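/- Fix an integer r ≥ 3 and a real ε > 0. Then the probability that H^r_{n,M} contains a perfect matching tends to 1 as n → ∞ through multiples of r, uniformly in M: for every ρ > 0 there is n₀ such that for every n ≥ n₀ divisible by r and every integer M with (1+ε)(n/r)·log n < M ≤ C(n,r), one has P(H^r_{n,M} contains a perfect matching) ≥ 1 − ρ. -/

import Mathlib

open Finset

/-- The set of perfect matchings of the `r`-graph `H` on vertex set `V`:
subsets of `H` consisting of pairwise disjoint edges whose union is `V`. -/
def pmSet (V : Finset ℕ) (H : Finset (Finset ℕ)) : Finset (Finset (Finset ℕ)) :=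
  H.powerset.filter (fun M => (∀ A ∈ M, ∀ B ∈ M, A ≠ B → A ∩ B = ∅) ∧ M.biUnion id = V)

/-- The number of perfect matchings of `H` (denoted `Φ(H)` in the paper). -/
def pmCount (V : Finset ℕ) (H : Finset (Finset ℕ)) : ℕ := (pmSet V H).card

/-- `Kn n r` is the collection of all `r`-element subsets of `[n] = {0,…,n-1}`. -/
def Kn (n r : ℕ) : Finset (Finset ℕ) := Finset.powersetCard r (Finset.range n)

set_option linter.unusedSectionVars false


section ExSec
variable {E : Type*} [DecidableEq E]

/-- Expectation of `f` over the random subset of `S` in which each element is kept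
independently with probability `p`. -/
noncomputable def Ex (p : ℝ) (S : Finset E) (f : Finset E → ℝ) : ℝ :=
  ∑ H ∈ S.powerset, p ^ (#H) * (1 - p) ^ (#S - #H) * f H

lemma Ex_empty (p : ℝ) (f : Finset E → ℝ) : Ex p ∅ f = f ∅ := by
  simp [Ex]

lemma Ex_insert (p : ℝ) {S : Finset E} {e : E} (he : e ∉ S) (f : Finset E → ℝ) :
    Ex p (insert e S) f = (1 - p) * Ex p S f + p * Ex p S (fun H => f (insert e H)) := by
  unfold Ex
  rw [Finset.sum_powerset_insert he, Finset.mul_sum, Finset.mul_sum]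
  congr 1
  · refine Finset.sum_congr rfl fun H hH => ?_
    have h1 : #H ≤ #S := Finset.card_le_card (Finset.mem_powerset.1 hH)
    rw [Finset.card_insert_of_notMem he, Nat.succ_sub h1, pow_succ]; ring
  · refine Finset.sum_congr rfl fun H hH => ?_
    have h1 : #H ≤ #S := Finset.card_le_card (Finset.mem_powerset.1 hH)
    have h2 : e ∉ H := fun h => he (Finset.mem_powerset.1 hH h)
    rw [Finset.card_insert_of_notMem he, Finset.card_insert_of_notMem h2,
      Nat.succ_sub_succ, pow_succ]; ring

lemma Ex_congr (p : ℝ) {S : Finset E} {f g : Finset E → ℝ} (h : ∀ H, H ⊆ S → f H = g H) :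
    Ex p S f = Ex p S g := by
  unfold Ex
  exact Finset.sum_congr rfl fun H hH => by rw [h H (Finset.mem_powerset.1 hH)]

lemma Ex_const (p : ℝ) (S : Finset E) (c : ℝ) : Ex p S (fun _ => c) = c := by
  induction S using Finset.induction_on with
  | empty => exact Ex_empty _ _
  | insert e S he ih => rw [Ex_insert p he, ih]; ring

lemma Ex_add (p : ℝ) (S : Finset E) (f g : Finset E → ℝ) :
    Ex p S (fun H => f H + g H) = Ex p S f + Ex p S g := by
  unfold Ex; rw [← Finset.sum_add_distrib]
  exact Finset.sum_congr rfl fun H _ => by ring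

lemma Ex_sub (p : ℝ) (S : Finset E) (f g : Finset E → ℝ) :
    Ex p S (fun H => f H - g H) = Ex p S f - Ex p S g := by
  unfold Ex; rw [← Finset.sum_sub_distrib]
  exact Finset.sum_congr rfl fun H _ => by ring

lemma Ex_mul (p : ℝ) (S : Finset E) (c : ℝ) (f : Finset E → ℝ) :
    Ex p S (fun H => c * f H) = c * Ex p S f := by
  unfold Ex; rw [Finset.mul_sum]
  exact Finset.sum_congr rfl fun H _ => by ring

lemma Ex_sum {ι : Type*} (p : ℝ) (S : Finset E) (s : Finset ι) (f : ι → Finset E → ℝ) :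
    Ex p S (fun H => ∑ i ∈ s, f i H) = ∑ i ∈ s, Ex p S (f i) := by
  unfold Ex; rw [Finset.sum_comm]
  exact Finset.sum_congr rfl fun H _ => by rw [Finset.mul_sum]

lemma Ex_mono {p : ℝ} (h0 : 0 ≤ p) (h1 : p ≤ 1) {S : Finset E} {f g : Finset E → ℝ}
    (h : ∀ H, H ⊆ S → f H ≤ g H) : Ex p S f ≤ Ex p S g := by
  unfold Ex
  refine Finset.sum_le_sum fun H hH => ?_
  have : 0 ≤ 1 - p := by linarith
  exact mul_le_mul_of_nonneg_left (h H (Finset.mem_powerset.1 hH)) (by positivity)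

lemma Ex_nonneg {p : ℝ} (h0 : 0 ≤ p) (h1 : p ≤ 1) {S : Finset E} {f : Finset E → ℝ}
    (h : ∀ H, H ⊆ S → 0 ≤ f H) : 0 ≤ Ex p S f := by
  have := Ex_mono h0 h1 (f := fun _ => (0:ℝ)) h
  rwa [Ex_const] at this

lemma Ex_le_const {p : ℝ} (h0 : 0 ≤ p) (h1 : p ≤ 1) {S : Finset E} {f : Finset E → ℝ} {c : ℝ}
    (h : ∀ H, H ⊆ S → f H ≤ c) : Ex p S f ≤ c := by
  have := Ex_mono h0 h1 (g := fun _ => c) h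
  rwa [Ex_const] at this

lemma Ex_union (p : ℝ) {A B : Finset E} (hAB : Disjoint A B) (f : Finset E → ℝ) :
    Ex p (A ∪ B) f = Ex p A (fun H₁ => Ex p B (fun H₂ => f (H₁ ∪ H₂))) := by
  induction A using Finset.induction_on generalizing f with
  | empty => simp [Ex_empty]
  | insert e A he ih =>
    rw [Finset.disjoint_insert_left] at hAB
    rw [Finset.insert_union, Ex_insert p (by simp [he, hAB.1]), Ex_insert p he, ih hAB.2, ih hAB.2]
    simp only [Finset.insert_union]

lemma Ex_split (p : ℝ) {S B : Finset E} (hB : B ⊆ S) (f : Finset E → ℝ) :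
    Ex p S f = Ex p (S \ B) (fun H₁ => Ex p B (fun H₂ => f (H₁ ∪ H₂))) := by
  rw [← Ex_union p Finset.sdiff_disjoint, Finset.sdiff_union_of_subset hB]

lemma Ex_miss (p : ℝ) {S A : Finset E} (hA : A ⊆ S) :
    Ex p S (fun H => if Disjoint A H then (1:ℝ) else 0) = (1 - p) ^ (#A) := by
  rw [Ex_split p hA]
  have : ∀ H₁, H₁ ⊆ S \ A → Ex p A (fun H₂ => if Disjoint A (H₁ ∪ H₂) then (1:ℝ) else 0)
      = (1 - p) ^ (#A) := by
    intro H₁ h1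
    unfold Ex
    rw [Finset.sum_eq_single ∅]
    · have : Disjoint A H₁ := (Finset.subset_sdiff.1 h1).2.symm
      simp [this]
    · intro H₂ h2 h3
      have h0 : ¬ Disjoint A (H₁ ∪ H₂) := by
        intro h
        apply h3
        have h4 := (Finset.disjoint_union_right.1 h).2
        exact Finset.eq_empty_of_forall_notMem fun a ha =>
          Finset.disjoint_right.1 h4 ha (Finset.mem_powerset.1 h2 ha)
      simp [h0]
    · simp
  rw [Ex_congr p this, Ex_const]

lemma Ex_card (p : ℝ) (S : Finset E) : Ex p S (fun H => (#H : ℝ)) = p * #S := by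
  induction S using Finset.induction_on with
  | empty => simp [Ex_empty]
  | insert e S he ih =>
    rw [Ex_insert p he, ih, Finset.card_insert_of_notMem he]
    rw [Ex_congr p (g := fun H => (#H : ℝ) + 1), Ex_add, Ex_const, ih]
    · push_cast; ring
    · intro H hH
      rw [Finset.card_insert_of_notMem (fun h => he (hH h))]; push_cast; ring

lemma Ex_card_sq (p : ℝ) (S : Finset E) :
    Ex p S (fun H => (#H : ℝ) ^ 2) = (p * #S) ^ 2 + p * (1 - p) * #S := by
  induction S using Finset.induction_on with
  | empty => simp [Ex_empty]
  | insert e S he ih =>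
    rw [Ex_insert p he, ih, Finset.card_insert_of_notMem he]
    rw [Ex_congr p (g := fun H => (#H : ℝ)^2 + (2 * (#H : ℝ) + 1)), Ex_add, Ex_add, Ex_mul,
      Ex_const, ih, Ex_card]
    · push_cast; ring
    · intro H hH
      rw [Finset.card_insert_of_notMem (fun h => he (hH h))]; push_cast; ring

lemma Ex_perm (p : ℝ) {S : Finset E} (σ : Equiv.Perm E) (hσ : S.map σ.toEmbedding = S)
    (f : Finset E → ℝ) : Ex p S (fun H => f (H.map σ.toEmbedding)) = Ex p S f := by
  unfold Ex
  have hσ2 : S.map σ.symm.toEmbedding = S := by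
    conv_lhs => rw [← hσ]
    rw [Finset.map_map]; ext; simp
  refine Finset.sum_nbij' (fun H => H.map σ.toEmbedding) (fun H => H.map σ.symm.toEmbedding)
    ?_ ?_ ?_ ?_ ?_
  · intro H hH
    rw [Finset.mem_powerset] at hH ⊢
    rw [← hσ]; exact Finset.map_subset_map.2 hH
  · intro H hH
    rw [Finset.mem_powerset] at hH ⊢
    rw [← hσ2]; exact Finset.map_subset_map.2 hH
  · intro H _; rw [Finset.map_map]; ext; simp
  · intro H _; rw [Finset.map_map]; ext; simp
  · intro H _; simp

lemma Ex_deriv (S : Finset E) (f : Finset E → ℝ) (p : ℝ) :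
    HasDerivAt (fun p => Ex p S f)
      (∑ e ∈ S, Ex p S (fun H => f (insert e H) - f (H.erase e))) p := by
  induction S using Finset.induction_on generalizing f with
  | empty => simp only [Ex_empty, Finset.sum_empty]; exact hasDerivAt_const _ _
  | insert e S he ih =>
    have h1 := ih f
    have h2 := ih (fun H => f (insert e H))
    have h3 : HasDerivAt (fun p : ℝ => 1 - p) (-1) p := by
      simpa using (hasDerivAt_id p).const_sub 1
    have h4 := (h3.mul h1).add ((hasDerivAt_id p).mul h2)
    have h5 : (fun p => Ex p (insert e S) f) = ((fun p : ℝ => 1 - p) * fun p => Ex p S f) +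
        (id * fun p => Ex p S (fun H => f (insert e H))) := by
      funext q; simp [Ex_insert q he]
    rw [h5]
    refine h4.congr_deriv (Eq.symm ?_)
    rw [Finset.sum_insert he, Ex_insert p he]
    have e1 : Ex p S (fun H => f (insert e H) - f (H.erase e)) =
        Ex p S (fun H => f (insert e H)) - Ex p S f := by
      rw [← Ex_sub]; apply Ex_congr; intro H hH
      rw [Finset.erase_eq_of_notMem (fun h => he (hH h))]
    have e2 : Ex p S (fun H => f (insert e (insert e H)) - f ((insert e H).erase e)) =
        Ex p S (fun H => f (insert e H)) - Ex p S f := by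
      rw [← Ex_sub]; apply Ex_congr; intro H hH
      rw [Finset.erase_insert (fun h => he (hH h)), Finset.insert_idem]
    have e3 : ∀ e' ∈ S, Ex p (insert e S) (fun H => f (insert e' H) - f (H.erase e')) =
        (1 - p) * Ex p S (fun H => f (insert e' H) - f (H.erase e')) +
        p * Ex p S (fun H => f (insert e (insert e' H)) - f (insert e (H.erase e'))) := by
      intro e' he'
      rw [Ex_insert p he]
      congr 2
      apply Ex_congr; intro H hH
      have : e ≠ e' := fun h => he (h ▸ he')
      rw [Finset.insert_comm, Finset.erase_insert_of_ne this]
    rw [e1, e2, Finset.sum_congr rfl e3, Finset.sum_add_distrib, ← Finset.mul_sum, ← Finset.mul_sum]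
    simp only [id]
    ring

lemma Ex_restrict (p : ℝ) {S B : Finset E} (hB : B ⊆ S) (f : Finset E → ℝ)
    (hf : ∀ H₁ H₂, H₁ ⊆ S \ B → H₂ ⊆ B → f (H₁ ∪ H₂) = f H₂) :
    Ex p S f = Ex p B f := by
  rw [Ex_split p hB, Ex_congr p (g := fun _ => Ex p B f), Ex_const]
  intro H₁ h1
  exact Ex_congr p fun H₂ h2 => hf H₁ H₂ h1 h2

lemma Ex_continuous (S : Finset E) (f : Finset E → ℝ) : Continuous (fun p => Ex p S f) :=
  continuous_iff_continuousAt.2 fun p => (Ex_deriv S f p).continuousAt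

end ExSec

/-- `M` is a matching of `H` consisting of `r`-edges inside `W`. -/
def IsMat (r : ℕ) (H : Finset (Finset ℕ)) (W : Finset ℕ) (M : Finset (Finset ℕ)) : Prop :=
  M ⊆ H ∧ (∀ A ∈ M, A ⊆ W ∧ #A = r) ∧ (∀ A ∈ M, ∀ B ∈ M, A ≠ B → Disjoint A B)

open Classical in
/-- Matching number of `H` inside `W`. -/
noncomputable def nu (r : ℕ) (H : Finset (Finset ℕ)) (W : Finset ℕ) : ℕ :=
  (H.powerset.filter (IsMat r H W)).sup card

section nuSec
variable {r : ℕ} {H H' : Finset (Finset ℕ)} {W W' : Finset ℕ} {M : Finset (Finset ℕ)}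

lemma IsMat.le_nu (h : IsMat r H W M) : #M ≤ nu r H W := by
  classical
  unfold nu
  exact Finset.le_sup (f := card) (by simp [h, h.1])

lemma exists_mat (r : ℕ) (H : Finset (Finset ℕ)) (W : Finset ℕ) :
    ∃ M, IsMat r H W M ∧ #M = nu r H W := by
  classical
  have hne : (H.powerset.filter (IsMat r H W)).Nonempty :=
    ⟨∅, by simp [IsMat]⟩
  obtain ⟨M, hM, h⟩ := Finset.exists_mem_eq_sup _ hne card
  exact ⟨M, (Finset.mem_filter.1 hM).2, h.symm⟩

lemma IsMat.card_union (h : IsMat r H W M) : #(M.biUnion id) = r * #M := by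
  rw [Finset.card_biUnion (t := id) (fun A hA B hB hAB => h.2.2 A hA B hB hAB)]
  rw [Finset.sum_congr rfl (fun A hA => show #(id A) = r from (h.2.1 A hA).2)]
  simp [mul_comm]

lemma IsMat.union_subset (h : IsMat r H W M) : M.biUnion id ⊆ W :=
  Finset.biUnion_subset.2 fun A hA => (h.2.1 A hA).1

lemma mul_nu_le (r : ℕ) (H : Finset (Finset ℕ)) (W : Finset ℕ) : r * nu r H W ≤ #W := by
  obtain ⟨M, hM, h⟩ := exists_mat r H W
  rw [← h, ← hM.card_union]
  exact Finset.card_le_card hM.union_subset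

lemma IsMat.mono (h : IsMat r H W M) (hH : ∀ A ∈ M, A ∈ H') (hW : ∀ A ∈ M, A ⊆ W') :
    IsMat r H' W' M :=
  ⟨hH, fun A hA => ⟨hW A hA, (h.2.1 A hA).2⟩, h.2.2⟩

lemma nu_mono (hH : H ⊆ H') (hW : W ⊆ W') : nu r H W ≤ nu r H' W' := by
  obtain ⟨M, hM, h⟩ := exists_mat r H W
  rw [← h]
  exact (hM.mono (fun A hA => hH (hM.1 hA)) (fun A hA => (hM.2.1 A hA).1.trans hW)).le_nu

lemma nu_le_of_congr (h : ∀ e, #e = r → e ⊆ W → e ∈ H → e ∈ H') : nu r H W ≤ nu r H' W := by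
  obtain ⟨M, hM, h'⟩ := exists_mat r H W
  rw [← h']
  exact (hM.mono (fun A hA => h A (hM.2.1 A hA).2 (hM.2.1 A hA).1 (hM.1 hA))
    (fun A hA => (hM.2.1 A hA).1)).le_nu

lemma nu_congr (h : ∀ e, #e = r → e ⊆ W → (e ∈ H ↔ e ∈ H')) : nu r H W = nu r H' W :=
  le_antisymm (nu_le_of_congr fun e h1 h2 => (h e h1 h2).1)
    (nu_le_of_congr fun e h1 h2 => (h e h1 h2).2)

lemma IsMat.erase (h : IsMat r H W M) (A : Finset ℕ) : IsMat r H W (M.erase A) :=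
  ⟨(Finset.erase_subset _ _).trans h.1, fun B hB => h.2.1 B (Finset.mem_of_mem_erase hB),
    fun B hB C hC => h.2.2 B (Finset.mem_of_mem_erase hB) C (Finset.mem_of_mem_erase hC)⟩

lemma nu_insert_le (r : ℕ) (H : Finset (Finset ℕ)) (W : Finset ℕ) (v : ℕ) :
    nu r H (insert v W) ≤ nu r H W + 1 := by
  obtain ⟨M, hM, h⟩ := exists_mat r H (insert v W)
  by_cases hv : ∃ A ∈ M, v ∈ A
  · obtain ⟨A, hA, hvA⟩ := hv
    have h1 : IsMat r H W (M.erase A) := by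
      refine (hM.erase A).mono (fun B hB => hM.1 (Finset.mem_of_mem_erase hB)) ?_
      intro B hB x hx
      have h2 := hM.2.1 B (Finset.mem_of_mem_erase hB)
      rcases Finset.mem_insert.1 (h2.1 hx) with h3 | h3
      · exfalso
        subst h3
        exact Finset.disjoint_left.1 (hM.2.2 B (Finset.mem_of_mem_erase hB) A hA
          (Finset.ne_of_mem_erase hB)) hx hvA
      · exact h3
    have := h1.le_nu
    rw [Finset.card_erase_of_mem hA] at this
    omega
  · push Not at hv
    have h1 : IsMat r H W M := hM.mono (fun B hB => hM.1 hB) (fun B hB x hx => by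
      rcases Finset.mem_insert.1 ((hM.2.1 B hB).1 hx) with h3 | h3
      · subst h3; exact absurd hx (hv B hB)
      · exact h3)
    have := h1.le_nu
    omega

lemma nu_add_edge (hr : 1 ≤ r) {e : Finset ℕ} (he : e ∈ H) (hc : #e = r) (hW : e ⊆ W) :
    nu r H (W \ e) + 1 ≤ nu r H W := by
  obtain ⟨M, hM, h⟩ := exists_mat r H (W \ e)
  have hne : e.Nonempty := Finset.card_pos.1 (by omega)
  have hd : ∀ A ∈ M, Disjoint A e := fun A hA => (Finset.subset_sdiff.1 (hM.2.1 A hA).1).2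
  have hn : e ∉ M := fun h' => by
    have := hd e h'
    rw [disjoint_self] at this
    exact hne.ne_empty this
  have h1 : IsMat r H W (insert e M) := by
    refine ⟨Finset.insert_subset he hM.1, ?_, ?_⟩
    · intro A hA
      rcases Finset.mem_insert.1 hA with rfl | hA
      · exact ⟨hW, hc⟩
      · exact ⟨(hM.2.1 A hA).1.trans Finset.sdiff_subset, (hM.2.1 A hA).2⟩
    · intro A hA B hB hAB
      rcases Finset.mem_insert.1 hA with hA1 | hA1 <;> rcases Finset.mem_insert.1 hB with hB1 | hB1
      · exact absurd (hA1.trans hB1.symm) hAB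
      · rw [hA1]; exact (hd B hB1).symm
      · rw [hB1]; exact hd A hA1
      · exact hM.2.2 A hA1 B hB1 hAB
  have := h1.le_nu
  rw [Finset.card_insert_of_notMem hn] at this
  omega

lemma nu_succ_iff (hr : 1 ≤ r) {v : ℕ} (hv : v ∉ W) :
    nu r H (insert v W) = nu r H W + 1 ↔
      ∃ Y ∈ powersetCard (r - 1) W, insert v Y ∈ H ∧ nu r H (W \ Y) = nu r H W := by
  constructor
  · intro h
    obtain ⟨M, hM, hc⟩ := exists_mat r H (insert v W)
    have hex : ∃ A ∈ M, v ∈ A := by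
      by_contra hcon
      push Not at hcon
      have h1 : IsMat r H W M := hM.mono (fun B hB => hM.1 hB) (fun B hB x hx => by
        rcases Finset.mem_insert.1 ((hM.2.1 B hB).1 hx) with h3 | h3
        · subst h3; exact absurd hx (hcon B hB)
        · exact h3)
      have := h1.le_nu
      omega
    obtain ⟨A, hA, hvA⟩ := hex
    have hAp := hM.2.1 A hA
    refine ⟨A.erase v, ?_, ?_, ?_⟩
    · rw [Finset.mem_powersetCard]
      refine ⟨?_, by rw [Finset.card_erase_of_mem hvA, hAp.2]⟩
      intro x hx
      rcases Finset.mem_insert.1 (hAp.1 (Finset.mem_of_mem_erase hx)) with h3 | h3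
      · exact absurd h3 (Finset.ne_of_mem_erase hx)
      · exact h3
    · rw [Finset.insert_erase hvA]; exact hM.1 hA
    · apply le_antisymm (nu_mono (Finset.Subset.refl _) Finset.sdiff_subset)
      have h1 : IsMat r H (W \ A.erase v) (M.erase A) := by
        refine (hM.erase A).mono (fun B hB => hM.1 (Finset.mem_of_mem_erase hB)) ?_
        intro B hB x hx
        have hBM := Finset.mem_of_mem_erase hB
        have hd := hM.2.2 B hBM A hA (Finset.ne_of_mem_erase hB)
        have hxA := Finset.disjoint_left.1 hd hx
        rcases Finset.mem_insert.1 ((hM.2.1 B hBM).1 hx) with h3 | h3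
        · subst h3; exact absurd hvA hxA
        · simp [h3, hxA]
      have := h1.le_nu
      rw [Finset.card_erase_of_mem hA] at this
      omega
  · rintro ⟨Y, hY, hYH, hYn⟩
    rw [Finset.mem_powersetCard] at hY
    have hvY : v ∉ Y := fun h => hv (hY.1 h)
    have h1 := nu_add_edge (r := r) hr hYH (by rw [Finset.card_insert_of_notMem hvY]; omega)
      (Finset.insert_subset_insert v hY.1)
    have h2 : insert v W \ insert v Y = W \ Y := by
      ext x; simp only [mem_sdiff, mem_insert]
      constructor
      · rintro ⟨h3 | h3, h4⟩
        · exact absurd (Or.inl h3) h4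
        · exact ⟨h3, fun h5 => h4 (Or.inr h5)⟩
      · rintro ⟨h3, h4⟩
        refine ⟨Or.inr h3, ?_⟩
        rintro (rfl | h5)
        · exact hv h3
        · exact h4 h5
    rw [h2, hYn] at h1
    have := nu_insert_le r H W v
    omega

lemma exists_unc (r : ℕ) (H : Finset (Finset ℕ)) (W : Finset ℕ) :
    ∃ U, U ⊆ W ∧ #U + r * nu r H W = #W ∧ (∀ Z, Z ⊆ U → nu r H (W \ Z) = nu r H W) := by
  obtain ⟨M, hM, h⟩ := exists_mat r H W
  refine ⟨W \ M.biUnion id, Finset.sdiff_subset, ?_, ?_⟩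
  · rw [← h, ← hM.card_union]
    exact Finset.card_sdiff_add_card_eq_card hM.union_subset
  · intro Z hZ
    apply le_antisymm (nu_mono (Finset.Subset.refl _) Finset.sdiff_subset)
    rw [← h]
    refine IsMat.le_nu (hM.mono hM.1 ?_)
    intro A hA x hx
    rw [mem_sdiff]
    refine ⟨(hM.2.1 A hA).1 hx, fun hxZ => ?_⟩
    have := hZ hxZ
    rw [mem_sdiff] at this
    exact this.2 (Finset.mem_biUnion.2 ⟨A, hA, hx⟩)

lemma nu_filter (r : ℕ) (H : Finset (Finset ℕ)) {W W' : Finset ℕ} (hW : W' ⊆ W) :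
    nu r (H.filter (· ⊆ W)) W' = nu r H W' :=
  nu_congr fun e _ h => by simp [h.trans hW]

/-- The set of vertices left uncovered by a chosen maximum matching. -/
noncomputable def unc (r : ℕ) (H : Finset (Finset ℕ)) (W : Finset ℕ) : Finset ℕ :=
  (exists_unc r (H.filter (· ⊆ W)) W).choose

lemma unc_subset : unc r H W ⊆ W := (exists_unc r (H.filter (· ⊆ W)) W).choose_spec.1
lemma unc_card : #(unc r H W) + r * nu r H W = #W := by
  have h : #(unc r H W) + r * nu r (H.filter (· ⊆ W)) W = #W :=
    (exists_unc r (H.filter (· ⊆ W)) W).choose_spec.2.1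
  rwa [nu_filter r H (Subset.refl _)] at h
lemma unc_nu {Z : Finset ℕ} (hZ : Z ⊆ unc r H W) : nu r H (W \ Z) = nu r H W := by
  have := (exists_unc r (H.filter (· ⊆ W)) W).choose_spec.2.2 Z hZ
  rwa [nu_filter r H (Subset.refl _), nu_filter r H Finset.sdiff_subset] at this

lemma unc_indep (hr : 1 ≤ r) {e : Finset ℕ} (hc : #e = r) (he : e ⊆ unc r H W) : e ∉ H := by
  intro h
  have h1 := nu_add_edge (W := W) hr h hc (he.trans unc_subset)
  rw [unc_nu he] at h1
  omega

lemma nu_perm_le (σ : Equiv.Perm ℕ) :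
    nu r H W ≤ nu r (H.map σ.finsetCongr.toEmbedding) (W.map σ.toEmbedding) := by
  obtain ⟨M, hM, h⟩ := exists_mat r H W
  have h1 : IsMat r (H.map σ.finsetCongr.toEmbedding) (W.map σ.toEmbedding)
      (M.map σ.finsetCongr.toEmbedding) := by
    refine ⟨Finset.map_subset_map.2 hM.1, ?_, ?_⟩
    · intro A hA
      obtain ⟨B, hB, rfl⟩ := Finset.mem_map.1 hA
      simp only [Equiv.coe_toEmbedding, Equiv.finsetCongr_apply, card_map]
      exact ⟨Finset.map_subset_map.2 (hM.2.1 B hB).1, (hM.2.1 B hB).2⟩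
    · intro A hA A' hA' hne
      obtain ⟨B, hB, rfl⟩ := Finset.mem_map.1 hA
      obtain ⟨B', hB', rfl⟩ := Finset.mem_map.1 hA'
      simp only [Equiv.coe_toEmbedding, Equiv.finsetCongr_apply] at hne ⊢
      rw [Finset.disjoint_map]
      exact hM.2.2 B hB B' hB' (fun h => hne (by rw [h]))
  have := h1.le_nu
  rw [card_map] at this
  omega

lemma nu_perm (σ : Equiv.Perm ℕ) :
    nu r (H.map σ.finsetCongr.toEmbedding) (W.map σ.toEmbedding) = nu r H W := by
  apply le_antisymm _ (nu_perm_le σ)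
  have h := nu_perm_le (r := r) (H := H.map σ.finsetCongr.toEmbedding)
    (W := W.map σ.toEmbedding) σ.symm
  have e1 : (W.map σ.toEmbedding).map σ.symm.toEmbedding = W := by
    rw [Finset.map_map]; ext; simp
  have e2 : (H.map σ.finsetCongr.toEmbedding).map σ.symm.finsetCongr.toEmbedding = H := by
    rw [Finset.map_map]
    have : σ.finsetCongr.toEmbedding.trans σ.symm.finsetCongr.toEmbedding =
        Function.Embedding.refl _ := by
      ext A x
      simp
    rw [this, Finset.map_refl]
  rwa [e1, e2] at h

lemma nu_russo (hr : 1 ≤ r) {e : Finset ℕ} (hc : #e = r) (hW : e ⊆ W) :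
    (if nu r H (W \ e) = nu r H W then 1 else 0) + nu r (H.erase e) W ≤ nu r (insert e H) W := by
  have h1 : nu r (H.erase e) W ≤ nu r H W := nu_mono (Finset.erase_subset _ _) (Subset.refl _)
  have h2 : nu r H W ≤ nu r (insert e H) W := nu_mono (Finset.subset_insert _ _) (Subset.refl _)
  split_ifs with h
  · have h3 := nu_add_edge (W := W) hr (Finset.mem_insert_self e H) hc hW
    have h4 : nu r H (W \ e) ≤ nu r (insert e H) (W \ e) :=
      nu_mono (Finset.subset_insert _ _) (Subset.refl _)
    omega
  · omega

lemma pm_of_nu {n : ℕ} (h : r * nu r H (range n) = n) (hpm : Finset (Finset ℕ) → ℕ)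
    (hdef : ∀ H, hpm H = #(H.powerset.filter
      (fun M => (∀ A ∈ M, ∀ B ∈ M, A ≠ B → A ∩ B = ∅) ∧ M.biUnion id = range n))) :
    0 < hpm H := by
  obtain ⟨M, hM, hc⟩ := exists_mat r H (range n)
  rw [hdef, Finset.card_pos]
  refine ⟨M, ?_⟩
  rw [mem_filter, mem_powerset]
  refine ⟨hM.1, fun A hA B hB hAB => Finset.disjoint_iff_inter_eq_empty.1 (hM.2.2 A hA B hB hAB), ?_⟩
  apply Finset.eq_of_subset_of_card_le hM.union_subset
  rw [hM.card_union, hc, h, card_range]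

end nuSec

lemma exists_perm_map {m : ℕ} {Y Y' : Finset ℕ} (hY : Y ⊆ range m) (hY' : Y' ⊆ range m)
    (hc : #Y = #Y') : ∃ σ : Equiv.Perm ℕ, Y.map σ.toEmbedding = Y' ∧ ∀ x, m ≤ x → σ x = x := by
  classical
  let P : {x // x ∈ range m} → Prop := fun x => x.1 ∈ Y
  let P' : {x // x ∈ range m} → Prop := fun x => x.1 ∈ Y'
  have e1 : {x : {x // x ∈ range m} // P x} ≃ {x // x ∈ Y} :=
    { toFun := fun x => ⟨x.1.1, x.2⟩
      invFun := fun x => ⟨⟨x.1, hY x.2⟩, x.2⟩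
      left_inv := fun x => rfl
      right_inv := fun x => rfl }
  have e2 : {x : {x // x ∈ range m} // P' x} ≃ {x // x ∈ Y'} :=
    { toFun := fun x => ⟨x.1.1, x.2⟩
      invFun := fun x => ⟨⟨x.1, hY' x.2⟩, x.2⟩
      left_inv := fun x => rfl
      right_inv := fun x => rfl }
  let e := (e1.trans (Finset.equivOfCardEq hc)).trans e2.symm
  let τ : Equiv.Perm {x // x ∈ range m} := e.extendSubtype
  let σ : Equiv.Perm ℕ := Equiv.Perm.ofSubtype τ
  have hσ : ∀ x (h : x ∈ range m), σ x = (τ ⟨x, h⟩).1 := fun x h =>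
    Equiv.Perm.ofSubtype_apply_of_mem τ h
  refine ⟨σ, ?_, ?_⟩
  · apply Finset.eq_of_subset_of_card_le
    · intro y hy
      obtain ⟨x, hx, rfl⟩ := Finset.mem_map.1 hy
      rw [Equiv.coe_toEmbedding, hσ x (hY hx)]
      exact e.extendSubtype_mem ⟨x, hY hx⟩ hx
    · rw [card_map, hc]
  · intro x hx
    exact Equiv.Perm.ofSubtype_apply_of_not_mem τ (by simp [hx])

lemma range_map_perm {m k : ℕ} (hk : m ≤ k) {σ : Equiv.Perm ℕ} (hσ : ∀ x, m ≤ x → σ x = x) :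
    (range k).map σ.toEmbedding = range k := by
  apply Finset.eq_of_subset_of_card_le
  · intro y hy
    obtain ⟨x, hx, rfl⟩ := Finset.mem_map.1 hy
    rw [Equiv.coe_toEmbedding, mem_range]
    by_contra h
    push Not at h
    have h1 := hσ (σ x) (by omega)
    have := σ.injective h1
    rw [this] at h
    simp at hx; omega
  · simp

lemma powersetCard_map_perm {r m Q : ℕ} (hk : m ≤ Q) {σ : Equiv.Perm ℕ}
    (hσ : ∀ x, m ≤ x → σ x = x) :
    (powersetCard r (range Q)).map σ.finsetCongr.toEmbedding = powersetCard r (range Q) := by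
  apply Finset.eq_of_subset_of_card_le
  · intro y hy
    obtain ⟨x, hx, rfl⟩ := Finset.mem_map.1 hy
    rw [mem_powersetCard] at hx ⊢
    rw [Equiv.coe_toEmbedding, Equiv.finsetCongr_apply, card_map]
    refine ⟨?_, hx.2⟩
    rw [← range_map_perm hk hσ]
    exact Finset.map_subset_map.2 hx.1
  · simp

/-- Expectation in the binomial random `r`-graph on `range Q`. -/
noncomputable def EQ (r Q : ℕ) (p : ℝ) (f : Finset (Finset ℕ) → ℝ) : ℝ :=
  Ex p (powersetCard r (range Q)) f

/-- Invariance under permutations of `range m`. -/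
def PInv (m : ℕ) (f : Finset (Finset ℕ) → Finset ℕ → ℝ) : Prop :=
  ∀ σ : Equiv.Perm ℕ, (∀ x, m ≤ x → σ x = x) → ∀ H Y,
    f (H.map σ.finsetCongr.toEmbedding) (Y.map σ.toEmbedding) = f H Y

lemma exch {r Q m : ℕ} (hm : m ≤ Q) (p : ℝ) {f : Finset (Finset ℕ) → Finset ℕ → ℝ}
    (hf : PInv m f) {Y Y' : Finset ℕ} (hY : Y ⊆ range m) (hY' : Y' ⊆ range m) (hc : #Y = #Y') :
    EQ r Q p (fun H => f H Y) = EQ r Q p (fun H => f H Y') := by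
  obtain ⟨σ, h1, h2⟩ := exists_perm_map hY hY' hc
  unfold EQ
  rw [← Ex_perm p σ.finsetCongr (powersetCard_map_perm hm h2) (fun H => f H Y')]
  apply Ex_congr
  intro H _
  rw [← h1, hf σ h2]

lemma exch_avg {r Q m k : ℕ} (hm : m ≤ Q) (p : ℝ) {f : Finset (Finset ℕ) → Finset ℕ → ℝ}
    (hf : PInv m f) {Y : Finset ℕ} (hY : Y ∈ powersetCard k (range m)) :
    EQ r Q p (fun H => ∑ Z ∈ powersetCard k (range m), f H Z) =
      (m.choose k : ℝ) * EQ r Q p (fun H => f H Y) := by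
  unfold EQ
  rw [Ex_sum]
  rw [mem_powersetCard] at hY
  rw [Finset.sum_congr rfl (g := fun _ => EQ r Q p (fun H => f H Y))]
  · simp [EQ]
  · intro Z hZ
    rw [mem_powersetCard] at hZ
    exact exch hm p hf hZ.1 hY.1 (hZ.2.trans hY.2.symm)

/-- `f` depends only on the edges inside `range m`. -/
def Past {α : Type*} (m : ℕ) (f : Finset (Finset ℕ) → α) : Prop :=
  ∀ H H', (∀ e, e ⊆ range m → (e ∈ H ↔ e ∈ H')) → f H = f H'

/-- The star of vertex `m` in `range (m+1)`. -/
def vstar (r m : ℕ) : Finset (Finset ℕ) := (powersetCard (r - 1) (range m)).image (insert m)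

lemma vstar_inj {r m : ℕ} {Y Y' : Finset ℕ} (hY : Y ∈ powersetCard (r - 1) (range m))
    (hY' : Y' ∈ powersetCard (r - 1) (range m)) (h : insert m Y = insert m Y') : Y = Y' := by
  rw [mem_powersetCard] at hY hY'
  have a : m ∉ Y := fun h => by simpa using hY.1 h
  have b : m ∉ Y' := fun h => by simpa using hY'.1 h
  rw [← Finset.erase_insert a, h, Finset.erase_insert b]

lemma card_star (r m : ℕ) : #(vstar r m) = m.choose (r - 1) := by
  unfold vstar
  rw [Finset.card_image_of_injOn (fun Y hY Y' hY' h => vstar_inj hY hY' h)]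
  simp

lemma star_subset {r m Q : ℕ} (hr : 1 ≤ r) (hm : m < Q) : vstar r m ⊆ powersetCard r (range Q) := by
  intro e he
  obtain ⟨Y, hY, rfl⟩ := Finset.mem_image.1 he
  rw [mem_powersetCard] at hY ⊢
  have a : m ∉ Y := fun h => by simpa using hY.1 h
  refine ⟨?_, by rw [card_insert_of_notMem a]; omega⟩
  apply Finset.insert_subset (by simpa using hm)
  exact hY.1.trans (Finset.range_subset_range.2 hm.le)

lemma star_not_sub {r m : ℕ} {e : Finset ℕ} (he : e ∈ vstar r m) : ¬ e ⊆ range m := by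
  obtain ⟨Y, hY, rfl⟩ := Finset.mem_image.1 he
  intro h
  simpa using h (mem_insert_self m Y)

lemma Past.union {α : Type*} {m r : ℕ} {f : Finset (Finset ℕ) → α} (hf : Past m f)
    {H₁ H₂ : Finset (Finset ℕ)} (h2 : H₂ ⊆ vstar r m) : f (H₁ ∪ H₂) = f H₁ := by
  apply hf
  intro e he
  rw [mem_union]
  constructor
  · rintro (h | h)
    · exact h
    · exact absurd he (star_not_sub (h2 h))
  · exact Or.inl

lemma star_miss {r m Q : ℕ} (hr : 1 ≤ r) (hm : m < Q) (p : ℝ)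
    {w : Finset (Finset ℕ) → ℝ} (hw : Past m w)
    {N : Finset (Finset ℕ) → Finset (Finset ℕ)} (hN : Past m N)
    (hNs : ∀ H, N H ⊆ powersetCard (r - 1) (range m)) :
    EQ r Q p (fun H => w H * (if ∀ Y ∈ N H, insert m Y ∉ H then (1:ℝ) else 0)) =
      EQ r Q p (fun H => w H * (1 - p) ^ #(N H)) := by
  unfold EQ
  rw [Ex_split p (star_subset hr hm), Ex_split p (star_subset hr hm)]
  apply Ex_congr
  intro H₁ h1
  rw [Ex_congr p (g := fun H₂ => w H₁ *
    (if Disjoint ((N H₁).image (insert m)) H₂ then (1:ℝ) else 0)), Ex_mul, Ex_miss]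
  · rw [Ex_congr p (g := fun _ => w H₁ * (1 - p) ^ #(N H₁)), Ex_const]
    · rw [Finset.card_image_of_injOn (fun Y hY Y' hY' h => vstar_inj (hNs _ hY) (hNs _ hY') h)]
    · intro H₂ h2
      rw [hw.union h2, hN.union h2]
  · exact Finset.image_subset_image (hNs _)
  · intro H₂ h2
    rw [hw.union h2, hN.union h2]
    congr 1
    apply if_congr _ rfl rfl
    rw [Finset.disjoint_left]
    constructor
    · intro h e he heH
      obtain ⟨Y, hY, rfl⟩ := Finset.mem_image.1 he
      exact h Y hY (mem_union_right _ heH)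
    · intro h Y hY hYH
      have hs : insert m Y ∈ vstar r m := Finset.mem_image_of_mem _ (hNs _ hY)
      rcases mem_union.1 hYH with h3 | h3
      · exact (mem_sdiff.1 (h1 h3)).2 hs
      · exact h (Finset.mem_image_of_mem _ hY) h3

lemma star_deg {r m Q : ℕ} (hr : 1 ≤ r) (hm : m < Q) (p : ℝ)
    {w : Finset (Finset ℕ) → ℝ} (hw : Past m w) :
    EQ r Q p (fun H => w H * (#(H ∩ vstar r m) : ℝ) ^ 2) =
      EQ r Q p w * ((p * m.choose (r - 1)) ^ 2 + p * (1 - p) * m.choose (r - 1)) := by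
  unfold EQ
  rw [Ex_split p (star_subset hr hm), Ex_split p (star_subset hr hm), mul_comm, ← Ex_mul]
  apply Ex_congr
  intro H₁ h1
  rw [Ex_congr p (g := fun H₂ => w H₁ * (#H₂ : ℝ) ^ 2), Ex_mul, Ex_card_sq, card_star,
    Ex_congr p (f := fun H₂ => w (H₁ ∪ H₂)) (g := fun _ => w H₁), Ex_const, mul_comm]
  · intro H₂ h2
    rw [hw.union h2]
  · intro H₂ h2
    rw [hw.union h2, Finset.union_inter_distrib_right, Finset.inter_eq_left.2 h2]
    have : H₁ ∩ vstar r m = ∅ := by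
      rw [← Finset.disjoint_iff_inter_eq_empty]
      exact (Finset.subset_sdiff.1 h1).2
    rw [this, Finset.empty_union]

noncomputable def nv (r : ℕ) (H : Finset (Finset ℕ)) (m : ℕ) : ℕ := nu r H (range m)

/-- Missable `(r-1)`-sets. -/
noncomputable def Nn (r : ℕ) (H : Finset (Finset ℕ)) (m : ℕ) : Finset (Finset ℕ) :=
  (powersetCard (r - 1) (range m)).filter (fun Y => nu r H (range m \ Y) = nv r H m)

/-- Missable `r`-sets. -/
noncomputable def FF (r : ℕ) (H : Finset (Finset ℕ)) (m : ℕ) : Finset (Finset ℕ) :=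
  (powersetCard r (range m)).filter (fun Y => nu r H (range m \ Y) = nv r H m)

noncomputable def xx (r : ℕ) (H : Finset (Finset ℕ)) (m : ℕ) : ℝ := m - r * nv r H m
noncomputable def inc (r : ℕ) (H : Finset (Finset ℕ)) (m : ℕ) : ℝ := (nv r H (m + 1) : ℝ) - nv r H m
noncomputable def al (r : ℕ) (H : Finset (Finset ℕ)) (m : ℕ) : ℝ := #(Nn r H m) / m.choose (r - 1)
noncomputable def NB (r : ℕ) (H : Finset (Finset ℕ)) (m : ℕ) : ℝ :=
  if nv r H (m - (r - 1)) = nv r H m then 1 else 0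
noncomputable def bb (r Q : ℕ) (p : ℝ) (m : ℕ) : ℝ :=
  EQ r Q p (fun H => if nv r H (m - r) = nv r H m then 1 else 0)

lemma past_nu {r m : ℕ} {W : Finset ℕ} (hW : W ⊆ range m) : Past m (fun H => nu r H W) :=
  fun _ _ h => nu_congr fun e _ he => h e (he.trans hW)

lemma past_nv (r m : ℕ) : Past m (fun H => nv r H m) := past_nu (Subset.refl _)

lemma past_Nn (r m : ℕ) : Past m (fun H => Nn r H m) := by
  intro H H' h
  unfold Nn
  apply Finset.filter_congr
  intro Y _
  have h1 : nv r H m = nv r H' m := past_nv r m H H' h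
  have h2 : nu r H (range m \ Y) = nu r H' (range m \ Y) := past_nu sdiff_subset H H' h
  rw [h1, h2]

lemma past_unc {r m : ℕ} {W : Finset ℕ} (hW : W ⊆ range m) : Past m (fun H => unc r H W) := by
  intro H H' h
  have : H.filter (· ⊆ W) = H'.filter (· ⊆ W) := by
    ext e
    simp only [mem_filter]
    constructor
    · rintro ⟨h1, h2⟩; exact ⟨(h e (h2.trans hW)).1 h1, h2⟩
    · rintro ⟨h1, h2⟩; exact ⟨(h e (h2.trans hW)).2 h1, h2⟩
  simp only [unc, this]

lemma Nn_subset (r : ℕ) (H : Finset (Finset ℕ)) (m : ℕ) :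
    Nn r H m ⊆ powersetCard (r - 1) (range m) := Finset.filter_subset _ _

lemma nv_succ_le (r : ℕ) (H : Finset (Finset ℕ)) (m : ℕ) : nv r H (m + 1) ≤ nv r H m + 1 := by
  unfold nv; rw [Finset.range_add_one]; exact nu_insert_le _ _ _ _

lemma nv_mono (r : ℕ) (H : Finset (Finset ℕ)) {m k : ℕ} (h : m ≤ k) : nv r H m ≤ nv r H k :=
  nu_mono (Subset.refl _) (Finset.range_subset_range.2 h)

lemma inc_eq {r : ℕ} (hr : 1 ≤ r) (H : Finset (Finset ℕ)) (m : ℕ) :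
    inc r H m = 1 - (if ∀ Y ∈ Nn r H m, insert m Y ∉ H then (1:ℝ) else 0) := by
  have hk := nu_succ_iff (H := H) (W := range m) hr (v := m) (by simp)
  rw [← Finset.range_add_one] at hk
  have h1 := nv_succ_le r H m
  have h2 := nv_mono r H (Nat.le_succ m)
  unfold inc
  split_ifs with h
  · have : nv r H (m + 1) ≠ nv r H m + 1 := by
      intro h3
      obtain ⟨Y, hY, hY1, hY2⟩ := hk.1 h3
      exact h Y (by unfold Nn; rw [mem_filter]; exact ⟨hY, hY2⟩) hY1
    have : nv r H (m + 1) = nv r H m := by simp at h2; omega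
    rw [this]; ring
  · push Not at h
    obtain ⟨Y, hY, hY1⟩ := h
    unfold Nn at hY
    rw [mem_filter] at hY
    have : nv r H (m + 1) = nv r H m + 1 := hk.2 ⟨Y, hY.1, hY1, hY.2⟩
    rw [this]; push_cast; ring

lemma E_one_sub_inc {r Q m : ℕ} (hr : 1 ≤ r) (hm : m < Q) (p : ℝ)
    {w : Finset (Finset ℕ) → ℝ} (hw : Past m w) :
    EQ r Q p (fun H => w H * (1 - inc r H m)) = EQ r Q p (fun H => w H * (1 - p) ^ #(Nn r H m)) := by
  rw [← star_miss hr hm p hw (past_Nn r m) (fun H => Nn_subset r H m)]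
  congr 1; funext H
  rw [inc_eq hr]; ring

lemma E_inc {r Q m : ℕ} (hr : 1 ≤ r) (hm : m < Q) (p : ℝ)
    {w : Finset (Finset ℕ) → ℝ} (hw : Past m w) :
    EQ r Q p (fun H => w H * inc r H m) =
      EQ r Q p (fun H => w H * (1 - (1 - p) ^ #(Nn r H m))) := by
  have h := E_one_sub_inc hr hm p hw
  unfold EQ at h ⊢
  have h1 : ∀ H, w H * inc r H m = w H - w H * (1 - inc r H m) := fun H => by ring
  have h2 : ∀ H, w H * (1 - (1 - p) ^ #(Nn r H m)) = w H - w H * (1 - p) ^ #(Nn r H m) :=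
    fun H => by ring
  simp only [h1, h2, Ex_sub, h]

lemma map_sdiff_perm (σ : Equiv.Perm ℕ) (A B : Finset ℕ) :
    (A \ B).map σ.toEmbedding = A.map σ.toEmbedding \ B.map σ.toEmbedding := by
  ext x; simp [mem_map_equiv]

lemma pinv_nu {m : ℕ} (r : ℕ) {Φ : ℕ → ℕ → ℕ → ℝ} :
    PInv m (fun H Y => Φ (nv r H m) (nv r H (m + 1)) (nu r H (range m \ Y))) := by
  intro σ hσ H Y
  have h1 : nv r (H.map σ.finsetCongr.toEmbedding) m = nv r H m := by
    unfold nv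
    conv_lhs => rw [← range_map_perm le_rfl hσ]
    exact nu_perm σ
  have h2 : nv r (H.map σ.finsetCongr.toEmbedding) (m + 1) = nv r H (m + 1) := by
    unfold nv
    conv_lhs => rw [← range_map_perm (Nat.le_succ m) hσ]
    exact nu_perm σ
  have h3 : nu r (H.map σ.finsetCongr.toEmbedding) (range m \ Y.map σ.toEmbedding) =
      nu r H (range m \ Y) := by
    conv_lhs => rw [← range_map_perm le_rfl hσ, ← map_sdiff_perm]
    exact nu_perm σ
  simp only [h1, h2, h3]

lemma range_sdiff_tail {m k : ℕ} (hk : k ≤ m) :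
    range m \ (range m \ range (m - k)) = range (m - k) := by
  ext x; simp only [mem_sdiff, mem_range]; omega

lemma tail_mem {m k : ℕ} (hk : k ≤ m) : range m \ range (m - k) ∈ powersetCard k (range m) := by
  rw [mem_powersetCard]
  refine ⟨sdiff_subset, ?_⟩
  rw [Finset.card_sdiff_of_subset (Finset.range_subset_range.2 (Nat.sub_le _ _)), card_range, card_range]
  omega

lemma exch_nu {r Q m k : ℕ} (hm : m ≤ Q) (hk : k ≤ m) (p : ℝ) (Ψ : ℕ → ℕ → ℝ) :
    EQ r Q p (fun H => Ψ (nv r H m) (nv r H (m + 1)) *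
      #((powersetCard k (range m)).filter (fun Y => nu r H (range m \ Y) = nv r H m))) =
    (m.choose k : ℝ) * EQ r Q p (fun H => Ψ (nv r H m) (nv r H (m + 1)) *
      if nv r H (m - k) = nv r H m then 1 else 0) := by
  have h := exch_avg (r := r) hm p (pinv_nu (m := m) r
    (Φ := fun a b c => Ψ a b * if c = a then 1 else 0)) (tail_mem hk)
  simp only [range_sdiff_tail hk] at h
  rw [show (fun H => Ψ (nv r H m) (nv r H (m + 1)) * if nv r H (m - k) = nv r H m then 1 else 0)
    = (fun H => Ψ (nv r H m) (nv r H (m + 1)) * if nu r H (range (m - k)) = nv r H m then (1:ℝ) else 0)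
    from rfl, ← h]
  congr 1; funext H
  rw [← Finset.mul_sum, Finset.sum_boole]

lemma choose_pos' {r m : ℕ} (h : r ≤ m) : (0:ℝ) < m.choose r := by
  exact_mod_cast Nat.choose_pos h

lemma E_NB {r Q m : ℕ} (hm : m ≤ Q) (hk : r - 1 ≤ m) (p : ℝ) (g : ℕ → ℝ) :
    EQ r Q p (fun H => g (nv r H m) * NB r H m) = EQ r Q p (fun H => g (nv r H m) * al r H m) := by
  have h := exch_nu (r := r) hm hk p (fun a _ => g a)
  have hc := choose_pos' hk
  have h2 : EQ r Q p (fun H => g (nv r H m) * al r H m) = (1 / (m.choose (r - 1) : ℝ)) *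
    EQ r Q p (fun H => g (nv r H m) *
      #((powersetCard (r - 1) (range m)).filter (fun Y => nu r H (range m \ Y) = nv r H m))) := by
    unfold EQ
    rw [← Ex_mul]; congr 1; funext H; unfold al Nn; field_simp
  rw [h2, h]
  unfold NB
  field_simp

lemma E_NB_inc {r Q m : ℕ} (hr : 1 ≤ r) (hm : m < Q) (hk : r - 1 ≤ m) (p : ℝ) (g : ℕ → ℝ) :
    EQ r Q p (fun H => g (nv r H m) * NB r H m * (1 - inc r H m)) =
      EQ r Q p (fun H => g (nv r H m) * al r H m * (1 - p) ^ #(Nn r H m)) := by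
  have h := exch_nu (r := r) hm.le hk p (fun a b => g a * (1 - ((b:ℝ) - a)))
  have hc := choose_pos' hk
  have hp : Past m (fun H => g (nv r H m) * al r H m) := by
    intro H H' hH
    have e1 : nv r H m = nv r H' m := past_nv r m H H' hH
    have e2 : Nn r H m = Nn r H' m := past_Nn r m H H' hH
    simp only [e1, e2, al]
  rw [← E_one_sub_inc hr hm p hp]
  have h2 : EQ r Q p (fun H => g (nv r H m) * al r H m * (1 - inc r H m)) =
    (1 / (m.choose (r - 1) : ℝ)) *
    EQ r Q p (fun H => g (nv r H m) * (1 - ((nv r H (m+1) : ℝ) - nv r H m)) *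
      #((powersetCard (r - 1) (range m)).filter (fun Y => nu r H (range m \ Y) = nv r H m))) := by
    unfold EQ
    rw [← Ex_mul]; congr 1; funext H; unfold al Nn inc; field_simp
  rw [h2, h, ← mul_assoc, one_div, inv_mul_cancel₀ hc.ne', one_mul]
  congr 1; funext H; unfold NB inc; ring

lemma bb_eq {r Q m : ℕ} (hm : m ≤ Q) (p : ℝ) {Z : Finset ℕ} (hZ : Z ∈ powersetCard r (range m)) :
    EQ r Q p (fun H => if nu r H (range m \ Z) = nv r H m then (1:ℝ) else 0) = bb r Q p m := by
  have hrm : r ≤ m := by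
    rw [mem_powersetCard] at hZ
    have := Finset.card_le_card hZ.1
    rw [card_range, hZ.2] at this; exact this
  have h1 := tail_mem hrm
  rw [mem_powersetCard] at h1 hZ
  have h := exch (r := r) hm p (pinv_nu (m := m) r
    (Φ := fun a b c => if c = a then (1:ℝ) else 0)) hZ.1 h1.1 (hZ.2.trans h1.2.symm)
  simp only [range_sdiff_tail hrm] at h
  exact h

lemma E_FF {r Q m : ℕ} (hm : m ≤ Q) (hk : r ≤ m) (p : ℝ) :
    EQ r Q p (fun H => (#(FF r H m) : ℝ)) = (m.choose r : ℝ) * bb r Q p m := by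
  have h := exch_nu (r := r) hm hk p (fun a b => 1)
  simp only [one_mul] at h
  exact h

lemma bb_nonneg {r Q m : ℕ} {p : ℝ} (h0 : 0 ≤ p) (h1 : p ≤ 1) : 0 ≤ bb r Q p m := by
  unfold bb EQ
  exact Ex_nonneg h0 h1 fun H _ => by split_ifs <;> norm_num

lemma bb_le_one {r Q m : ℕ} {p : ℝ} (h0 : 0 ≤ p) (h1 : p ≤ 1) : bb r Q p m ≤ 1 := by
  unfold bb EQ
  exact Ex_le_const h0 h1 fun H _ => by split_ifs <;> norm_num

lemma russo {r Q m : ℕ} (hr : 1 ≤ r) (hm : m ≤ Q) {p : ℝ} (h0 : 0 ≤ p) (h1 : p ≤ 1) :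
    ∃ D, HasDerivAt (fun p => EQ r Q p (fun H => (nv r H m : ℝ))) D p ∧
      (m.choose r : ℝ) * bb r Q p m ≤ D := by
  refine ⟨_, Ex_deriv _ _ p, ?_⟩
  have hsub : powersetCard r (range m) ⊆ powersetCard r (range Q) :=
    Finset.powersetCard_mono (Finset.range_subset_range.2 hm)
  calc (m.choose r : ℝ) * bb r Q p m = ∑ e ∈ powersetCard r (range m), bb r Q p m := by simp
    _ ≤ ∑ e ∈ powersetCard r (range m), Ex p (powersetCard r (range Q))
        (fun H => (nv r (insert e H) m : ℝ) - nv r (H.erase e) m) := by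
        apply Finset.sum_le_sum
        intro e he
        rw [← bb_eq hm p he]
        apply Ex_mono h0 h1
        intro H _
        rw [mem_powersetCard] at he
        have := nu_russo (H := H) (W := range m) hr he.2 he.1
        unfold nv
        have h2 : (((if nu r H (range m \ e) = nu r H (range m) then 1 else 0) +
          nu r (H.erase e) (range m) : ℕ) : ℝ) ≤ nu r (insert e H) (range m) := by exact_mod_cast this
        push_cast at h2
        linarith
    _ ≤ _ := by
        apply Finset.sum_le_sum_of_subset_of_nonneg hsub
        intro e _ _
        apply Ex_nonneg h0 h1
        intro H _
        have : nv r (H.erase e) m ≤ nv r (insert e H) m :=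
          nu_mono ((Finset.erase_subset _ _).trans (Finset.subset_insert _ _)) (Subset.refl _)
        have : (nv r (H.erase e) m : ℝ) ≤ nv r (insert e H) m := by exact_mod_cast this
        linarith

noncomputable def pw (r : ℕ) (H : Finset (Finset ℕ)) (m w : ℕ) : Finset (Finset ℕ) :=
  (Nn r H m).filter (fun Y => w ∈ unc r H (range m \ Y))
noncomputable def ta (r : ℕ) (H : Finset (Finset ℕ)) (m w : ℕ) : ℝ :=
  #(pw r H m w) / m.choose (r - 1)
noncomputable def rho (r : ℕ) (H : Finset (Finset ℕ)) (m : ℕ) : ℝ := max (xx r H m - (r - 1)) 0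
noncomputable def HB (r : ℕ) (H : Finset (Finset ℕ)) (m : ℕ) (h : ℝ) : Finset ℕ :=
  (range m).filter (fun w => h ≤ ta r H m w)
noncomputable def LB (r : ℕ) (H : Finset (Finset ℕ)) (m : ℕ) (h : ℝ) : Finset ℕ :=
  (range m).filter (fun w => ¬ h ≤ ta r H m w)

section countSec
variable {r : ℕ} {H : Finset (Finset ℕ)} {m : ℕ}

lemma rho_nonneg : 0 ≤ rho r H m := le_max_right _ _

lemma mem_Nn {Y : Finset ℕ} : Y ∈ Nn r H m ↔
    (Y ⊆ range m ∧ #Y = r - 1) ∧ nu r H (range m \ Y) = nv r H m := by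
  unfold Nn; rw [mem_filter, mem_powersetCard]

lemma card_unc_of_mem (hr : 1 ≤ r) {Y : Finset ℕ} (hY : Y ∈ Nn r H m) :
    (#(unc r H (range m \ Y)) : ℝ) = rho r H m := by
  rw [mem_Nn] at hY
  have h1 := unc_card (r := r) (H := H) (W := range m \ Y)
  have h2 := Finset.card_sdiff_add_card_eq_card hY.1.1
  rw [card_range, hY.1.2] at h2
  rw [hY.2] at h1
  have h3 : (#(unc r H (range m \ Y)) : ℝ) + r * nv r H m + (r - 1) = m := by
    have : #(unc r H (range m \ Y)) + r * nv r H m + (r - 1) = m := by omega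
    have h4 : ((#(unc r H (range m \ Y)) + r * nv r H m + (r - 1) : ℕ) : ℝ) = m := by
      exact_mod_cast this
    push_cast [Nat.cast_sub hr] at h4
    linarith
  unfold rho xx
  rw [max_eq_left]
  · linarith
  · have : (0:ℝ) ≤ #(unc r H (range m \ Y)) := by positivity
    linarith

lemma sum_pw (hr : 1 ≤ r) : ∑ w ∈ range m, (#(pw r H m w) : ℝ) = #(Nn r H m) * rho r H m := by
  have h1 : ∀ w, (#(pw r H m w) : ℝ) =
      ∑ Y ∈ Nn r H m, if w ∈ unc r H (range m \ Y) then (1:ℝ) else 0 := by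
    intro w; unfold pw; rw [Finset.sum_boole]
  simp only [h1]
  rw [Finset.sum_comm]
  have h2 : ∀ Y ∈ Nn r H m,
      (∑ w ∈ range m, if w ∈ unc r H (range m \ Y) then (1:ℝ) else 0) = rho r H m := by
    intro Y hY
    rw [Finset.sum_boole, ← card_unc_of_mem hr hY]
    congr 2
    ext w
    simp only [mem_filter]
    constructor
    · exact fun h => h.2
    · exact fun h => ⟨sdiff_subset (unc_subset h), h⟩
  rw [Finset.sum_congr rfl h2]
  simp

lemma sum_ta (hr : 1 ≤ r) : ∑ w ∈ range m, ta r H m w = al r H m * rho r H m := by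
  unfold ta al
  rw [← Finset.sum_div, sum_pw hr]; ring

lemma sum_HB_LB (hr : 1 ≤ r) (h : ℝ) : ∑ w ∈ HB r H m h, ta r H m w + ∑ w ∈ LB r H m h, ta r H m w =
    al r H m * rho r H m := by
  rw [← sum_ta hr]; exact Finset.sum_filter_add_sum_filter_not _ _ _

lemma al_nonneg : 0 ≤ al r H m := by unfold al; positivity
lemma ta_nonneg {w : ℕ} : 0 ≤ ta r H m w := by unfold ta; positivity

lemma al_le_one : al r H m ≤ 1 := by
  unfold al
  apply div_le_one_of_le₀ _ (by positivity)
  have := Finset.card_le_card (Nn_subset r H m)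
  simp at this
  exact_mod_cast this

lemma card_HB_le (hr : 1 ≤ r) {h : ℝ} (hh : 0 < h) : (#(HB r H m h) : ℝ) ≤ rho r H m / h := by
  rw [le_div_iff₀ hh]
  calc (#(HB r H m h) : ℝ) * h = ∑ w ∈ HB r H m h, h := by simp
    _ ≤ ∑ w ∈ HB r H m h, ta r H m w :=
        Finset.sum_le_sum fun w hw => (mem_filter.1 hw).2
    _ ≤ ∑ w ∈ range m, ta r H m w :=
        Finset.sum_le_sum_of_subset_of_nonneg (Finset.filter_subset _ _) fun _ _ _ => ta_nonneg
    _ = al r H m * rho r H m := sum_ta hr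
    _ ≤ 1 * rho r H m := mul_le_mul_of_nonneg_right al_le_one rho_nonneg
    _ = rho r H m := one_mul _

lemma pw_facts {w : ℕ} {Y : Finset ℕ} (hY : Y ∈ pw r H m w) :
    Y ∈ Nn r H m ∧ w ∉ Y ∧ w ∈ range m ∧ nu r H ((range m \ Y) \ {w}) = nv r H m := by
  unfold pw at hY
  rw [mem_filter] at hY
  have h1 := unc_subset hY.2
  rw [mem_sdiff] at h1
  refine ⟨hY.1, h1.2, h1.1, ?_⟩
  rw [unc_nu (Finset.singleton_subset_iff.2 hY.2)]
  exact (mem_Nn.1 hY.1).2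

lemma insert_mem_FF (hr : 1 ≤ r) {w : ℕ} {Y : Finset ℕ} (hY : Y ∈ pw r H m w) :
    insert w Y ∈ FF r H m := by
  obtain ⟨h1, h2, h3, h4⟩ := pw_facts hY
  rw [mem_Nn] at h1
  unfold FF
  rw [mem_filter, mem_powersetCard]
  refine ⟨⟨Finset.insert_subset h3 h1.1.1, by rw [card_insert_of_notMem h2]; omega⟩, ?_⟩
  rw [← h4]
  congr 1
  ext x; simp only [mem_sdiff, mem_insert, mem_singleton]; tauto

lemma crude_count (hr : 1 ≤ r) : ∑ w ∈ range m, #(pw r H m w) ≤ r * #(FF r H m) := by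
  have h1 : ∑ w ∈ range m, #(pw r H m w) = #((range m).sigma (fun w => pw r H m w)) := by
    rw [card_sigma]
  have h2 : r * #(FF r H m) = #((FF r H m).sigma (fun Z => Z)) := by
    rw [card_sigma, Finset.sum_congr rfl (g := fun _ => r)]
    · simp [mul_comm]
    · intro Z hZ; unfold FF at hZ; rw [mem_filter, mem_powersetCard] at hZ; exact hZ.1.2
  rw [h1, h2]
  apply Finset.card_le_card_of_injOn (fun q => ⟨insert q.1 q.2, q.1⟩)
  · rintro ⟨w, Y⟩ hq
    simp only [coe_sigma, Set.mem_sigma_iff, mem_coe] at hq ⊢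
    exact ⟨insert_mem_FF hr hq.2, mem_insert_self _ _⟩
  · rintro ⟨w, Y⟩ hq ⟨w', Y'⟩ hq' heq
    simp only [coe_sigma, Set.mem_sigma_iff, mem_coe] at hq hq'
    simp only [Sigma.mk.injEq, heq_eq_eq] at heq
    obtain ⟨h3, rfl⟩ := heq
    have a := (pw_facts hq.2).2.1
    have b := (pw_facts hq'.2).2.1
    rw [← Finset.erase_insert a, h3, Finset.erase_insert b]

lemma card_contain (k m w : ℕ) (hw : w ∈ range m) :
    #((powersetCard (k + 1) (range m)).filter (fun Y => w ∈ Y)) ≤ (m - 1).choose k := by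
  have : #(powersetCard k ((range m).erase w)) = (m - 1).choose k := by
    rw [card_powersetCard, Finset.card_erase_of_mem hw, card_range]
  rw [← this]
  apply Finset.card_le_card_of_injOn (fun Y => Y.erase w)
  · intro Y hY
    rw [mem_coe, mem_filter, mem_powersetCard] at hY
    rw [mem_coe, mem_powersetCard]
    exact ⟨Finset.erase_subset_erase _ hY.1.1, by rw [card_erase_of_mem hY.2]; omega⟩
  · intro Y hY Y' hY' h
    rw [mem_coe, mem_filter] at hY hY'
    simp only at h
    rw [← Finset.insert_erase hY.2, h, Finset.insert_erase hY'.2]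

lemma heavy_count (hr : 2 ≤ r) (B : Finset ℕ) (hB : B ⊆ range m) :
    ∑ w ∈ B, #(pw r H m w) ≤ #(FF r H m) + #B * (#B * (m - 1).choose (r - 2)) := by
  have h1 : ∀ w ∈ B, #(pw r H m w) ≤ #((pw r H m w).filter (fun Y => Disjoint Y B)) +
      #B * (m - 1).choose (r - 2) := by
    intro w hw
    rw [← Finset.card_filter_add_card_filter_not (s := pw r H m w) (fun Y => Disjoint Y B)]
    apply Nat.add_le_add_left
    have h2 : (pw r H m w).filter (fun Y => ¬ Disjoint Y B) ⊆
        B.biUnion (fun w' => (powersetCard (r - 2 + 1) (range m)).filter (fun Y => w' ∈ Y)) := by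
      intro Y hY
      rw [mem_filter, Finset.not_disjoint_iff] at hY
      obtain ⟨hY1, w', h3, h4⟩ := hY
      rw [mem_biUnion]
      refine ⟨w', h4, ?_⟩
      rw [mem_filter]
      refine ⟨?_, h3⟩
      have : r - 2 + 1 = r - 1 := by omega
      rw [this]
      exact Nn_subset _ _ _ (pw_facts hY1).1
    refine (Finset.card_le_card h2).trans (Finset.card_biUnion_le.trans ?_)
    refine (Finset.sum_le_sum fun w' hw' => card_contain (r - 2) m w' (hB hw')).trans ?_
    simp
  refine (Finset.sum_le_sum h1).trans ?_
  rw [Finset.sum_add_distrib, Finset.sum_const, smul_eq_mul]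
  apply Nat.add_le_add_right
  rw [← card_sigma]
  apply Finset.card_le_card_of_injOn (fun q => insert q.1 q.2)
  · rintro ⟨w, Y⟩ hq
    simp only [coe_sigma, Set.mem_sigma_iff, mem_coe, mem_filter] at hq ⊢
    exact insert_mem_FF (by omega) hq.2.1
  · rintro ⟨w, Y⟩ hq ⟨w', Y'⟩ hq' heq
    simp only [coe_sigma, Set.mem_sigma_iff, mem_coe, mem_filter] at hq hq'
    simp only at heq
    have hww : w = w' := by
      have h3 : w ∈ insert w' Y' := heq ▸ mem_insert_self w Y
      rcases mem_insert.1 h3 with h4 | h4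
      · exact h4
      · exact absurd hq.1 (Finset.disjoint_left.1 hq'.2.2 h4)
    subst hww
    have a := (pw_facts hq.2.1).2.1
    have b := (pw_facts hq'.2.1).2.1
    have : Y = Y' := by rw [← Finset.erase_insert a, heq, Finset.erase_insert b]
    rw [this]

end countSec

lemma choose_rel1 {r m : ℕ} (hr : 1 ≤ r) (hm : r ≤ m) :
    (m.choose r : ℝ) * r = m.choose (r - 1) * (m - r + 1) := by
  have := Nat.choose_succ_right_eq m (r - 1)
  rw [Nat.sub_add_cancel hr] at this
  have h2 : ((m - (r - 1) : ℕ) : ℝ) = m - r + 1 := by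
    rw [Nat.cast_sub (by omega), Nat.cast_sub hr]; push_cast; ring
  rw [← h2]
  exact_mod_cast this

lemma choose_rel2 {r m : ℕ} (hr : 2 ≤ r) (hm : r ≤ m) :
    ((m - 1).choose (r - 2) : ℝ) * m = m.choose (r - 1) * (r - 1) := by
  have := Nat.add_one_mul_choose_eq (m - 1) (r - 2)
  rw [Nat.sub_add_cancel (by omega), show r - 2 + 1 = r - 1 by omega] at this
  have h2 : ((r - 1 : ℕ) : ℝ) = r - 1 := by
    rw [Nat.cast_sub (by omega)]; push_cast; ring
  rw [← h2, mul_comm]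
  exact_mod_cast this

lemma choose_rel3 {r m : ℕ} (hr : 1 ≤ r) (hm : r ≤ m) :
    (r : ℝ) * m.choose r = m * (m - 1).choose (r - 1) := by
  have := Nat.add_one_mul_choose_eq (m - 1) (r - 1)
  rw [Nat.sub_add_cancel (by omega), Nat.sub_add_cancel (by omega)] at this
  rw [mul_comm]
  exact_mod_cast this.symm

lemma E_smul (r Q : ℕ) (p c : ℝ) (f : Finset (Finset ℕ) → ℝ) :
    EQ r Q p (fun H => c * f H) = c * EQ r Q p f := Ex_mul _ _ _ _
lemma E_add (r Q : ℕ) (p : ℝ) (f g : Finset (Finset ℕ) → ℝ) :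
    EQ r Q p (fun H => f H + g H) = EQ r Q p f + EQ r Q p g := Ex_add _ _ _ _
lemma E_sub (r Q : ℕ) (p : ℝ) (f g : Finset (Finset ℕ) → ℝ) :
    EQ r Q p (fun H => f H - g H) = EQ r Q p f - EQ r Q p g := Ex_sub _ _ _ _
lemma E_const (r Q : ℕ) (p c : ℝ) : EQ r Q p (fun _ => c) = c := Ex_const _ _ _
lemma E_sum {ι : Type*} (r Q : ℕ) (p : ℝ) (s : Finset ι) (f : ι → Finset (Finset ℕ) → ℝ) :
    EQ r Q p (fun H => ∑ i ∈ s, f i H) = ∑ i ∈ s, EQ r Q p (f i) := Ex_sum _ _ _ _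
lemma E_mono {r Q : ℕ} {p : ℝ} (h0 : 0 ≤ p) (h1 : p ≤ 1) {f g : Finset (Finset ℕ) → ℝ}
    (h : ∀ H, f H ≤ g H) : EQ r Q p f ≤ EQ r Q p g := Ex_mono h0 h1 fun H _ => h H
lemma E_nonneg {r Q : ℕ} {p : ℝ} (h0 : 0 ≤ p) (h1 : p ≤ 1) {f : Finset (Finset ℕ) → ℝ}
    (h : ∀ H, 0 ≤ f H) : 0 ≤ EQ r Q p f := Ex_nonneg h0 h1 fun H _ => h H

lemma crude_bb {r Q m : ℕ} (hr : 1 ≤ r) (hm : m ≤ Q) (hrm : r ≤ m) {p : ℝ} (h0 : 0 ≤ p)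
    (h1 : p ≤ 1) : EQ r Q p (fun H => al r H m * rho r H m) ≤ m * bb r Q p m := by
  have hc := choose_pos' (r := r - 1) (m := m) (by omega)
  have hb := bb_nonneg (r := r) (Q := Q) (m := m) h0 h1
  have h2 : EQ r Q p (fun H => al r H m * rho r H m) ≤
      EQ r Q p (fun H => (r / (m.choose (r - 1) : ℝ)) * #(FF r H m)) := by
    apply E_mono h0 h1
    intro H
    rw [← sum_ta hr]
    unfold ta
    rw [← Finset.sum_div, div_mul_eq_mul_div]
    apply div_le_div_of_nonneg_right _ hc.le
    exact_mod_cast crude_count hr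
  rw [E_smul, E_FF hm hrm] at h2
  have h3 := choose_rel1 hr hrm
  have h4 : (r / (m.choose (r - 1) : ℝ)) * (m.choose r * bb r Q p m) = (m - r + 1) * bb r Q p m := by
    rw [div_mul_eq_mul_div, div_eq_iff hc.ne']
    calc (r : ℝ) * (m.choose r * bb r Q p m) = (m.choose r * r) * bb r Q p m := by ring
      _ = _ := by rw [h3]; ring
  rw [h4] at h2
  refine h2.trans (mul_le_mul_of_nonneg_right ?_ hb)
  have : (1:ℝ) ≤ r := by exact_mod_cast hr
  linarith

lemma heavy_bb {r Q m : ℕ} (hr : 2 ≤ r) (hm : m ≤ Q) (hrm : r ≤ m) {p : ℝ} (h0 : 0 ≤ p)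
    (h1 : p ≤ 1) {h : ℝ} (hh : 0 < h) :
    r * EQ r Q p (fun H => ∑ w ∈ HB r H m h, ta r H m w) ≤
      m * bb r Q p m + r ^ 2 / (h ^ 2 * m) * EQ r Q p (fun H => rho r H m ^ 2) := by
  have hc := choose_pos' (r := r - 1) (m := m) (by omega)
  have hb := bb_nonneg (r := r) (Q := Q) (m := m) h0 h1
  have hm0 : (0:ℝ) < m := by
    have : 0 < m := by omega
    exact_mod_cast this
  have hr1 : (2:ℝ) ≤ r := by exact_mod_cast hr
  have h2 : EQ r Q p (fun H => r * ∑ w ∈ HB r H m h, ta r H m w) ≤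
      EQ r Q p (fun H => (r / (m.choose (r - 1) : ℝ)) * #(FF r H m) +
        r ^ 2 / (h ^ 2 * m) * rho r H m ^ 2) := by
    apply E_mono h0 h1
    intro H
    have h3 := heavy_count (r := r) (H := H) (m := m) hr (HB r H m h) (Finset.filter_subset _ _)
    have h4 : (∑ w ∈ HB r H m h, (#(pw r H m w) : ℝ)) ≤ #(FF r H m) +
        #(HB r H m h) * (#(HB r H m h) * (m - 1).choose (r - 2)) := by exact_mod_cast h3
    have h5 := card_HB_le (r := r) (H := H) (m := m) (by omega) hh
    have h6 : ((m - 1).choose (r - 2) : ℝ) = m.choose (r - 1) * (r - 1) / m := by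
      rw [eq_div_iff hm0.ne']; exact choose_rel2 hr hrm
    have h7 : (#(HB r H m h) : ℝ) * #(HB r H m h) ≤ (rho r H m / h) ^ 2 := by
      rw [← sq]; exact pow_le_pow_left₀ (by positivity) h5 2
    unfold ta
    rw [← Finset.sum_div]
    calc (r:ℝ) * ((∑ w ∈ HB r H m h, (#(pw r H m w) : ℝ)) / m.choose (r - 1))
        ≤ r * ((#(FF r H m) + #(HB r H m h) * (#(HB r H m h) * (m - 1).choose (r - 2))) /
            m.choose (r - 1)) := by gcongr
      _ = (r / (m.choose (r - 1) : ℝ)) * #(FF r H m) +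
          r * (r - 1) / m * (#(HB r H m h) * #(HB r H m h)) := by
          rw [h6]; field_simp
      _ ≤ (r / (m.choose (r - 1) : ℝ)) * #(FF r H m) +
          r * r / m * (rho r H m / h) ^ 2 := by
          gcongr
          linarith
      _ = _ := by field_simp
  rw [E_smul, E_add, E_smul, E_smul, E_FF hm hrm] at h2
  have h3 := choose_rel1 (by omega : 1 ≤ r) hrm
  have h4 : (r / (m.choose (r - 1) : ℝ)) * (m.choose r * bb r Q p m) = (m - r + 1) * bb r Q p m := by
    rw [div_mul_eq_mul_div, div_eq_iff hc.ne']
    calc (r : ℝ) * (m.choose r * bb r Q p m) = (m.choose r * r) * bb r Q p m := by ring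
      _ = _ := by rw [h3]; ring
  rw [h4] at h2
  have h5 : (m - r + 1) * bb r Q p m ≤ m * bb r Q p m :=
    mul_le_mul_of_nonneg_right (by linarith) hb
  linarith

noncomputable def yp (r : ℕ) (H : Finset (Finset ℕ)) (m : ℕ) : ℝ :=
  max ((nv r H (m + r) : ℝ) - nv r H m - 1) 0

lemma past_pw (r m w : ℕ) : Past m (fun H => pw r H m w) := by
  intro H H' h
  have h1 : Nn r H m = Nn r H' m := past_Nn r m H H' h
  show pw r H m w = pw r H' m w
  unfold pw
  rw [h1]
  apply Finset.filter_congr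
  intro Y _
  have h2 : unc r H (range m \ Y) = unc r H' (range m \ Y) := past_unc sdiff_subset H H' h
  rw [h2]

lemma past_ta (r m w : ℕ) : Past m (fun H => ta r H m w) := by
  intro H H' h
  have h1 : pw r H m w = pw r H' m w := past_pw r m w H H' h
  simp only [ta, h1]

lemma past_rho (r m : ℕ) : Past m (fun H => rho r H m) := by
  intro H H' h
  have h1 : nv r H m = nv r H' m := past_nv r m H H' h
  simp only [rho, xx, h1]

open Classical in
noncomputable def sel (r : ℕ) (H : Finset (Finset ℕ)) (m w : ℕ) : ℝ :=
  1 - (if ∀ Y ∈ pw r H m w, insert m Y ∉ H then (1:ℝ) else 0)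

lemma light_pointwise_aux {r m : ℕ} (hr : 1 ≤ r) (H : Finset (Finset ℕ)) {w : ℕ}
    (hw : w ∈ range m) (hn : nv r H (m + r) ≤ nv r H m + 1) :
    sel r H m w ≤ if nu r H (range (m + r) \ insert w (Ico (m + 1) (m + r))) = nv r H (m + r)
      then 1 else 0 := by
  unfold sel
  split_ifs with h1 h2 h2
  · norm_num
  · norm_num
  · norm_num
  · exfalso
    push Not at h1
    obtain ⟨Y, hY, hYH⟩ := h1
    apply h2
    obtain ⟨f1, f2, f3, f4⟩ := pw_facts hY
    rw [mem_Nn] at f1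
    apply le_antisymm (nu_mono (Subset.refl _) sdiff_subset)
    refine hn.trans ?_
    have hmY : m ∉ Y := fun h => by simpa using f1.1.1 h
    rw [mem_range] at hw
    have h3 : insert m Y ⊆ range (m + r) \ insert w (Ico (m + 1) (m + r)) := by
      intro x hx
      rw [mem_insert] at hx
      simp only [mem_sdiff, mem_range, mem_insert, mem_Ico, not_or, not_and]
      rcases hx with rfl | hx
      · exact ⟨by omega, by omega, by omega⟩
      · have := f1.1.1 hx
        rw [mem_range] at this
        exact ⟨by omega, fun h => f2 (h ▸ hx), by omega⟩
    have h4 := nu_add_edge (r := r) hr hYH (by rw [card_insert_of_notMem hmY]; omega) h3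
    refine le_trans ?_ h4
    apply Nat.add_le_add_right
    rw [← f4]
    apply nu_mono (Subset.refl _)
    intro x hx
    simp only [mem_sdiff, mem_range, mem_insert, mem_Ico, not_or, not_and, mem_singleton] at hx ⊢
    exact ⟨⟨by omega, hx.2, by omega⟩, by omega, hx.1.2⟩

lemma sel_nonneg (r : ℕ) (H : Finset (Finset ℕ)) (m w : ℕ) : 0 ≤ sel r H m w := by
  unfold sel; split_ifs <;> norm_num

lemma sum_sel_le {r m : ℕ} (hr : 1 ≤ r) (H : Finset (Finset ℕ)) :
    ∑ w ∈ range m, sel r H m w ≤ #(H ∩ vstar r m) * rho r H m := by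
  classical
  have h1 : ∀ w ∈ range m, sel r H m w ≤
      ∑ Y ∈ (Nn r H m).filter (fun Y => insert m Y ∈ H),
        if w ∈ unc r H (range m \ Y) then (1:ℝ) else 0 := by
    intro w hw
    have hnn : ∀ Y ∈ (Nn r H m).filter (fun Y => insert m Y ∈ H),
        (0:ℝ) ≤ if w ∈ unc r H (range m \ Y) then (1:ℝ) else 0 := fun Y _ => by
      split_ifs <;> norm_num
    unfold sel
    split_ifs with h
    · rw [sub_self]; exact Finset.sum_nonneg hnn
    · push Not at h
      obtain ⟨Y, hY, hYH⟩ := h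
      unfold pw at hY
      rw [mem_filter] at hY
      have h2 := Finset.single_le_sum hnn (mem_filter.2 ⟨hY.1, hYH⟩)
      rw [if_pos hY.2] at h2
      linarith
  refine (Finset.sum_le_sum h1).trans ?_
  rw [Finset.sum_comm]
  have h2 : ∀ Y ∈ (Nn r H m).filter (fun Y => insert m Y ∈ H),
      (∑ w ∈ range m, if w ∈ unc r H (range m \ Y) then (1:ℝ) else 0) = rho r H m := by
    intro Y hY
    rw [Finset.sum_boole, ← card_unc_of_mem hr (mem_filter.1 hY).1]
    congr 2
    ext w
    simp only [mem_filter]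
    constructor
    · exact fun h => h.2
    · exact fun h => ⟨sdiff_subset (unc_subset h), h⟩
  rw [Finset.sum_congr rfl h2, Finset.sum_const, nsmul_eq_mul]
  apply mul_le_mul_of_nonneg_right _ rho_nonneg
  norm_cast
  apply Finset.card_le_card_of_injOn (fun Y => insert m Y)
  · intro Y hY
    rw [mem_coe, mem_filter] at hY
    rw [mem_coe, mem_inter]
    exact ⟨hY.2, Finset.mem_image_of_mem _ (Nn_subset _ _ _ hY.1)⟩
  · intro Y hY Y' hY' h
    rw [mem_coe, mem_filter] at hY hY'
    exact vstar_inj (Nn_subset _ _ _ hY.1) (Nn_subset _ _ _ hY'.1) h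

lemma light_pointwise {r m : ℕ} (hr : 1 ≤ r) (H : Finset (Finset ℕ)) {T : ℝ} (hT : 0 < T) (h : ℝ) :
    ∑ w ∈ LB r H m h, sel r H m w ≤
      (∑ w ∈ range m, if nu r H (range (m + r) \ insert w (Ico (m + 1) (m + r))) = nv r H (m + r)
        then (1:ℝ) else 0) + T * (rho r H m * yp r H m) +
        (1 / T) * (rho r H m * (#(H ∩ vstar r m) : ℝ) ^ 2) := by
  have hyp : 0 ≤ yp r H m := le_max_right _ _
  have hrho := rho_nonneg (r := r) (H := H) (m := m)
  have h0 : ∑ w ∈ LB r H m h, sel r H m w ≤ ∑ w ∈ range m, sel r H m w :=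
    Finset.sum_le_sum_of_subset_of_nonneg (Finset.filter_subset _ _) fun _ _ _ => sel_nonneg _ _ _ _
  have hs0 : 0 ≤ ∑ w ∈ range m, (if nu r H (range (m + r) \ insert w (Ico (m + 1) (m + r))) =
      nv r H (m + r) then (1:ℝ) else 0) := Finset.sum_nonneg fun _ _ => by split_ifs <;> norm_num
  by_cases hn : nv r H (m + r) ≤ nv r H m + 1
  · have h1 : ∑ w ∈ range m, sel r H m w ≤ _ :=
      Finset.sum_le_sum fun w hw => light_pointwise_aux hr H hw hn
    have h2 : 0 ≤ T * (rho r H m * yp r H m) := by positivity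
    have h3 : 0 ≤ (1 / T) * (rho r H m * (#(H ∩ vstar r m) : ℝ) ^ 2) := by positivity
    linarith
  · have h1 := sum_sel_le hr (m := m) H
    have h2 : 1 ≤ yp r H m := by
      unfold yp
      apply le_max_of_le_left
      have : nv r H m + 2 ≤ nv r H (m + r) := by omega
      have : (nv r H m : ℝ) + 2 ≤ nv r H (m + r) := by exact_mod_cast this
      linarith
    set d : ℝ := (#(H ∩ vstar r m) : ℝ) with hd
    have hd0 : 0 ≤ d := by positivity
    have h3 : d ≤ T * yp r H m + (1 / T) * d ^ 2 := by
      by_cases hdT : d ≤ T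
      · have : T * 1 ≤ T * yp r H m := mul_le_mul_of_nonneg_left h2 hT.le
        have : 0 ≤ (1 / T) * d ^ 2 := by positivity
        linarith
      · push Not at hdT
        have : d ≤ (1 / T) * d ^ 2 := by
          rw [one_div, inv_mul_eq_div, le_div_iff₀ hT, sq]
          exact mul_le_mul_of_nonneg_left hdT.le hd0
        have : 0 ≤ T * yp r H m := by positivity
        linarith
    have h4 := mul_le_mul_of_nonneg_right h3 hrho
    have e : (T * yp r H m + 1 / T * d ^ 2) * rho r H m =
      T * (rho r H m * yp r H m) + (1 / T) * (rho r H m * d ^ 2) := by ring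
    linarith

lemma one_sub_pow_ge {p t K : ℝ} {k : ℕ} (h0 : 0 ≤ p) (h1 : p ≤ 1) (ht : 0 ≤ t)
    (hK : 2 * K * t ≤ p * k) (hK1 : 2 * K * t ≤ 1) (hK0 : 0 ≤ K) : K * t ≤ 1 - (1 - p) ^ k := by
  have a : (1 - p) ^ k ≤ Real.exp (-(p * k)) := by
    have : 1 - p ≤ Real.exp (-p) := by have := Real.add_one_le_exp (-p); linarith
    calc (1 - p) ^ k ≤ (Real.exp (-p)) ^ k := pow_le_pow_left₀ (by linarith) this k
      _ = _ := by rw [← Real.exp_nat_mul]; congr 1; ring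
  set s := 2 * K * t with hs
  have hs0 : 0 ≤ s := by positivity
  have b : Real.exp (-(p * k)) ≤ Real.exp (-s) := Real.exp_le_exp.2 (by linarith)
  have c : Real.exp (-s) ≤ 1 - s / 2 := by
    rw [Real.exp_neg]
    have : 1 + s ≤ Real.exp s := by have := Real.add_one_le_exp s; linarith
    calc (Real.exp s)⁻¹ ≤ (1 + s)⁻¹ := inv_anti₀ (by linarith) this
      _ ≤ 1 - s / 2 := by
        rw [inv_le_iff_one_le_mul₀ (by linarith)]
        nlinarith
  have : K * t = s / 2 := by rw [hs]; ring
  linarith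

lemma light_bb {r Q m : ℕ} (hr : 1 ≤ r) (hm : m + r ≤ Q) (hrm : r ≤ m) {p : ℝ} (h0 : 0 ≤ p)
    (h1 : p ≤ 1) {K T : ℝ} (hK : 0 < K) (hT : 0 < T) (hKp : 2 * K ≤ p * m.choose (r - 1)) :
    K * EQ r Q p (fun H => ∑ w ∈ LB r H m (1 / (2 * K)), ta r H m w) ≤
      m * bb r Q p (m + r) + T * EQ r Q p (fun H => rho r H m * yp r H m) +
      ((p * m.choose (r - 1)) ^ 2 + p * m.choose (r - 1)) / T * EQ r Q p (fun H => rho r H m) := by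
  classical
  set h := 1 / (2 * K) with hh
  have hc := choose_pos' (r := r - 1) (m := m) (by omega)
  have e1 := E_mono (r := r) (Q := Q) h0 h1 (fun H => light_pointwise (m := m) hr H hT h)
  rw [E_add, E_add, E_smul, E_smul, star_deg hr (by omega) p (past_rho r m), E_sum] at e1
  have e2 : ∀ w ∈ range m, EQ r Q p (fun H => if nu r H (range (m + r) \
      insert w (Ico (m + 1) (m + r))) = nv r H (m + r) then (1:ℝ) else 0) = bb r Q p (m + r) := by
    intro w hw
    apply bb_eq hm
    rw [mem_range] at hw
    rw [mem_powersetCard]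
    refine ⟨?_, ?_⟩
    · intro x hx
      simp only [mem_insert, mem_Ico, mem_range] at hx ⊢
      omega
    · rw [card_insert_of_notMem (by simp; omega), Nat.card_Ico]; omega
  rw [Finset.sum_congr rfl e2, Finset.sum_const, card_range, nsmul_eq_mul] at e1
  have e3 : K * EQ r Q p (fun H => ∑ w ∈ LB r H m h, ta r H m w) ≤
      EQ r Q p (fun H => ∑ w ∈ LB r H m h, sel r H m w) := by
    have f1 : ∀ (φ : Finset (Finset ℕ) → ℕ → ℝ) H, ∑ w ∈ LB r H m h, φ H w =
        ∑ w ∈ range m, (if ¬ h ≤ ta r H m w then φ H w else 0) := by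
      intro φ H; unfold LB; rw [Finset.sum_filter]
    rw [← E_smul]
    simp only [f1 (fun H w => ta r H m w), f1 (fun H w => sel r H m w), Finset.mul_sum]
    rw [E_sum, E_sum]
    apply Finset.sum_le_sum
    intro w hw
    have f2 := star_miss (r := r) (m := m) (Q := Q) hr (by omega) p
      (w := fun H => if ¬ h ≤ ta r H m w then (1:ℝ) else 0)
      (by intro H H' hH
          have : ta r H m w = ta r H' m w := past_ta r m w H H' hH
          simp only [this]) (past_pw r m w)
      (fun H => (Finset.filter_subset _ _).trans (Nn_subset r H m))
    have f3 : EQ r Q p (fun H => if ¬ h ≤ ta r H m w then sel r H m w else 0) =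
        EQ r Q p (fun H => (if ¬ h ≤ ta r H m w then (1:ℝ) else 0) * (1 - (1 - p) ^ #(pw r H m w))) := by
      have g1 : ∀ H, (if ¬ h ≤ ta r H m w then sel r H m w else 0) =
        (if ¬ h ≤ ta r H m w then (1:ℝ) else 0) - (if ¬ h ≤ ta r H m w then (1:ℝ) else 0) *
          (if ∀ Y ∈ pw r H m w, insert m Y ∉ H then (1:ℝ) else 0) := by
        intro H; unfold sel; split_ifs <;> ring
      have g2 : ∀ H, (if ¬ h ≤ ta r H m w then (1:ℝ) else 0) * (1 - (1 - p) ^ #(pw r H m w)) =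
        (if ¬ h ≤ ta r H m w then (1:ℝ) else 0) - (if ¬ h ≤ ta r H m w then (1:ℝ) else 0) *
          (1 - p) ^ #(pw r H m w) := by
        intro H; ring
      simp only [g1, g2]
      rw [E_sub, E_sub]
      congr 1
    rw [f3]
    apply E_mono h0 h1
    intro H
    by_cases hl : h ≤ ta r H m w
    · simp [hl]
    · simp only [hl, not_false_eq_true, if_true, one_mul]
      push Not at hl
      apply one_sub_pow_ge h0 h1 ta_nonneg _ _ hK.le
      · have : (#(pw r H m w) : ℝ) = ta r H m w * m.choose (r - 1) := by
          unfold ta; field_simp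
        rw [this]
        have := mul_le_mul_of_nonneg_right hKp (ta_nonneg (r := r) (H := H) (m := m) (w := w))
        linarith
      · rw [hh, lt_div_iff₀ (by positivity)] at hl
        linarith
  have hrho : 0 ≤ EQ r Q p (fun H => rho r H m) := E_nonneg h0 h1 fun H => rho_nonneg
  have e4 : 1 / T * (EQ r Q p (fun H => rho r H m) * ((p * m.choose (r - 1)) ^ 2 +
      p * (1 - p) * m.choose (r - 1))) ≤
      ((p * m.choose (r - 1)) ^ 2 + p * m.choose (r - 1)) / T * EQ r Q p (fun H => rho r H m) := by
    rw [one_div, inv_mul_eq_div, div_mul_eq_mul_div, mul_comm (EQ r Q p _)]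
    gcongr
    nlinarith
  linarith

/-- Slowly varying weights. -/
structure Wt (r Q a : ℕ) (γ τ : ℝ) (ω : ℕ → ℝ) : Prop where
  nonneg : ∀ m, 0 ≤ ω m
  lo : ∀ m, m < a → ω m = 0
  hi : ∀ m, Q ≤ m + 2 * r → ω m = 0
  slow : ∀ m m', m ≤ m' + 2 * r → m' ≤ m + 2 * r → |ω m - ω m'| ≤ γ * (ω m + τ)
  ha : 2 * r + 1 ≤ a
  haQ : a ≤ Q
  g0 : 0 ≤ γ
  g1 : γ ≤ 1
  t0 : 0 ≤ τ

section wtSec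
variable {r Q a : ℕ} {γ τ : ℝ} {ω : ℕ → ℝ}

lemma Wt.shift_eq (h : Wt r Q a γ τ ω) {i : ℕ} (hi : i ≤ 2 * r) (F : ℕ → ℝ) :
    ∑ m ∈ range Q, ω m * F (m + i) = ∑ m ∈ range Q, ω (m - i) * F m := by
  have ha := h.ha
  have haQ := h.haQ
  have e1 : ∑ m ∈ range Q, ω m * F (m + i) = ∑ m ∈ range (Q - i), ω m * F (m + i) := by
    symm
    apply Finset.sum_subset (Finset.range_subset_range.2 (Nat.sub_le _ _))
    intro m hm hm'
    rw [mem_range] at hm hm'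
    rw [h.hi m (by omega), zero_mul]
  have e2 : ∑ m ∈ range Q, ω (m - i) * F m = ∑ m ∈ range (Q - i), ω m * F (m + i) := by
    conv_lhs => rw [show Q = i + (Q - i) by omega, Finset.sum_range_add]
    rw [Finset.sum_eq_zero, zero_add]
    · apply Finset.sum_congr rfl
      intro m _
      rw [show i + m - i = m by omega, add_comm]
    · intro m hm
      rw [mem_range] at hm
      rw [show m - i = 0 by omega, h.lo 0 (by omega), zero_mul]
  rw [e1, e2]

lemma Wt.shift (h : Wt r Q a γ τ ω) {i : ℕ} (hi : i ≤ 2 * r) (F G : ℕ → ℝ)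
    (hF : ∀ m, m < Q → |F m| ≤ G m) :
    |∑ m ∈ range Q, ω m * F (m + i) - ∑ m ∈ range Q, ω m * F m| ≤
      γ * ∑ m ∈ range Q, (ω m + τ) * G m := by
  rw [h.shift_eq hi, ← Finset.sum_sub_distrib, Finset.mul_sum]
  refine (Finset.abs_sum_le_sum_abs _ _).trans (Finset.sum_le_sum fun m hm => ?_)
  rw [← sub_mul, abs_mul, abs_sub_comm, ← mul_assoc]
  have h1 := h.slow m (m - i) (by omega) (by omega)
  have h2 : 0 ≤ γ * (ω m + τ) := (abs_nonneg _).trans h1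
  exact mul_le_mul h1 (hF m (mem_range.1 hm)) (abs_nonneg _) h2

end wtSec

noncomputable def uu (r : ℕ) (H : Finset (Finset ℕ)) (m : ℕ) : ℝ := xx r H m - (m % r : ℕ)

section pathSec
variable {r : ℕ} {H : Finset (Finset ℕ)}

lemma xx_nonneg (m : ℕ) : 0 ≤ xx r H m := by
  have := mul_nu_le r H (range m)
  rw [card_range] at this
  have h2 : ((r * nu r H (range m) : ℕ) : ℝ) ≤ m := by exact_mod_cast this
  unfold xx nv; push_cast at h2; linarith

lemma uu_eq (m : ℕ) : uu r H m = r * ((m / r : ℕ) - nv r H m : ℝ) := by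
  have h := Nat.div_add_mod m r
  have h2 : (r : ℝ) * (m / r : ℕ) + (m % r : ℕ) = m := by exact_mod_cast h
  unfold uu xx; linarith

lemma nv_le_div (hr : 1 ≤ r) (m : ℕ) : nv r H m ≤ m / r := by
  have := mul_nu_le r H (range m)
  rw [card_range] at this
  unfold nv
  rw [Nat.le_div_iff_mul_le (by omega)]
  linarith

lemma uu_nonneg (hr : 1 ≤ r) (m : ℕ) : 0 ≤ uu r H m := by
  rw [uu_eq]
  have : (nv r H m : ℝ) ≤ (m / r : ℕ) := by exact_mod_cast nv_le_div hr m
  have h2 : (0:ℝ) ≤ r := by positivity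
  exact mul_nonneg h2 (by linarith)

lemma xx_le (m : ℕ) : xx r H m ≤ m := by
  unfold xx
  have : (0:ℝ) ≤ r * nv r H m := by positivity
  linarith

lemma uu_le_xx (m : ℕ) : uu r H m ≤ xx r H m := by
  unfold uu
  have : (0:ℝ) ≤ (m % r : ℕ) := by positivity
  linarith

lemma xx_le_uu (hr : 1 ≤ r) (m : ℕ) : xx r H m ≤ uu r H m + (r - 1) := by
  unfold uu
  have h1 : m % r + 1 ≤ r := Nat.mod_lt _ (by omega)
  have : ((m % r : ℕ) : ℝ) + 1 ≤ r := by exact_mod_cast h1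
  linarith

lemma rho_le_uu (hr : 1 ≤ r) (m : ℕ) : rho r H m ≤ uu r H m := by
  unfold rho
  apply max_le _ (uu_nonneg hr m)
  have := xx_le_uu (H := H) hr m
  linarith

lemma rho_le_xx (hr : 1 ≤ r) (m : ℕ) : rho r H m ≤ xx r H m := (rho_le_uu hr m).trans (uu_le_xx m)

lemma inc_cases (m : ℕ) : inc r H m = 0 ∨ inc r H m = 1 := by
  have h1 := nv_succ_le r H m
  have h2 := nv_mono r H (Nat.le_succ m)
  simp only [Nat.succ_eq_add_one] at h2
  have : nv r H (m + 1) = nv r H m ∨ nv r H (m + 1) = nv r H m + 1 := by omega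
  unfold inc
  rcases this with h | h
  · left; rw [h]; ring
  · right; rw [h]; push_cast; ring

lemma xx_succ (m : ℕ) : xx r H (m + 1) = xx r H m + 1 - r * inc r H m := by
  unfold xx inc; push_cast; ring

lemma x_inc (m : ℕ) : r * (xx r H m * inc r H m) = xx r H m + 1 / 2 +
    (r ^ 2 - 2 * r) / 2 * inc r H m + (xx r H m ^ 2 - xx r H (m + 1) ^ 2) / 2 := by
  rw [xx_succ]
  rcases inc_cases (r := r) (H := H) m with h | h <;> rw [h] <;> ring

/-- pathwise bound for the error control -/
lemma path_err (hr : 2 ≤ r) (j : ℕ) {c : ℝ} (hc : (r:ℝ) ^ 2 ≤ c) :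
    (1 / 2) * ((xx r H (j + r - 1) + c) * yp r H j) -
      (xx r H (j + r - 1) + c) * NB r H (j + r - 1) * (1 - inc r H (j + r - 1)) ≤
    1 / (2 * r) * ((xx r H j ^ 2 + 2 * c * xx r H j) -
      (xx r H (j + r) ^ 2 + 2 * c * xx r H (j + r))) := by
  have hr2 : (2:ℝ) ≤ r := by exact_mod_cast hr
  have hr0 : (0:ℝ) < r := by linarith
  obtain ⟨m, hm⟩ : ∃ m, m = j + r - 1 := ⟨_, rfl⟩
  have hm1 : j + r = m + 1 := by omega
  have hmj : m - (r - 1) = j := by omega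
  set y : ℝ := (nv r H (j + r) : ℝ) - nv r H j - 1 with hy
  have hx1 : xx r H j = xx r H (j + r) + r * y := by
    rw [hy]; unfold xx; push_cast; ring
  have hx0 := xx_nonneg (r := r) (H := H) (j + r)
  have hx2 : xx r H (j + r) = xx r H m + 1 - r * inc r H m := by rw [hm1]; exact xx_succ m
  have hrhs : 1 / (2 * r) * ((xx r H j ^ 2 + 2 * c * xx r H j) -
      (xx r H (j + r) ^ 2 + 2 * c * xx r H (j + r))) = y * (xx r H (j + r) + c + r * y / 2) := by
    rw [hx1]; field_simp; ring
  rw [hrhs, ← hm]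
  have hyy : yp r H j = max y 0 := rfl
  have hnb : NB r H m = if nv r H j = nv r H m then 1 else 0 := by unfold NB; rw [hmj]
  have hmono := nv_mono r H (show j ≤ m by omega)
  have hmono2 := nv_mono r H (show m ≤ j + r by omega)
  have hsucc := nv_succ_le r H m
  rw [← hm1] at hsucc
  have hc0 : 0 ≤ c := le_trans (by positivity) hc
  have hg0 : 0 ≤ xx r H m := xx_nonneg m
  have hinc : inc r H m = (nv r H (j + r) : ℝ) - nv r H m := by unfold inc; rw [hm1]
  have hrc : (r:ℝ) ≤ c := by nlinarith
  rcases Nat.lt_trichotomy (nv r H (j + r)) (nv r H j + 1) with h | h | h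
  · have e1 : nv r H (j + r) = nv r H j := by omega
    have e2 : nv r H m = nv r H j := by omega
    have hyv : y = -1 := by rw [hy, e1]; ring
    have hi : inc r H m = 0 := by rw [hinc, e1, e2]; ring
    rw [hyy, hnb, if_pos e2.symm, hyv, hi, max_eq_right (by norm_num)]
    rw [hi] at hx2
    rw [hx2]
    nlinarith
  · have hyv : y = 0 := by rw [hy, h]; push_cast; ring
    rw [hyy, hyv, max_eq_left le_rfl]
    have : 0 ≤ NB r H m := by rw [hnb]; split_ifs <;> norm_num
    have h1i : 0 ≤ 1 - inc r H m := by
      rcases inc_cases (r := r) (H := H) m with h | h <;> rw [h] <;> norm_num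
    have : 0 ≤ (xx r H m + c) * NB r H m * (1 - inc r H m) := by positivity
    linarith
  · have hy1 : 1 ≤ y := by
      have : nv r H j + 2 ≤ nv r H (j + r) := by omega
      have : (nv r H j : ℝ) + 2 ≤ nv r H (j + r) := by exact_mod_cast this
      rw [hy]; linarith
    have hne : ¬ nv r H j = nv r H m := by omega
    rw [hyy, hnb, if_neg hne, max_eq_left (by linarith)]
    have h1 : xx r H m ≤ xx r H (j + r) + r := by
      rcases inc_cases (r := r) (H := H) m with h | h <;> rw [h] at hx2 <;> linarith
    have h2 : 1 / 2 * (xx r H m + c) ≤ xx r H (j + r) + c + r * y / 2 := by nlinarith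
    have := mul_le_mul_of_nonneg_left h2 (by linarith : 0 ≤ y)
    linarith

lemma inc_sub_NB_le (hr : 2 ≤ r) (j : ℕ) :
    inc r H (j + r - 1) - NB r H (j + r - 1) ≤ yp r H j := by
  obtain ⟨m, hm⟩ : ∃ m, m = j + r - 1 := ⟨_, rfl⟩
  rw [← hm]
  have hm1 : j + r = m + 1 := by omega
  have hmj : m - (r - 1) = j := by omega
  have hnb : NB r H m = if nv r H j = nv r H m then 1 else 0 := by unfold NB; rw [hmj]
  have hinc : inc r H m = (nv r H (j + r) : ℝ) - nv r H m := by unfold inc; rw [hm1]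
  have hmono := nv_mono r H (show j ≤ m by omega)
  rw [hnb]
  split_ifs with h
  · apply le_max_of_le_left
    rw [hinc, h]
  · rcases inc_cases (r := r) (H := H) m with h2 | h2
    · rw [h2]; apply le_max_of_le_right; norm_num
    · apply le_max_of_le_left
      have : nv r H j + 1 ≤ nv r H m := by omega
      have : (nv r H j : ℝ) + 1 ≤ nv r H m := by exact_mod_cast this
      rw [hinc]; linarith

lemma rho_le_g (hr : 2 ≤ r) (j : ℕ) {c : ℝ} (hc : (r:ℝ) ^ 2 ≤ c) :
    rho r H j ≤ xx r H (j + r - 1) + c := by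
  have hr2 : (2:ℝ) ≤ r := by exact_mod_cast hr
  have h : ∀ i, nv r H (j + i) ≤ nv r H j + i := by
    intro i
    induction i with
    | zero => simp
    | succ i ih => have := nv_succ_le r H (j + i); rw [← add_assoc]; omega
  have h1 := h (r - 1)
  rw [show j + (r - 1) = j + r - 1 by omega] at h1
  have h2 : (nv r H (j + r - 1) : ℝ) ≤ nv r H j + (r - 1) := by
    have : ((nv r H j + (r - 1) : ℕ) : ℝ) = nv r H j + (r - 1) := by
      push_cast [Nat.cast_sub (show 1 ≤ r by omega)]; ring
    rw [← this]; exact_mod_cast h1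
  have h3 : xx r H j ≤ xx r H (j + r - 1) + r ^ 2 := by
    have e : ((j + r - 1 : ℕ) : ℝ) = j + r - 1 := by
      rw [Nat.cast_sub (by omega)]; push_cast; ring
    unfold xx
    rw [e]
    nlinarith
  have := rho_le_xx (H := H) (show 1 ≤ r by omega) j
  linarith

/-- pathwise bound used for the total -/
lemma path_tot_aux (hr : 2 ≤ r) (m k : ℕ) (hk : k ≤ r - 1) :
    xx r H m - ∑ i ∈ range k, (xx r H (m + i) - i) * inc r H (m + i) ≤
      xx r H m * if nv r H m = nv r H (m + k) then 1 else 0 := by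
  have hr2 : (2:ℝ) ≤ r := by exact_mod_cast hr
  induction k with
  | zero => simp
  | succ k ih =>
    have ih := ih (by omega)
    rw [Finset.sum_range_succ]
    have hmono := nv_mono r H (show m ≤ m + k by omega)
    have hmono2 := nv_mono r H (show m + k ≤ m + (k + 1) by omega)
    have hkr : (k:ℝ) + 1 ≤ r - 1 := by
      have : k + 2 ≤ r := by omega
      have : (k:ℝ) + 2 ≤ r := by exact_mod_cast this
      linarith
    rcases inc_cases (r := r) (H := H) (m + k) with h | h
    · have e : nv r H (m + (k + 1)) = nv r H (m + k) := by
        unfold inc at h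
        have : (nv r H (m + k + 1) : ℝ) = nv r H (m + k) := by linarith
        exact_mod_cast this
      rw [h, e]; simpa using ih
    · have e : nv r H (m + (k + 1)) = nv r H (m + k) + 1 := by
        unfold inc at h
        have : (nv r H (m + k + 1) : ℝ) = nv r H (m + k) + 1 := by linarith
        exact_mod_cast this
      have hx := xx_succ (r := r) (H := H) (m + k)
      have hx0 := xx_nonneg (r := r) (H := H) (m + k + 1)
      rw [h] at hx ⊢
      rw [if_neg (by omega)]
      by_cases hmk : nv r H m = nv r H (m + k)
      · rw [if_pos hmk] at ih
        have : xx r H (m + k) = xx r H m + k := by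
          unfold xx; rw [hmk]; push_cast; ring
        rw [this]; linarith
      · rw [if_neg hmk] at ih
        linarith

lemma path_tot (hr : 2 ≤ r) (m : ℕ) :
    xx r H m - ∑ i ∈ range (r - 1), (xx r H (m + i) - i) * inc r H (m + i) ≤
      rho r H (m + (r - 1)) * NB r H (m + (r - 1)) := by
  refine (path_tot_aux hr m (r - 1) le_rfl).trans ?_
  unfold NB
  rw [Nat.add_sub_cancel]
  split_ifs with h
  · rw [mul_one, mul_one]
    unfold rho
    apply le_max_of_le_left
    unfold xx
    rw [h]; push_cast [Nat.cast_sub (show 1 ≤ r by omega)]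
    linarith
  · simp

end pathSec

lemma pt_exp {a l q : ℝ} (h0 : 0 ≤ a) (h1 : a ≤ 1) (hl : 6 ≤ l) (hq : q ≤ Real.exp (-(l * a))) :
    a * q ≤ 3 / l * (1 - q - a) + 2 * Real.exp (-(l / 2)) := by
  have hl0 : 0 < l := by linarith
  have h3 : 0 < 3 / l := by positivity
  have key : a * Real.exp (-(l * a)) ≤ 3 / l * (1 - Real.exp (-(l * a)) - a)
      + 2 * Real.exp (-(l / 2)) := by
    set E := Real.exp (-(l * a)) with hE
    have hE0 : 0 < E := Real.exp_pos _
    have hF0 : 0 < Real.exp (-(l / 2)) := Real.exp_pos _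
    rcases le_or_gt a (1 / 2) with h | h
    · set t := l * a with ht
      have ht0 : 0 ≤ t := by positivity
      have hE1 : E * Real.exp t = 1 := by rw [hE, ← Real.exp_add]; simp
      have hq := Real.quadratic_le_exp_of_nonneg ht0
      have hat : 6 * a ≤ t := by nlinarith
      have main : (t + 3) * E ≤ 3 - 3 * a := by
        have : t + 3 ≤ (3 - 3 * a) * Real.exp t := by
          rcases le_or_gt t 3 with h5 | h5
          · have e1 : (3 - t / 2) * Real.exp t ≤ (3 - 3 * a) * Real.exp t :=
              mul_le_mul_of_nonneg_right (by linarith) (Real.exp_pos _).le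
            have e2 : (3 - t / 2) * (1 + t + t ^ 2 / 2) ≤ (3 - t / 2) * Real.exp t :=
              mul_le_mul_of_nonneg_left hq (by linarith)
            have e3 : 0 ≤ t * (3 / 2 + t - t ^ 2 / 4) := mul_nonneg ht0 (by nlinarith)
            nlinarith
          · have e1 : (3 / 2) * Real.exp t ≤ (3 - 3 * a) * Real.exp t :=
              mul_le_mul_of_nonneg_right (by linarith) (Real.exp_pos _).le
            nlinarith
        calc (t + 3) * E ≤ (3 - 3 * a) * Real.exp t * E :=
              mul_le_mul_of_nonneg_right this hE0.le
          _ = (3 - 3 * a) * (E * Real.exp t) := by ring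
          _ = 3 - 3 * a := by rw [hE1, mul_one]
      have : a * E ≤ 3 / l * (1 - E - a) := by
        rw [div_mul_eq_mul_div, le_div_iff₀ hl0]
        nlinarith
      linarith
    · have hEF : E ≤ Real.exp (-(l / 2)) := by
        apply Real.exp_le_exp.2; nlinarith
      have h32 : 3 / l ≤ 1 / 2 := by rw [div_le_iff₀ hl0]; linarith
      have e1 : a * E ≤ E := by nlinarith
      have e2 : 3 / l * E ≤ 1 / 2 * E := mul_le_mul_of_nonneg_right h32 hE0.le
      have e3 : 0 ≤ 3 / l * (1 - a) := mul_nonneg h3.le (by linarith)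
      nlinarith
  have e1 : a * q ≤ a * Real.exp (-(l * a)) := mul_le_mul_of_nonneg_left hq h0
  have e2 : 3 / l * (1 - Real.exp (-(l * a)) - a) ≤ 3 / l * (1 - q - a) :=
    mul_le_mul_of_nonneg_left (by linarith) h3.le
  linarith

lemma pt_conv {a l q : ℝ} (h0 : 0 ≤ a) (h1 : a ≤ 1) (hq : q ≤ Real.exp (-(l * a))) :
    -Real.exp (-l) ≤ 1 - q - a := by
  have h := convexOn_exp.2 (Set.mem_univ (0:ℝ)) (Set.mem_univ (-l)) (by linarith : 0 ≤ 1 - a) h0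
    (by ring)
  simp only [smul_eq_mul, mul_zero, zero_add, Real.exp_zero, mul_one] at h
  have e : a * -l = -(l * a) := by ring
  rw [e] at h
  have : a * Real.exp (-l) ≤ Real.exp (-l) := mul_le_of_le_one_left (Real.exp_pos _).le h1
  linarith

lemma q_le {r : ℕ} {H : Finset (Finset ℕ)} {m : ℕ} {p : ℝ} (h0 : 0 ≤ p) (h1 : p ≤ 1)
    (hrm : r - 1 ≤ m) :
    (1 - p) ^ #(Nn r H m) ≤ Real.exp (-((p * m.choose (r - 1)) * al r H m)) := by
  have hc := choose_pos' hrm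
  have e : (p * m.choose (r - 1)) * al r H m = #(Nn r H m) * p := by
    unfold al; field_simp
  rw [e, ← mul_neg, Real.exp_nat_mul]
  apply pow_le_pow_left₀ (by linarith)
  have := Real.add_one_le_exp (-p)
  linarith

section ineqSec
variable {r Q : ℕ} {p : ℝ}

lemma past_const {α : Type*} (m : ℕ) (c : α) : Past m (fun _ : Finset (Finset ℕ) => c) :=
  fun _ _ _ => rfl

lemma g_fun (r m : ℕ) (c : ℝ) (H : Finset (Finset ℕ)) :
    xx r H m + c = (fun k : ℕ => (m:ℝ) - r * k + c) (nv r H m) := rfl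

lemma E_g_NB_inc {m : ℕ} (hr : 2 ≤ r) (hm : m < Q) (hk : r - 1 ≤ m) (h0 : 0 ≤ p) (h1 : p ≤ 1)
    {c : ℝ} (hc : 0 ≤ c) (hl : 12 ≤ p * m.choose (r - 1)) :
    EQ r Q p (fun H => (xx r H m + c) * NB r H m * (1 - inc r H m)) ≤
      3 / (p * m.choose (r - 1)) * EQ r Q p (fun H => (xx r H m + c) * (inc r H m - NB r H m))
      + 2 * Real.exp (-(p * m.choose (r - 1) / 2)) * EQ r Q p (fun H => xx r H m + c) := by
  set l := p * m.choose (r - 1) with hlv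
  have e1 : EQ r Q p (fun H => (xx r H m + c) * NB r H m * (1 - inc r H m)) =
      EQ r Q p (fun H => (xx r H m + c) * al r H m * (1 - p) ^ #(Nn r H m)) :=
    E_NB_inc (by omega) hm hk p (fun k : ℕ => (m:ℝ) - r * k + c)
  have e2 : EQ r Q p (fun H => (xx r H m + c) * NB r H m) =
      EQ r Q p (fun H => (xx r H m + c) * al r H m) :=
    E_NB hm.le hk p (fun k : ℕ => (m:ℝ) - r * k + c)
  have hpast : Past m (fun H => xx r H m + c) := by
    intro H H' h
    have : nv r H m = nv r H' m := past_nv r m H H' h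
    simp only [xx, this]
  have e3 := E_inc (by omega : 1 ≤ r) hm p hpast
  have e4 : EQ r Q p (fun H => (xx r H m + c) * (inc r H m - NB r H m)) =
      EQ r Q p (fun H => (xx r H m + c) * (1 - (1 - p) ^ #(Nn r H m) - al r H m)) := by
    simp only [mul_sub (xx r _ m + c) (inc r _ m), mul_sub (xx r _ m + c) (1 - (1 - p) ^ _)]
    rw [E_sub, E_sub, e2, e3]
  rw [e1, e4, ← E_smul, ← E_smul, ← E_add]
  apply E_mono h0 h1
  intro H
  have hg : 0 ≤ xx r H m + c := add_nonneg (xx_nonneg m) hc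
  have := mul_le_mul_of_nonneg_left
    (pt_exp (al_nonneg (r := r) (H := H) (m := m)) al_le_one (by linarith : 6 ≤ l)
      (q_le (r := r) (H := H) h0 h1 hk)) hg
  linarith

lemma near_mono {j : ℕ} (hr : 2 ≤ r) (hm : j + r ≤ Q) (h0 : 0 ≤ p) (h1 : p ≤ 1) :
    EQ r Q p (fun H => uu r H (j + r)) ≤ EQ r Q p (fun H => uu r H j) +
      r * Real.exp (-(p * (j + r - 1).choose (r - 1))) := by
  have hr0 : (0:ℝ) ≤ r := by positivity
  obtain ⟨m, hm'⟩ : ∃ m, m = j + r - 1 := ⟨_, rfl⟩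
  rw [← hm']
  have hpath : ∀ H, uu r H (j + r) ≤ uu r H j + r * (NB r H m - inc r H m) := by
    intro H
    have hm1 : j + r = m + 1 := by omega
    have hmj : m - (r - 1) = j := by omega
    have hnb : NB r H m = if nv r H j = nv r H m then 1 else 0 := by unfold NB; rw [hmj]
    have hinc : inc r H m = (nv r H (j + r) : ℝ) - nv r H m := by unfold inc; rw [hm1]
    have hmono := nv_mono r H (show j ≤ m by omega)
    have hd : (j + r) / r = j / r + 1 := Nat.add_div_right j (by omega)
    rw [uu_eq, uu_eq, ← mul_add]
    apply mul_le_mul_of_nonneg_left _ hr0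
    rw [hd, hnb, hinc]
    push_cast
    split_ifs with h
    · rw [h]; linarith
    · have : nv r H j + 1 ≤ nv r H m := by omega
      have : (nv r H j : ℝ) + 1 ≤ nv r H m := by exact_mod_cast this
      linarith
  have e0 := E_mono (r := r) (Q := Q) h0 h1 hpath
  rw [E_add, E_smul, E_sub] at e0
  have e1 : EQ r Q p (fun H => NB r H m) = EQ r Q p (fun H => al r H m) := by
    have := E_NB (r := r) (Q := Q) (m := m) (by omega) (by omega) p (fun _ => 1)
    simpa using this
  have e2 : EQ r Q p (fun H => inc r H m) = EQ r Q p (fun H => 1 - (1 - p) ^ #(Nn r H m)) := by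
    have := E_inc (r := r) (Q := Q) (m := m) (by omega) (by omega) p (past_const m (1:ℝ))
    simpa using this
  rw [e1, e2, ← E_sub] at e0
  have e3 : EQ r Q p (fun H => al r H m - (1 - (1 - p) ^ #(Nn r H m))) ≤
      EQ r Q p (fun _ => Real.exp (-(p * m.choose (r - 1)))) := by
    apply E_mono h0 h1
    intro H
    have := pt_conv (al_nonneg (r := r) (H := H) (m := m)) al_le_one
      (q_le (r := r) (H := H) h0 h1 (by omega))
    linarith
  rw [E_const] at e3
  have := mul_le_mul_of_nonneg_left e3 hr0
  linarith

end ineqSec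

noncomputable def wU (r Q : ℕ) (ω : ℕ → ℝ) (p : ℝ) : ℝ :=
  ∑ m ∈ range Q, ω m * EQ r Q p (fun H => uu r H m)
noncomputable def wS (r Q : ℕ) (ω : ℕ → ℝ) (p : ℝ) : ℝ :=
  ∑ m ∈ range Q, ω m * EQ r Q p (fun H => xx r H m ^ 2)
noncomputable def wA (r Q : ℕ) (ω : ℕ → ℝ) (p : ℝ) : ℝ :=
  ∑ m ∈ range Q, ω m * (m * bb r Q p m)
noncomputable def wW (Q : ℕ) (ω : ℕ → ℝ) : ℝ := ∑ m ∈ range Q, ω m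
noncomputable def wE (r Q : ℕ) (γ τ : ℝ) (ω : ℕ → ℝ) (p : ℝ) : ℝ :=
  γ * ∑ m ∈ range Q, (ω m + τ) * (EQ r Q p (fun H => xx r H m ^ 2) + 1)

section tot
variable {r Q a : ℕ} {γ τ : ℝ} {ω : ℕ → ℝ}

lemma Wt.shift_le (h : Wt r Q a γ τ ω) {i : ℕ} (hi : i ≤ 2 * r) (F G : ℕ → ℝ) {C : ℝ}
    (hF : ∀ m, m < Q → |F m| ≤ C * G m) :
    |∑ m ∈ range Q, ω m * F (m + i) - ∑ m ∈ range Q, ω m * F m| ≤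
      C * (γ * ∑ m ∈ range Q, (ω m + τ) * G m) := by
  refine (h.shift hi F (fun m => C * G m) hF).trans (le_of_eq ?_)
  rw [mul_left_comm, Finset.mul_sum (s := range Q) (a := C)]
  congr 1
  exact Finset.sum_congr rfl fun m _ => by ring

lemma sawtooth (hr : 2 ≤ r) (m : ℕ) :
    ((m % r : ℕ) : ℝ) - (r - 1) / 2 =
      (((m + 1) % r : ℕ) : ℝ) * (((m + 1) % r : ℕ) - r) / 2 -
      ((m % r : ℕ) : ℝ) * ((m % r : ℕ) - r) / 2 := by
  have h1 : m % r < r := Nat.mod_lt _ (by omega)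
  rcases Nat.lt_or_ge (m % r + 1) r with h | h
  · have : (m + 1) % r = m % r + 1 := by
      rw [Nat.add_mod, Nat.mod_eq_of_lt (show 1 < r by omega), Nat.mod_eq_of_lt h]
    rw [this]; push_cast; ring
  · have e : m % r + 1 = r := by omega
    have : (m + 1) % r = 0 := by
      rw [Nat.add_mod, Nat.mod_eq_of_lt (show 1 < r by omega), e, Nat.mod_self]
    have e2 : ((m % r : ℕ) : ℝ) + 1 = r := by exact_mod_cast e
    rw [this, ← e2]; push_cast; ring

lemma tot_path (h : Wt r Q a γ τ ω) (hr : 2 ≤ r) (H : Finset (Finset ℕ)) :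
    1 / r * ∑ m ∈ range Q, ω m * uu r H m - 4 * r ^ 2 *
      (γ * ∑ m ∈ range Q, (ω m + τ) * (xx r H m ^ 2 + 1)) ≤
    ∑ m ∈ range Q, ω m * (rho r H m * NB r H m) := by
  have hr2 : (2:ℝ) ≤ r := by exact_mod_cast hr
  have hr0 : (0:ℝ) < r := by linarith
  set 𝓔 := γ * ∑ m ∈ range Q, (ω m + τ) * (xx r H m ^ 2 + 1) with h𝓔
  have h𝓔0 : 0 ≤ 𝓔 := by
    apply mul_nonneg h.g0 (Finset.sum_nonneg fun m _ => ?_)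
    have := h.nonneg m
    have := h.t0
    positivity
  have x0 : ∀ m, 0 ≤ xx r H m := fun m => xx_nonneg m
  have i01 : ∀ m, 0 ≤ inc r H m ∧ inc r H m ≤ 1 := by
    intro m
    rcases inc_cases (r := r) (H := H) m with h | h <;> rw [h] <;> norm_num
  have n01 : ∀ m, 0 ≤ NB r H m ∧ NB r H m ≤ 1 := by
    intro m; unfold NB; split_ifs <;> norm_num
  -- shifts
  have s1 := h.shift_le (i := r - 1) (by omega) (fun m => rho r H m * NB r H m)
    (fun m => xx r H m ^ 2 + 1) (C := 1) (by
      intro m _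
      have a1 := rho_nonneg (r := r) (H := H) (m := m)
      have a2 := rho_le_xx (H := H) (show 1 ≤ r by omega) m
      rw [abs_of_nonneg (mul_nonneg a1 (n01 m).1)]
      have := mul_le_of_le_one_right a1 (n01 m).2
      nlinarith [sq_nonneg (xx r H m - 1)])
  have s2 : ∀ i ∈ range (r - 1), |∑ m ∈ range Q, ω m * ((xx r H (m + i) - i) * inc r H (m + i)) -
      ∑ m ∈ range Q, ω m * ((xx r H m - i) * inc r H m)| ≤ (r + 1) * 𝓔 := by
    intro i hi
    rw [mem_range] at hi
    apply h.shift_le (i := i) (by omega) (fun m => (xx r H m - i) * inc r H m)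
      (fun m => xx r H m ^ 2 + 1)
    intro m _
    rw [abs_mul, abs_of_nonneg (i01 m).1]
    have hi2 : (i:ℝ) ≤ r := by exact_mod_cast (by omega : i ≤ r)
    have hi0 : (0:ℝ) ≤ i := by positivity
    have b1 : |xx r H m - i| ≤ xx r H m + r := by
      rw [abs_le]; constructor <;> linarith [x0 m]
    have := mul_le_of_le_one_right (abs_nonneg (xx r H m - i)) (i01 m).2
    nlinarith [sq_nonneg (xx r H m - 1), x0 m, mul_nonneg hr0.le (sq_nonneg (xx r H m))]
  have s3 := h.shift_le (i := 1) (by omega) (fun m => xx r H m ^ 2)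
    (fun m => xx r H m ^ 2 + 1) (C := 1) (by
      intro m _
      rw [abs_of_nonneg (sq_nonneg _)]; linarith)
  have s4 := h.shift_le (i := 1) (by omega) (fun m => ((m % r : ℕ) : ℝ) * ((m % r : ℕ) - r) / 2)
    (fun m => xx r H m ^ 2 + 1) (C := r ^ 2) (by
      intro m _
      have h1 : m % r ≤ r := (Nat.mod_lt _ (by omega)).le
      have h2 : ((m % r : ℕ) : ℝ) ≤ r := by exact_mod_cast h1
      have h3 : (0:ℝ) ≤ ((m % r : ℕ) : ℝ) := by positivity
      rw [abs_le]; constructor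
      · nlinarith [sq_nonneg (xx r H m), mul_nonneg (sq_nonneg (r:ℝ)) (sq_nonneg (xx r H m))]
      · nlinarith [sq_nonneg (xx r H m), mul_nonneg (sq_nonneg (r:ℝ)) (sq_nonneg (xx r H m))])
  -- path inequality summed
  have p1 : ∑ m ∈ range Q, ω m * xx r H m - ∑ i ∈ range (r - 1),
      ∑ m ∈ range Q, ω m * ((xx r H (m + i) - i) * inc r H (m + i)) ≤
      ∑ m ∈ range Q, ω m * (rho r H (m + (r - 1)) * NB r H (m + (r - 1))) := by
    rw [Finset.sum_comm, ← Finset.sum_sub_distrib]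
    apply Finset.sum_le_sum
    intro m _
    rw [← Finset.mul_sum, ← mul_sub]
    exact mul_le_mul_of_nonneg_left (path_tot hr m) (h.nonneg m)
  have p2 : ∑ i ∈ range (r - 1), ∑ m ∈ range Q, ω m * ((xx r H (m + i) - i) * inc r H (m + i)) ≤
      ∑ i ∈ range (r - 1), ∑ m ∈ range Q, ω m * ((xx r H m - i) * inc r H m)
        + (r - 1) * ((r + 1) * 𝓔) := by
    have : ∑ i ∈ range (r - 1), ((r:ℝ) + 1) * 𝓔 = (r - 1) * ((r + 1) * 𝓔) := by
      rw [Finset.sum_const, card_range, nsmul_eq_mul, Nat.cast_sub (by omega)]; simp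
    rw [← this, ← Finset.sum_add_distrib]
    apply Finset.sum_le_sum
    intro i hi
    have := (abs_le.1 (s2 i hi)).2
    linarith
  have hsumi : ∑ i ∈ range (r - 1), (i:ℝ) = (r - 1) * (r - 2) / 2 := by
    have := Finset.sum_range_id_mul_two (r - 1)
    have h2 : ((∑ i ∈ range (r - 1), i : ℕ) : ℝ) * 2 = (r - 1) * (r - 2) := by
      have h3 : ((r - 1 : ℕ) : ℝ) = r - 1 := by rw [Nat.cast_sub (by omega)]; simp
      have h4 : ((r - 1 - 1 : ℕ) : ℝ) = r - 2 := by
        rw [show r - 1 - 1 = r - 2 by omega, Nat.cast_sub (by omega)]; simp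
      rw [← h3, ← h4]; exact_mod_cast this
    push_cast at h2; linarith
  have p3 : ∑ m ∈ range Q, ω m * xx r H m -
      ∑ i ∈ range (r - 1), ∑ m ∈ range Q, ω m * ((xx r H m - i) * inc r H m) =
      1 / r * ∑ m ∈ range Q, ω m * uu r H m +
      1 / r * (∑ m ∈ range Q, ω m * ((((m + 1) % r : ℕ) : ℝ) * (((m + 1) % r : ℕ) - r) / 2) -
        ∑ m ∈ range Q, ω m * (((m % r : ℕ) : ℝ) * ((m % r : ℕ) - r) / 2)) +
      (r - 1) / (2 * r) * (∑ m ∈ range Q, ω m * xx r H (m + 1) ^ 2 -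
        ∑ m ∈ range Q, ω m * xx r H m ^ 2) := by
    rw [Finset.sum_comm]
    simp only [mul_sub (1 / (r:ℝ)), mul_sub (((r:ℝ) - 1) / (2 * r)), Finset.mul_sum]
    rw [← Finset.sum_sub_distrib, ← Finset.sum_sub_distrib, ← Finset.sum_add_distrib,
      ← Finset.sum_sub_distrib, ← Finset.sum_add_distrib]
    apply Finset.sum_congr rfl
    intro m _
    have c1 : ∑ i ∈ range (r - 1), ω m * ((xx r H m - i) * inc r H m) =
        ω m * (((r - 1) * xx r H m - (r - 1) * (r - 2) / 2) * inc r H m) := by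
      rw [← Finset.mul_sum, ← Finset.sum_mul, Finset.sum_sub_distrib, hsumi]
      rw [Finset.sum_const, card_range, nsmul_eq_mul, Nat.cast_sub (by omega)]; simp
    rw [c1]
    have c2 := x_inc (r := r) (H := H) m
    have c3 := sawtooth hr m
    have c4 : uu r H m = xx r H m - (m % r : ℕ) := rfl
    have c5 : xx r H m * inc r H m = 1 / r * (xx r H m + 1 / 2 +
        (r ^ 2 - 2 * r) / 2 * inc r H m + (xx r H m ^ 2 - xx r H (m + 1) ^ 2) / 2) := by
      rw [← c2]; field_simp
    have c6 : ((r - 1) * xx r H m - (r - 1) * (r - 2) / 2) * inc r H m =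
        (r - 1) * (xx r H m * inc r H m) - (r - 1) * (r - 2) / 2 * inc r H m := by ring
    rw [c6, c5]
    have c7 : (((m + 1) % r : ℕ) : ℝ) * (((m + 1) % r : ℕ) - r) / 2 =
      ((m % r : ℕ) : ℝ) - (r - 1) / 2 + ((m % r : ℕ) : ℝ) * ((m % r : ℕ) - r) / 2 := by linarith
    rw [c7, c4]
    field_simp
    ring
  have q1 := (abs_le.1 s1).2
  have q3 := (abs_le.1 s3).1
  have q4 := (abs_le.1 s4).1
  rw [← h𝓔] at q1 q3 q4
  have t1 : 1 / (r:ℝ) * (-(r ^ 2 * 𝓔)) ≤ 1 / r *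
      (∑ m ∈ range Q, ω m * ((((m + 1) % r : ℕ) : ℝ) * (((m + 1) % r : ℕ) - r) / 2) -
        ∑ m ∈ range Q, ω m * (((m % r : ℕ) : ℝ) * ((m % r : ℕ) - r) / 2)) :=
    mul_le_mul_of_nonneg_left q4 (by positivity)
  have t2 : (r - 1) / (2 * r) * (-(1 * 𝓔)) ≤ (r - 1) / (2 * r) *
      (∑ m ∈ range Q, ω m * xx r H (m + 1) ^ 2 - ∑ m ∈ range Q, ω m * xx r H m ^ 2) :=
    mul_le_mul_of_nonneg_left q3 (div_nonneg (by linarith) (by linarith))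
  have t3 : 1 / (r:ℝ) * (-(r ^ 2 * 𝓔)) = - (r * 𝓔) := by field_simp
  have t4 : ((r:ℝ) - 1) / (2 * r) ≤ 1 := by rw [div_le_one (by linarith)]; linarith
  have t5 : (r - 1) / (2 * r) * 𝓔 ≤ 1 * 𝓔 := mul_le_mul_of_nonneg_right t4 h𝓔0
  have t6 : ((r:ℝ) - 1) * ((r + 1) * 𝓔) + 2 * 𝓔 + r * 𝓔 ≤ 4 * r ^ 2 * 𝓔 := by
    have : ((r:ℝ) - 1) * (r + 1) + 2 + r ≤ 4 * r ^ 2 := by nlinarith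
    have := mul_le_mul_of_nonneg_right this h𝓔0
    linarith
  linarith

end tot

section expSec
variable {r Q a : ℕ} {γ τ : ℝ} {ω : ℕ → ℝ} {p : ℝ}

lemma wE_nonneg (h : Wt r Q a γ τ ω) (h0 : 0 ≤ p) (h1 : p ≤ 1) : 0 ≤ wE r Q γ τ ω p := by
  apply mul_nonneg h.g0 (Finset.sum_nonneg fun m _ => ?_)
  have := h.nonneg m
  have := h.t0
  have := E_nonneg (r := r) (Q := Q) h0 h1 (f := fun H => xx r H m ^ 2) (fun H => sq_nonneg _)
  positivity

lemma tot_E (h : Wt r Q a γ τ ω) (hr : 2 ≤ r) (h0 : 0 ≤ p) (h1 : p ≤ 1) :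
    1 / r * wU r Q ω p - 4 * r ^ 2 * wE r Q γ τ ω p ≤
    ∑ m ∈ range Q, ω m * EQ r Q p (fun H => al r H m * rho r H m) := by
  have e := E_mono (r := r) (Q := Q) h0 h1 (tot_path h hr)
  rw [E_sub, E_smul, E_smul, E_smul, E_sum, E_sum, E_sum] at e
  simp only [E_smul, E_add, E_const] at e
  unfold wU wE
  refine e.trans (le_of_eq (Finset.sum_congr rfl fun m hm => ?_))
  rcases Nat.lt_or_ge m a with hma | hma
  · rw [h.lo m hma]; simp
  · congr 1
    have ha := h.ha
    have := E_NB (r := r) (Q := Q) (m := m) (mem_range.1 hm).le (by omega) p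
      (fun k : ℕ => max ((m:ℝ) - r * k - (r - 1)) 0)
    have e2 : ∀ H, al r H m * rho r H m = rho r H m * al r H m := fun H => mul_comm _ _
    simp only [e2]
    exact this

lemma crude (h : Wt r Q a γ τ ω) (hr : 2 ≤ r) (h0 : 0 ≤ p) (h1 : p ≤ 1) :
    1 / r * wU r Q ω p - 4 * r ^ 2 * wE r Q γ τ ω p ≤ wA r Q ω p := by
  refine (tot_E h hr h0 h1).trans (Finset.sum_le_sum fun m hm => ?_)
  rcases Nat.lt_or_ge m a with hma | hma
  · rw [h.lo m hma]; simp
  · have ha := h.ha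
    exact mul_le_mul_of_nonneg_left
      (crude_bb (by omega) (mem_range.1 hm).le (by omega) h0 h1) (h.nonneg m)

lemma sum_yp (h : Wt r Q a γ τ ω) (hr : 2 ≤ r) (h0 : 0 ≤ p) (h1 : p ≤ 1) {Λ : ℝ} (hΛ : 12 ≤ Λ)
    (hl : ∀ m, a ≤ m → Λ ≤ p * m.choose (r - 1)) :
    ∑ m ∈ range Q, ω m * EQ r Q p (fun H => rho r H m * yp r H m) ≤
      2 * r ^ 2 * wE r Q γ τ ω p +
        8 * Real.exp (-(Λ / 2)) * (wU r Q ω p + 2 * r ^ 2 * wW Q ω) := by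
  have hr2 : (2:ℝ) ≤ r := by exact_mod_cast hr
  have hr0 : (0:ℝ) < r := by linarith
  have hE0 := wE_nonneg h h0 h1
  set c : ℝ := r ^ 2 with hc
  set X : ℕ → ℝ := fun m => EQ r Q p (fun H => xx r H m ^ 2 + 2 * c * xx r H m) with hX
  have hx : ∀ m H, 0 ≤ xx r H m := fun m H => xx_nonneg m
  have hcc : 0 ≤ c := by positivity
  have pt : ∀ m ∈ range Q, ω m * EQ r Q p (fun H => rho r H m * yp r H m) ≤
      ω m * (2 / r * (X m - X (m + r)) + 8 * Real.exp (-(Λ / 2)) *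
        (EQ r Q p (fun H => uu r H m) + 2 * r ^ 2)) := by
    intro j hj
    rw [mem_range] at hj
    rcases Nat.lt_or_ge j a with hja | hja
    · rw [h.lo j hja]; simp
    rcases Nat.lt_or_ge (j + 2 * r) Q with hjQ | hjQ
    swap
    · rw [h.hi j hjQ]; simp
    apply mul_le_mul_of_nonneg_left _ (h.nonneg j)
    have ha := h.ha
    have e1 := E_mono (r := r) (Q := Q) h0 h1 (fun H => path_err (r := r) (H := H) hr j (c := c) le_rfl)
    rw [E_sub, E_smul, E_smul, E_sub] at e1
    have hlj := hl (j + r - 1) (by omega)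
    have e2 := E_g_NB_inc (r := r) (Q := Q) (p := p) (m := j + r - 1) hr (by omega) (by omega) h0 h1
      hcc (by linarith)
    have e3 : EQ r Q p (fun H => (xx r H (j + r - 1) + c) *
        (inc r H (j + r - 1) - NB r H (j + r - 1))) ≤
        EQ r Q p (fun H => (xx r H (j + r - 1) + c) * yp r H j) := by
      apply E_mono h0 h1
      intro H
      exact mul_le_mul_of_nonneg_left (inc_sub_NB_le hr j) (add_nonneg (hx _ H) hcc)
    have hY0 : 0 ≤ EQ r Q p (fun H => (xx r H (j + r - 1) + c) * yp r H j) := by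
      apply E_nonneg h0 h1
      intro H
      exact mul_nonneg (add_nonneg (hx _ H) hcc) (le_max_right _ _)
    have hg0 : 0 ≤ EQ r Q p (fun H => xx r H (j + r - 1) + c) :=
      E_nonneg h0 h1 fun H => add_nonneg (hx _ H) hcc
    have e4 : EQ r Q p (fun H => rho r H j * yp r H j) ≤
        EQ r Q p (fun H => (xx r H (j + r - 1) + c) * yp r H j) := by
      apply E_mono h0 h1
      intro H
      exact mul_le_mul_of_nonneg_right (rho_le_g hr j le_rfl) (le_max_right _ _)
    have e5 : EQ r Q p (fun H => xx r H (j + r - 1) + c) ≤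
        EQ r Q p (fun H => uu r H j) + 2 * r ^ 2 := by
      have : EQ r Q p (fun H => uu r H j) + 2 * r ^ 2 = EQ r Q p (fun H => uu r H j + 2 * r ^ 2) := by
        rw [E_add, E_const]
      rw [this]
      apply E_mono h0 h1
      intro H
      have b1 := xx_le_uu (H := H) (show 1 ≤ r by omega) j
      have b2 := nv_mono r H (show j ≤ j + r - 1 by omega)
      have b3 : (nv r H j : ℝ) ≤ nv r H (j + r - 1) := by exact_mod_cast b2
      have b4 : ((j + r - 1 : ℕ) : ℝ) = j + r - 1 := by
        rw [Nat.cast_sub (by omega)]; push_cast; ring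
      have b5 : xx r H (j + r - 1) ≤ xx r H j + (r - 1) := by
        unfold xx; rw [b4]; nlinarith
      nlinarith
    set l := p * ((j + r - 1).choose (r - 1) : ℝ) with hlv
    have e6 : Real.exp (-(l / 2)) ≤ Real.exp (-(Λ / 2)) := Real.exp_le_exp.2 (by linarith)
    have e7 : 3 / l ≤ 1 / 4 := by rw [div_le_iff₀ (by linarith)]; linarith
    have e8 : 3 / l * EQ r Q p (fun H => (xx r H (j + r - 1) + c) *
        (inc r H (j + r - 1) - NB r H (j + r - 1))) ≤ 1 / 4 *
        EQ r Q p (fun H => (xx r H (j + r - 1) + c) * yp r H j) :=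
      (mul_le_mul_of_nonneg_left e3 (div_nonneg (by norm_num) (by linarith))).trans
        (mul_le_mul_of_nonneg_right e7 hY0)
    have e9 : Real.exp (-(l / 2)) * EQ r Q p (fun H => xx r H (j + r - 1) + c) ≤
        Real.exp (-(Λ / 2)) * (EQ r Q p (fun H => uu r H j) + 2 * r ^ 2) :=
      mul_le_mul e6 e5 hg0 (Real.exp_pos _).le
    have e10 : 2 / (r:ℝ) * (X j - X (j + r)) = 4 * (1 / (2 * r) * (X j - X (j + r))) := by
      field_simp; ring
    rw [e10]
    simp only [hX]
    linarith
  refine (Finset.sum_le_sum pt).trans ?_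
  have s := h.shift_le (i := r) (by omega) X (fun m => EQ r Q p (fun H => xx r H m ^ 2) + 1)
    (C := 1 + c) (by
      intro m _
      have : (1 + c) * (EQ r Q p (fun H => xx r H m ^ 2) + 1) =
          EQ r Q p (fun H => (1 + c) * (xx r H m ^ 2 + 1)) := by
        rw [E_smul, E_add, E_const]
      rw [this, abs_of_nonneg]
      · apply E_mono h0 h1
        intro H
        nlinarith [mul_nonneg hcc (sq_nonneg (xx r H m - 1))]
      · apply E_nonneg h0 h1
        intro H
        have := hx m H
        positivity)
  have s2 := (abs_le.1 s).1
  have t : ∑ m ∈ range Q, ω m * (2 / r * (X m - X (m + r)) + 8 * Real.exp (-(Λ / 2)) *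
        (EQ r Q p (fun H => uu r H m) + 2 * r ^ 2)) =
      2 / r * (∑ m ∈ range Q, ω m * X m - ∑ m ∈ range Q, ω m * X (m + r)) +
      8 * Real.exp (-(Λ / 2)) * (wU r Q ω p + 2 * r ^ 2 * wW Q ω) := by
    unfold wU wW
    rw [Finset.mul_sum (s := range Q) (a := 2 * (r:ℝ) ^ 2), ← Finset.sum_add_distrib,
      Finset.mul_sum, ← Finset.sum_sub_distrib, Finset.mul_sum, ← Finset.sum_add_distrib]
    exact Finset.sum_congr rfl fun m _ => by ring
  rw [t]
  have hw : wE r Q γ τ ω p = γ * ∑ m ∈ range Q, (ω m + τ) *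
    (EQ r Q p (fun H => xx r H m ^ 2) + 1) := rfl
  rw [← hw] at s2
  have u1 : 2 / (r:ℝ) * (∑ m ∈ range Q, ω m * X m - ∑ m ∈ range Q, ω m * X (m + r)) ≤
      2 / r * ((1 + c) * wE r Q γ τ ω p) :=
    mul_le_mul_of_nonneg_left (by linarith) (by positivity)
  have u2 : 2 / (r:ℝ) * ((1 + c) * wE r Q γ τ ω p) ≤ 1 * ((1 + c) * wE r Q γ τ ω p) := by
    apply mul_le_mul_of_nonneg_right _ (by positivity)
    rw [div_le_one hr0]; exact hr2
  have u3 : (1 + c) * wE r Q γ τ ω p ≤ 2 * r ^ 2 * wE r Q γ τ ω p :=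
    mul_le_mul_of_nonneg_right (by rw [hc]; nlinarith) hE0
  linarith

lemma shift_bb (h : Wt r Q a γ τ ω) (h0 : 0 ≤ p) (h1 : p ≤ 1) :
    ∑ m ∈ range Q, ω m * (m * bb r Q p (m + r)) ≤ 2 * wA r Q ω p + τ * Q ^ 2 := by
  have b0 : ∀ m, 0 ≤ bb r Q p m := fun m => bb_nonneg h0 h1
  have b1 : ∀ m, bb r Q p m ≤ 1 := fun m => bb_le_one h0 h1
  have s := h.shift (i := r) (by omega) (fun m => (m:ℝ) * bb r Q p m) (fun m => m * bb r Q p m)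
    (fun m _ => by rw [abs_of_nonneg (mul_nonneg (by positivity) (b0 m))])
  have s2 := (abs_le.1 s).2
  have e1 : ∑ m ∈ range Q, ω m * (m * bb r Q p (m + r)) ≤
      ∑ m ∈ range Q, ω m * (((m + r : ℕ) : ℝ) * bb r Q p (m + r)) := by
    apply Finset.sum_le_sum
    intro m _
    apply mul_le_mul_of_nonneg_left _ (h.nonneg m)
    apply mul_le_mul_of_nonneg_right _ (b0 _)
    push_cast; linarith [(Nat.cast_nonneg r : (0:ℝ) ≤ r)]
  have e2 : ∑ m ∈ range Q, (ω m + τ) * (m * bb r Q p m) ≤ wA r Q ω p + τ * Q ^ 2 := by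
    have : τ * (Q:ℝ) ^ 2 = ∑ m ∈ range Q, τ * Q := by
      rw [Finset.sum_const, card_range, nsmul_eq_mul]; ring
    unfold wA
    rw [this, ← Finset.sum_add_distrib]
    apply Finset.sum_le_sum
    intro m hm
    have hmQ : (m:ℝ) ≤ Q := by exact_mod_cast (mem_range.1 hm).le
    have : (m:ℝ) * bb r Q p m ≤ Q := by
      have := mul_le_of_le_one_right (Nat.cast_nonneg m : (0:ℝ) ≤ m) (b1 m)
      linarith
    have := mul_le_mul_of_nonneg_left this h.t0
    linarith
  have e3 : 0 ≤ ∑ m ∈ range Q, (ω m + τ) * (m * bb r Q p m) := by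
    apply Finset.sum_nonneg
    intro m _
    exact mul_nonneg (add_nonneg (h.nonneg m) h.t0) (mul_nonneg (by positivity) (b0 m))
  have e4 := mul_le_of_le_one_left e3 h.g1
  have hA : wA r Q ω p = ∑ m ∈ range Q, ω m * (m * bb r Q p m) := rfl
  linarith

lemma sharp (h : Wt r Q a γ τ ω) (hr : 2 ≤ r) (h0 : 0 ≤ p) (h1 : p ≤ 1) {Λ Λp K T : ℝ}
    (hΛ : 12 ≤ Λ) (hl : ∀ m, a ≤ m → Λ ≤ p * m.choose (r - 1))
    (hu : ∀ m, m < Q → p * m.choose (r - 1) ≤ Λp) (hK : 0 < K) (hT : 0 < T) (hKΛ : 2 * K ≤ Λ) :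
    1 / r * wU r Q ω p - 4 * r ^ 2 * wE r Q γ τ ω p ≤
      1 / r * (wA r Q ω p + 4 * K ^ 2 * r ^ 2 / a * wS r Q ω p) +
      1 / K * (2 * wA r Q ω p + τ * Q ^ 2 + T * (2 * r ^ 2 * wE r Q γ τ ω p +
        8 * Real.exp (-(Λ / 2)) * (wU r Q ω p + 2 * r ^ 2 * wW Q ω)) +
        (Λp ^ 2 + Λp) / T * wU r Q ω p) := by
  have hr2 : (2:ℝ) ≤ r := by exact_mod_cast hr
  have hr0 : (0:ℝ) < r := by linarith
  have ha := h.ha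
  have ha0 : (0:ℝ) < a := by exact_mod_cast (by omega : 0 < a)
  refine (tot_E h hr h0 h1).trans ?_
  have pt : ∀ m ∈ range Q, ω m * EQ r Q p (fun H => al r H m * rho r H m) ≤
      ω m * (1 / r * (m * bb r Q p m + 4 * K ^ 2 * r ^ 2 / a * EQ r Q p (fun H => xx r H m ^ 2)) +
       1 / K * (m * bb r Q p (m + r) + T * EQ r Q p (fun H => rho r H m * yp r H m) +
        (Λp ^ 2 + Λp) / T * EQ r Q p (fun H => uu r H m))) := by
    intro m hm
    rw [mem_range] at hm
    rcases Nat.lt_or_ge m a with hja | hja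
    · rw [h.lo m hja]; simp
    rcases Nat.lt_or_ge (m + 2 * r) Q with hjQ | hjQ
    swap
    · rw [h.hi m hjQ]; simp
    apply mul_le_mul_of_nonneg_left _ (h.nonneg m)
    have hlm := hl m hja
    have hum := hu m hm
    have e1 := heavy_bb (r := r) (Q := Q) (m := m) hr hm.le (by omega) h0 h1
      (h := 1 / (2 * K)) (by positivity)
    have e2 := light_bb (r := r) (Q := Q) (m := m) (by omega) (by omega) (by omega) h0 h1
      hK hT (by linarith)
    have e3 : EQ r Q p (fun H => al r H m * rho r H m) =
        EQ r Q p (fun H => ∑ w ∈ HB r H m (1 / (2 * K)), ta r H m w) +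
        EQ r Q p (fun H => ∑ w ∈ LB r H m (1 / (2 * K)), ta r H m w) := by
      rw [← E_add]
      congr 1; funext H
      rw [sum_HB_LB (by omega)]
    rw [e3]
    have hS0 : 0 ≤ EQ r Q p (fun H => rho r H m ^ 2) := E_nonneg h0 h1 fun H => sq_nonneg _
    have hS1 : EQ r Q p (fun H => rho r H m ^ 2) ≤ EQ r Q p (fun H => xx r H m ^ 2) :=
      E_mono h0 h1 fun H => pow_le_pow_left₀ rho_nonneg (rho_le_xx (by omega) m) 2
    have hR0 : 0 ≤ EQ r Q p (fun H => rho r H m) := E_nonneg h0 h1 fun H => rho_nonneg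
    have hR1 : EQ r Q p (fun H => rho r H m) ≤ EQ r Q p (fun H => uu r H m) :=
      E_mono h0 h1 fun H => rho_le_uu (by omega) m
    have hmA : (a:ℝ) ≤ m := by exact_mod_cast hja
    apply add_le_add
    · rw [one_div_mul_eq_div, le_div_iff₀ hr0]
      have : (r:ℝ) ^ 2 / ((1 / (2 * K)) ^ 2 * m) = 4 * K ^ 2 * r ^ 2 / m := by
        have : (0:ℝ) < m := by linarith
        field_simp; norm_num
      rw [this] at e1
      have hc : 4 * K ^ 2 * r ^ 2 / m ≤ 4 * K ^ 2 * (r:ℝ) ^ 2 / a :=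
        div_le_div_of_nonneg_left (by positivity) ha0 hmA
      have := mul_le_mul hc hS1 hS0 (by positivity)
      rw [mul_comm]
      exact e1.trans (add_le_add le_rfl this)
    · rw [one_div_mul_eq_div K, le_div_iff₀ hK]
      set l := p * (m.choose (r - 1) : ℝ) with hlv
      have hc : (l ^ 2 + l) / T ≤ (Λp ^ 2 + Λp) / T := by
        apply div_le_div_of_nonneg_right _ hT.le
        nlinarith
      have hc0 : 0 ≤ (Λp ^ 2 + Λp) / T := div_nonneg (by nlinarith) hT.le
      have := mul_le_mul hc hR1 hR0 hc0
      rw [mul_comm]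
      exact e2.trans (add_le_add le_rfl this)
  refine (Finset.sum_le_sum pt).trans ?_
  have t : ∑ m ∈ range Q, ω m * (1 / r * (m * bb r Q p m +
      4 * K ^ 2 * r ^ 2 / a * EQ r Q p (fun H => xx r H m ^ 2)) +
       1 / K * (m * bb r Q p (m + r) + T * EQ r Q p (fun H => rho r H m * yp r H m) +
        (Λp ^ 2 + Λp) / T * EQ r Q p (fun H => uu r H m))) =
      1 / r * (wA r Q ω p + 4 * K ^ 2 * r ^ 2 / a * wS r Q ω p) +
      1 / K * (∑ m ∈ range Q, ω m * (m * bb r Q p (m + r)) +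
        T * (∑ m ∈ range Q, ω m * EQ r Q p (fun H => rho r H m * yp r H m)) +
        (Λp ^ 2 + Λp) / T * wU r Q ω p) := by
    unfold wU wA wS
    simp only [Finset.mul_sum, mul_add, Finset.sum_add_distrib]
    congr 1
    · congr 1
      · exact Finset.sum_congr rfl fun m _ => by ring
      · exact Finset.sum_congr rfl fun m _ => by ring
    · congr 1
      · congr 1
        · exact Finset.sum_congr rfl fun m _ => by ring
        · exact Finset.sum_congr rfl fun m _ => by ring
      · exact Finset.sum_congr rfl fun m _ => by ring
  rw [t]
  have e1 := shift_bb h h0 h1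
  have e2 := mul_le_mul_of_nonneg_left (sum_yp h hr h0 h1 hΛ hl) hT.le
  have hK1 : 0 ≤ 1 / K := by positivity
  gcongr

end expSec

section odeSec
variable {r Q a : ℕ} {γ τ : ℝ} {ω : ℕ → ℝ}

lemma E_uu_deriv (hr : 1 ≤ r) {m : ℕ} (hm : m ≤ Q) {p : ℝ} (h0 : 0 ≤ p) (h1 : p ≤ 1) :
    ∃ D, HasDerivAt (fun p => EQ r Q p (fun H => uu r H m)) D p ∧
      D ≤ -(r * ((m.choose r : ℝ) * bb r Q p m)) := by
  obtain ⟨D, hD, hD2⟩ := russo (r := r) (Q := Q) (m := m) hr hm h0 h1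
  have hr0 : (0:ℝ) ≤ r := by positivity
  refine ⟨r * (0 - D), ?_, ?_⟩
  · have e : (fun p => EQ r Q p (fun H => uu r H m)) =
        fun p => r * (((m / r : ℕ) : ℝ) - EQ r Q p (fun H => (nv r H m : ℝ))) := by
      funext p
      simp only [uu_eq]
      rw [E_smul, E_sub, E_const]
    rw [e]
    exact ((hasDerivAt_const p _).sub hD).const_mul _
  · have := mul_le_mul_of_nonneg_left hD2 hr0
    linarith

lemma E_uu_anti (hr : 1 ≤ r) {m : ℕ} (hm : m ≤ Q) {p q : ℝ} (h0 : 0 ≤ p) (hpq : p ≤ q)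
    (h1 : q ≤ 1) : EQ r Q q (fun H => uu r H m) ≤ EQ r Q p (fun H => uu r H m) := by
  have hd : ∀ x ∈ Set.Icc p q, ∃ D, HasDerivAt (fun p => EQ r Q p (fun H => uu r H m)) D x ∧
      D ≤ 0 := by
    intro x hx
    obtain ⟨D, h1, h2⟩ := E_uu_deriv (r := r) (Q := Q) hr hm (p := x) (h0.trans hx.1) (hx.2.trans h1)
    refine ⟨D, h1, h2.trans ?_⟩
    have := bb_nonneg (r := r) (Q := Q) (m := m) (p := x) (h0.trans hx.1) (by linarith [hx.2])
    have : 0 ≤ r * ((m.choose r : ℝ) * bb r Q x m) := by positivity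
    linarith
  have := antitoneOn_of_deriv_nonpos (convex_Icc p q)
    (f := fun p => EQ r Q p (fun H => uu r H m))
    (fun x hx => by
      obtain ⟨D, h1, _⟩ := hd x hx
      exact h1.continuousAt.continuousWithinAt)
    (fun x hx => by
      rw [interior_Icc] at hx
      obtain ⟨D, h1, _⟩ := hd x (Set.Ioo_subset_Icc_self hx)
      exact h1.differentiableAt.differentiableWithinAt)
    (fun x hx => by
      rw [interior_Icc] at hx
      obtain ⟨D, h1, h2⟩ := hd x (Set.Ioo_subset_Icc_self hx)
      rw [h1.deriv]; exact h2)
  exact this (Set.left_mem_Icc.2 hpq) (Set.right_mem_Icc.2 hpq) hpq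

lemma wU_deriv (h : Wt r Q a γ τ ω) (hr : 1 ≤ r) {p : ℝ} (h0 : 0 ≤ p) (h1 : p ≤ 1) :
    ∃ D, HasDerivAt (wU r Q ω) D p ∧ D ≤ -((a - 1).choose (r - 1) * wA r Q ω p) := by
  have hd : ∀ m, ∃ D, m < Q → HasDerivAt (fun p => EQ r Q p (fun H => uu r H m)) D p ∧
      D ≤ -(r * ((m.choose r : ℝ) * bb r Q p m)) := by
    intro m
    by_cases hm : m < Q
    · obtain ⟨D, hD⟩ := E_uu_deriv (r := r) (Q := Q) hr hm.le h0 h1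
      exact ⟨D, fun _ => hD⟩
    · exact ⟨0, fun h => absurd h hm⟩
  choose D hD using hd
  refine ⟨∑ m ∈ range Q, ω m * D m, ?_, ?_⟩
  · unfold wU
    apply HasDerivAt.fun_sum
    intro m hm
    exact (hD m (mem_range.1 hm)).1.const_mul _
  · unfold wA
    rw [Finset.mul_sum, ← Finset.sum_neg_distrib]
    apply Finset.sum_le_sum
    intro m hm
    rcases Nat.lt_or_ge m a with hja | hja
    · rw [h.lo m hja]; simp
    have ha := h.ha
    have e1 := mul_le_mul_of_nonneg_left (hD m (mem_range.1 hm)).2 (h.nonneg m)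
    have hb := bb_nonneg (r := r) (Q := Q) (m := m) (p := p) h0 h1
    have e2 := choose_rel3 (r := r) (m := m) hr (by omega)
    have e3 : ((a - 1).choose (r - 1) : ℝ) ≤ (m - 1).choose (r - 1) := by
      exact_mod_cast Nat.choose_le_choose _ (by omega)
    have e4 : (r:ℝ) * ((m.choose r : ℝ) * bb r Q p m) = (m - 1).choose (r - 1) * (m * bb r Q p m) := by
      rw [← mul_assoc, e2]; ring
    have e5 := mul_le_mul_of_nonneg_right e3 (mul_nonneg (Nat.cast_nonneg (α := ℝ) m) hb)
    have e6 := mul_le_mul_of_nonneg_left e5 (h.nonneg m)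
    rw [e4] at e1
    linarith

lemma ode (h : Wt r Q a γ τ ω) (hr : 1 ≤ r) {p q c B : ℝ} (h0 : 0 ≤ p) (hpq : p ≤ q) (h1 : q ≤ 1)
    (hc : 0 < c) (hB : 0 ≤ B)
    (hA : ∀ x, p ≤ x → x ≤ q → c * wU r Q ω x - B ≤ wA r Q ω x) :
    wU r Q ω q ≤ Real.exp (-(c * (a - 1).choose (r - 1) * (q - p))) * wU r Q ω p + B / c := by
  set D0 : ℝ := ((a - 1).choose (r - 1) : ℝ) with hD0
  have hD00 : 0 ≤ D0 := by positivity
  set F : ℝ → ℝ := fun x => (wU r Q ω x - B / c) * Real.exp (c * D0 * x) with hF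
  have hd : ∀ x ∈ Set.Icc p q, ∃ D, HasDerivAt F D x ∧ D ≤ 0 := by
    intro x hx
    obtain ⟨D, hD1, hD2⟩ := wU_deriv h hr (h0.trans hx.1) (hx.2.trans h1)
    refine ⟨_, (hD1.sub_const (B / c)).mul
      (((hasDerivAt_id x).const_mul (c * D0)).exp), ?_⟩
    have hE := Real.exp_pos (c * D0 * x)
    have e1 : D * Real.exp (c * D0 * x) + (wU r Q ω x - B / c) *
        (Real.exp (c * D0 * id x) * (c * D0 * 1)) =
        (D + D0 * (c * wU r Q ω x - B)) * Real.exp (c * D0 * x) := by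
      simp only [id]; field_simp
      try ring
    rw [e1]
    apply mul_nonpos_of_nonpos_of_nonneg _ hE.le
    have := mul_le_mul_of_nonneg_left (hA x hx.1 hx.2) hD00
    linarith
  have hanti := antitoneOn_of_deriv_nonpos (convex_Icc p q) (f := F)
    (fun x hx => by
      obtain ⟨D, h1, _⟩ := hd x hx
      exact h1.continuousAt.continuousWithinAt)
    (fun x hx => by
      rw [interior_Icc] at hx
      obtain ⟨D, h1, _⟩ := hd x (Set.Ioo_subset_Icc_self hx)
      exact h1.differentiableAt.differentiableWithinAt)
    (fun x hx => by
      rw [interior_Icc] at hx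
      obtain ⟨D, h1, h2⟩ := hd x (Set.Ioo_subset_Icc_self hx)
      rw [h1.deriv]; exact h2)
  have key := hanti (Set.left_mem_Icc.2 hpq) (Set.right_mem_Icc.2 hpq) hpq
  simp only [hF] at key
  have hE := Real.exp_pos (-(c * D0 * q))
  have e1 := mul_le_mul_of_nonneg_right key hE.le
  have e2 : Real.exp (c * D0 * q) * Real.exp (-(c * D0 * q)) = 1 := by
    rw [← Real.exp_add]; simp
  have e3 : Real.exp (c * D0 * p) * Real.exp (-(c * D0 * q)) = Real.exp (-(c * D0 * (q - p))) := by
    rw [← Real.exp_add]; congr 1; ring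
  rw [mul_assoc (wU r Q ω q - B / c), mul_assoc (wU r Q ω p - B / c), e2, e3, mul_one] at e1
  have e4 : 0 ≤ B / c * Real.exp (-(c * D0 * (q - p))) := by positivity
  linarith

/-- Regularity hypothesis on a window of `p`. -/
def Reg (r Q a : ℕ) (R η p q : ℝ) : Prop := ∀ x, p ≤ x → x ≤ q → ∀ m, a ≤ m → m < Q →
  EQ r Q x (fun H => xx r H m ^ 2) ≤ R * EQ r Q x (fun H => uu r H m) + η

noncomputable def wY (Q : ℕ) (η τ : ℝ) (ω : ℕ → ℝ) : ℝ := (η + 1) * wW Q ω + τ * (Q * (Q ^ 2 + 1))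

lemma wS_le (h : Wt r Q a γ τ ω) {R η p q x : ℝ} (hreg : Reg r Q a R η p q) (hx : p ≤ x)
    (hx2 : x ≤ q) : wS r Q ω x ≤ R * wU r Q ω x + η * wW Q ω := by
  unfold wS wU wW
  rw [Finset.mul_sum, Finset.mul_sum, ← Finset.sum_add_distrib]
  apply Finset.sum_le_sum
  intro m hm
  rcases Nat.lt_or_ge m a with hja | hja
  · rw [h.lo m hja]; simp
  · have := mul_le_mul_of_nonneg_left (hreg x hx hx2 m hja (mem_range.1 hm)) (h.nonneg m)
    linarith

lemma wE_le (h : Wt r Q a γ τ ω) {R η p q x : ℝ} (h0 : 0 ≤ p) (h1 : q ≤ 1)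
    (hreg : Reg r Q a R η p q) (hx : p ≤ x)
    (hx2 : x ≤ q) : wE r Q γ τ ω x ≤ γ * (R * wU r Q ω x + wY Q η τ ω) := by
  unfold wE wY
  apply mul_le_mul_of_nonneg_left _ h.g0
  have e1 := wS_le h hreg hx hx2
  have e2 : ∑ m ∈ range Q, (ω m + τ) * (EQ r Q x (fun H => xx r H m ^ 2) + 1) ≤
      wS r Q ω x + wW Q ω + τ * (Q * (Q ^ 2 + 1)) := by
    have : τ * ((Q:ℝ) * (Q ^ 2 + 1)) = ∑ m ∈ range Q, τ * ((Q:ℝ) ^ 2 + 1) := by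
      rw [Finset.sum_const, card_range, nsmul_eq_mul]; ring
    unfold wS wW
    rw [this, ← Finset.sum_add_distrib, ← Finset.sum_add_distrib]
    apply Finset.sum_le_sum
    intro m hm
    have : EQ r Q x (fun H => xx r H m ^ 2) ≤ (Q:ℝ) ^ 2 := by
      have := E_mono (r := r) (Q := Q) (h0.trans hx) (hx2.trans h1) (f := fun H => xx r H m ^ 2)
        (g := fun _ => (Q:ℝ) ^ 2) (fun H => by
          have b1 := xx_le (r := r) (H := H) m
          have b2 : (m:ℝ) ≤ Q := by exact_mod_cast (mem_range.1 hm).le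
          exact pow_le_pow_left₀ (xx_nonneg m) (b1.trans b2) 2)
      rwa [E_const] at this
    have := mul_le_mul_of_nonneg_left this h.t0
    linarith
  linarith

lemma wW_nonneg (h : Wt r Q a γ τ ω) : 0 ≤ wW Q ω := Finset.sum_nonneg fun m _ => h.nonneg m

lemma wU_nonneg (h : Wt r Q a γ τ ω) (hr : 1 ≤ r) {p : ℝ} (h0 : 0 ≤ p) (h1 : p ≤ 1) :
    0 ≤ wU r Q ω p := Finset.sum_nonneg fun m _ =>
  mul_nonneg (h.nonneg m) (E_nonneg h0 h1 fun _ => uu_nonneg hr m)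

lemma wY_nonneg (h : Wt r Q a γ τ ω) {η : ℝ} (hη : 0 ≤ η) : 0 ≤ wY Q η τ ω := by
  have := wW_nonneg h
  have := h.t0
  unfold wY; positivity

lemma phase1 (h : Wt r Q a γ τ ω) (hr : 2 ≤ r) {p q R η : ℝ} (h0 : 0 ≤ p) (hpq : p ≤ q)
    (h1 : q ≤ 1) (hη : 0 ≤ η) (hreg : Reg r Q a R η p q)
    (hγ : 8 * r ^ 3 * (γ * R) ≤ 1) :
    wU r Q ω q ≤ Real.exp (-(1 / (2 * r) * (a - 1).choose (r - 1) * (q - p))) * wU r Q ω p +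
      8 * r ^ 3 * γ * wY Q η τ ω := by
  have hr2 : (2:ℝ) ≤ r := by exact_mod_cast hr
  have hr0 : (0:ℝ) < r := by linarith
  have hY := wY_nonneg h hη
  have hg := h.g0
  have key := ode h (by omega) h0 hpq h1 (c := 1 / (2 * r)) (B := 4 * r ^ 2 * γ * wY Q η τ ω)
    (by positivity) (by positivity) (by
      intro x hx hx2
      have e1 := crude h hr (h0.trans hx) (hx2.trans h1)
      have e2 := mul_le_mul_of_nonneg_left (wE_le h h0 h1 hreg hx hx2)
        (by positivity : (0:ℝ) ≤ 4 * r ^ 2)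
      have hU := wU_nonneg h (by omega : 1 ≤ r) (h0.trans hx) (hx2.trans h1)
      have e3 : 4 * r ^ 2 * (γ * R) ≤ 1 / (2 * (r:ℝ)) := by
        rw [le_div_iff₀ (by positivity)]; nlinarith
      have e4 := mul_le_mul_of_nonneg_right e3 hU
      have e5 : 1 / (r:ℝ) * wU r Q ω x = 1 / (2 * r) * wU r Q ω x + 1 / (2 * r) * wU r Q ω x := by
        field_simp; norm_num
      linarith)
  refine key.trans (le_of_eq ?_)
  congr 1
  field_simp; ring

lemma phase2 (h : Wt r Q a γ τ ω) (hr : 2 ≤ r) {p q R η Λ Λp K T c : ℝ} (h0 : 0 ≤ p) (hpq : p ≤ q)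
    (h1 : q ≤ 1) (hη : 0 ≤ η) (hreg : Reg r Q a R η p q)
    (hΛ : 12 ≤ Λ) (hl : Λ ≤ p * a.choose (r - 1))
    (hu : q * Q.choose (r - 1) ≤ Λp) (hK : 0 < K) (hT : 0 < T) (hKΛ : 2 * K ≤ Λ) (hc : 0 < c)
    (hcoef : (1 + 2 * r / K) * c ≤ 1 - (4 * r ^ 3 * (γ * R) + 4 * K ^ 2 * r ^ 2 / a * R +
      r / K * (T * (2 * r ^ 2 * (γ * R) + 8 * Real.exp (-(Λ / 2))) + (Λp ^ 2 + Λp) / T))) :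
    wU r Q ω q ≤ Real.exp (-(c * (a - 1).choose (r - 1) * (q - p))) * wU r Q ω p +
      (4 * r ^ 3 * γ * wY Q η τ ω + 4 * K ^ 2 * r ^ 2 / a * (η * wW Q ω) + r / K *
        (τ * Q ^ 2 + T * (2 * r ^ 2 * γ * wY Q η τ ω + 16 * r ^ 2 * Real.exp (-(Λ / 2)) * wW Q ω)))
        / c := by
  have hr2 : (2:ℝ) ≤ r := by exact_mod_cast hr
  have hr0 : (0:ℝ) < r := by linarith
  have hY := wY_nonneg h hη
  have hW := wW_nonneg h
  have hg := h.g0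
  have ht := h.t0
  set B := (4 * r ^ 3 * γ * wY Q η τ ω + 4 * K ^ 2 * r ^ 2 / a * (η * wW Q ω) + r / K *
        (τ * Q ^ 2 + T * (2 * r ^ 2 * γ * wY Q η τ ω + 16 * r ^ 2 * Real.exp (-(Λ / 2)) * wW Q ω)))
    with hB
  have hB0 : 0 ≤ B := by rw [hB]; positivity
  refine ode h (by omega) h0 hpq h1 hc hB0 ?_
  intro x hx hx2
  have hx0 := h0.trans hx
  have e1 := sharp h hr hx0 (hx2.trans h1) (Λp := Λp) hΛ (by
    intro m hm
    have : (a.choose (r - 1) : ℝ) ≤ m.choose (r - 1) := by exact_mod_cast Nat.choose_le_choose _ hm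
    exact hl.trans (mul_le_mul hx this (by positivity) hx0)) (by
    intro m hm
    have : (m.choose (r - 1) : ℝ) ≤ Q.choose (r - 1) := by
      exact_mod_cast Nat.choose_le_choose _ hm.le
    exact (mul_le_mul hx2 this (by positivity) (h0.trans hpq)).trans hu) hK hT hKΛ
  have eE := wE_le h h0 h1 hreg hx hx2
  have eS := wS_le h hreg hx hx2
  have hU := wU_nonneg h (by omega : 1 ≤ r) hx0 (hx2.trans h1)
  set U := wU r Q ω x with hUd
  set W := wW Q ω with hWd
  set Y := wY Q η τ ω with hYd
  set A := wA r Q ω x with hAd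
  set e := Real.exp (-(Λ / 2)) with hed
  set 𝓔 := wE r Q γ τ ω x with hEd
  set S := wS r Q ω x with hSd
  have e2 : U - 4 * r ^ 3 * 𝓔 ≤ (A + 4 * K ^ 2 * r ^ 2 / a * S) +
      r / K * (2 * A + τ * Q ^ 2 + T * (2 * r ^ 2 * 𝓔 + 8 * e * (U + 2 * r ^ 2 * W)) +
        (Λp ^ 2 + Λp) / T * U) := by
    have := mul_le_mul_of_nonneg_left e1 hr0.le
    have l1 : (r:ℝ) * (1 / r * U - 4 * r ^ 2 * 𝓔) = U - 4 * r ^ 3 * 𝓔 := by field_simp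
    rw [l1] at this
    refine this.trans (le_of_eq ?_)
    rw [mul_add, ← mul_assoc, ← mul_assoc (r:ℝ) (1 / K)]
    congr 1
    · field_simp
    · congr 1; field_simp
  have f1 := mul_le_mul_of_nonneg_left eE (by positivity : (0:ℝ) ≤ 4 * r ^ 3)
  have f2 := mul_le_mul_of_nonneg_left eS (by positivity : (0:ℝ) ≤ 4 * K ^ 2 * r ^ 2 / a)
  have f3 := mul_le_mul_of_nonneg_left eE (by positivity : (0:ℝ) ≤ r / K * (T * (2 * r ^ 2)))
  have f4 := mul_le_mul_of_nonneg_right hcoef hU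
  have hk : (0:ℝ) ≤ 2 * r / K := by positivity
  have main : (1 + 2 * r / K) * (c * U) ≤ (1 + 2 * r / K) * A + B := by
    rw [hB]
    generalize 4 * K ^ 2 * (r:ℝ) ^ 2 / a = k1 at *
    generalize (Λp ^ 2 + Λp) / T = k2 at *
    have : 2 * (r:ℝ) / K = 2 * (r / K) := by ring
    rw [this] at f4 ⊢
    generalize (r:ℝ) / K = k3 at *
    linarith
  have main2 : (1 + 2 * r / K) * (c * U - A) ≤ (1 + 2 * r / K) * B := by
    have : B ≤ (1 + 2 * r / K) * B := le_mul_of_one_le_left hB0 (by linarith)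
    linarith
  have := le_of_mul_le_mul_left main2 (by positivity)
  linarith

end odeSec

section tails

lemma E_indep {r Q m s : ℕ} (hr : 1 ≤ r) (hm : m ≤ Q) {p : ℝ} (h0 : 0 ≤ p) (h1 : p ≤ 1) :
    EQ r Q p (fun H => if (s : ℝ) ≤ xx r H m then 1 else 0) ≤ 2 ^ m * (1 - p) ^ (s.choose r) := by
  have hq : 0 ≤ 1 - p := by linarith
  have step : EQ r Q p (fun H => if (s : ℝ) ≤ xx r H m then 1 else 0) ≤
      EQ r Q p (fun H => ∑ I ∈ powersetCard s (range m),
        if Disjoint (powersetCard r I) H then 1 else 0) := by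
    apply E_mono h0 h1
    intro H
    have hnn : ∀ I ∈ powersetCard s (range m),
        (0:ℝ) ≤ if Disjoint (powersetCard r I) H then 1 else 0 := by
      intro I _; split_ifs <;> norm_num
    split_ifs with h
    · have hc : s ≤ #(unc r H (range m)) := by
        have e := unc_card (r := r) (H := H) (W := range m)
        rw [card_range] at e
        have : (s : ℝ) ≤ (#(unc r H (range m)) : ℝ) := by
          have e2 : (#(unc r H (range m)) : ℝ) + r * nu r H (range m) = m := by exact_mod_cast e
          unfold xx nv at h
          linarith
        exact_mod_cast this
      obtain ⟨I, hI, hIc⟩ := Finset.exists_subset_card_eq hc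
      have hmem : I ∈ powersetCard s (range m) :=
        mem_powersetCard.2 ⟨hI.trans unc_subset, hIc⟩
      refine le_trans ?_ (Finset.single_le_sum hnn hmem)
      rw [if_pos]
      rw [Finset.disjoint_left]
      intro e he
      rw [mem_powersetCard] at he
      exact unc_indep hr he.2 (he.1.trans hI)
    · exact Finset.sum_nonneg hnn
  refine step.trans ?_
  unfold EQ
  rw [Ex_sum]
  have : ∀ I ∈ powersetCard s (range m), Ex p (powersetCard r (range Q))
      (fun H => if Disjoint (powersetCard r I) H then (1:ℝ) else 0) = (1 - p) ^ (s.choose r) := by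
    intro I hI
    rw [mem_powersetCard] at hI
    rw [Ex_miss p, card_powersetCard, hI.2]
    exact powersetCard_mono (hI.1.trans (range_subset_range.2 hm))
  rw [Finset.sum_congr rfl this, Finset.sum_const, card_powersetCard, card_range, nsmul_eq_mul]
  apply mul_le_mul_of_nonneg_right _ (pow_nonneg hq _)
  exact_mod_cast Nat.choose_le_two_pow m s

lemma block_exp {E : Type*} [DecidableEq E] {p : ℝ} (h0 : 0 ≤ p) (h1 : p ≤ 1) (B : Finset E)
    {g : Finset E → ℝ} (hg : ∀ H H', H ⊆ B → H' ⊆ B → |g H - g H'| ≤ 1) {s : ℝ} (hs : |s| ≤ 1) :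
    Ex p B (fun H => Real.exp (s * g H)) ≤ Real.exp (s ^ 2 + s * Ex p B g) := by
  set μ := Ex p B g with hμ
  have hd : ∀ H, H ⊆ B → |g H - μ| ≤ 1 := by
    intro H hH
    have a1 : μ ≤ g H + 1 := by
      rw [← Ex_const p B (g H + 1)]
      refine Ex_mono h0 h1 fun H' hH' => ?_
      have := abs_le.1 (hg H H' hH hH'); linarith [this.1]
    have a2 : g H - 1 ≤ μ := by
      rw [← Ex_const p B (g H - 1)]
      refine Ex_mono h0 h1 fun H' hH' => ?_
      have := abs_le.1 (hg H H' hH hH'); linarith [this.2]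
    rw [abs_le]; constructor <;> linarith
  have step : Ex p B (fun H => Real.exp (s * g H)) ≤
      Ex p B (fun H => Real.exp (s * μ) * ((1 + s ^ 2 - s * μ) + s * g H)) := by
    refine Ex_mono h0 h1 fun H hH => ?_
    have e : s * g H = s * μ + s * (g H - μ) := by ring
    rw [e, Real.exp_add]
    apply mul_le_mul_of_nonneg_left _ (Real.exp_pos _).le
    have b : |s * (g H - μ)| ≤ |s| := by
      rw [abs_mul]; exact mul_le_of_le_one_right (abs_nonneg _) (hd H hH)
    have c := (abs_le.1 (Real.abs_exp_sub_one_sub_id_le (b.trans hs))).2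
    have d : (s * (g H - μ)) ^ 2 ≤ s ^ 2 := by
      rw [← sq_abs, ← sq_abs s]
      exact pow_le_pow_left₀ (abs_nonneg _) b 2
    linarith
  refine step.trans ?_
  rw [Ex_mul, Ex_add, Ex_const, Ex_mul, ← hμ, Real.exp_add, mul_comm]
  apply mul_le_mul_of_nonneg_right _ (Real.exp_pos _).le
  linarith [Real.add_one_le_exp (s ^ 2)]

/-- Vertex-Lipschitz condition. -/
def VLip (r : ℕ) (f : Finset (Finset ℕ) → ℝ) : Prop :=
  ∀ j H H', (∀ e, e ∉ vstar r j → (e ∈ H ↔ e ∈ H')) → |f H - f H'| ≤ 1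

lemma psc_succ {r : ℕ} (hr : 1 ≤ r) (k : ℕ) :
    powersetCard r (range (k + 1)) = powersetCard r (range k) ∪ vstar r k := by
  obtain ⟨s, rfl⟩ : ∃ s, r = s + 1 := ⟨r - 1, by omega⟩
  rw [range_add_one, powersetCard_succ_insert (by simp)]
  rfl

lemma psc_disj (r k : ℕ) : Disjoint (powersetCard r (range k)) (vstar r k) := by
  rw [Finset.disjoint_left]
  intro e he h
  exact star_not_sub h (mem_powersetCard.1 he).1

lemma azuma {r : ℕ} (hr : 1 ≤ r) {p : ℝ} (h0 : 0 ≤ p) (h1 : p ≤ 1) {s : ℝ} (hs : |s| ≤ 1) (k : ℕ) :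
    ∀ f : Finset (Finset ℕ) → ℝ, VLip r f →
    EQ r k p (fun H => Real.exp (s * f H)) ≤ Real.exp (s ^ 2 * k + s * EQ r k p f) := by
  induction k with
  | zero =>
    intro f _
    unfold EQ
    rw [range_zero, powersetCard_eq_empty.2 (by simp; omega), Ex_empty, Ex_empty]
    simp
  | succ k ih =>
    intro f hf
    have key := ih (fun H₁ => Ex p (vstar r k) (fun H₂ => f (H₁ ∪ H₂))) (by
      intro j H H' hH
      rw [← Ex_sub, abs_le]
      have hb : ∀ H₂, |f (H ∪ H₂) - f (H' ∪ H₂)| ≤ 1 := fun H₂ => hf j _ _ fun e he => by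
        rw [mem_union, mem_union, hH e he]
      constructor
      · rw [← Ex_const p (vstar r k) (-1)]
        exact Ex_mono h0 h1 fun H₂ _ => (abs_le.1 (hb H₂)).1
      · exact Ex_le_const h0 h1 fun H₂ _ => (abs_le.1 (hb H₂)).2)
    unfold EQ at key ⊢
    rw [psc_succ hr, Ex_union p (psc_disj r k), Ex_union p (psc_disj r k)]
    have step : ∀ H₁, H₁ ⊆ powersetCard r (range k) →
        Ex p (vstar r k) (fun H₂ => Real.exp (s * f (H₁ ∪ H₂))) ≤
        Real.exp (s ^ 2) * Real.exp (s * Ex p (vstar r k) (fun H₂ => f (H₁ ∪ H₂))) := by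
      intro H₁ _
      rw [← Real.exp_add]
      apply block_exp h0 h1 _ _ hs
      intro H H' hH hH'
      apply hf k
      intro e he
      have a : e ∉ H := fun h => he (hH h)
      have b : e ∉ H' := fun h => he (hH' h)
      simp [a, b]
    refine (Ex_mono h0 h1 step).trans ?_
    rw [Ex_mul]
    refine (mul_le_mul_of_nonneg_left key (Real.exp_pos _).le).trans (le_of_eq ?_)
    rw [← Real.exp_add]
    congr 1
    push_cast
    ring

lemma mem_of_vstar {r j : ℕ} {e : Finset ℕ} (he : e ∈ vstar r j) : j ∈ e := by
  obtain ⟨Y, _, rfl⟩ := Finset.mem_image.1 he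
  simp

lemma nv_lip_aux {r m j : ℕ} {H H' : Finset (Finset ℕ)}
    (h : ∀ e, e ∉ vstar r j → (e ∈ H ↔ e ∈ H')) : nv r H m ≤ nv r H' m + 1 := by
  classical
  unfold nv
  obtain ⟨M, hM, hc⟩ := exists_mat r H (range m)
  rw [← hc]
  have hM' : IsMat r H' (range m) (M.filter (· ∉ vstar r j)) := by
    refine ⟨?_, ?_, ?_⟩
    · intro e he
      rw [mem_filter] at he
      exact (h e he.2).1 (hM.1 he.1)
    · intro A hA
      exact hM.2.1 A (mem_filter.1 hA).1
    · intro A hA B hB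
      exact hM.2.2 A (mem_filter.1 hA).1 B (mem_filter.1 hB).1
  have h1 : #(M.filter (· ∈ vstar r j)) ≤ 1 := by
    rw [Finset.card_le_one]
    intro A hA B hB
    rw [mem_filter] at hA hB
    by_contra hne
    exact (Finset.disjoint_left.1 (hM.2.2 A hA.1 B hB.1 hne)) (mem_of_vstar hA.2) (mem_of_vstar hB.2)
  have h2 := Finset.card_filter_add_card_filter_not (s := M) (· ∈ vstar r j)
  have h3 := hM'.le_nu
  omega

lemma nv_lip (r m : ℕ) : VLip r (fun H => (nv r H m : ℝ)) := by
  intro j H H' h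
  have a := nv_lip_aux (m := m) h
  have b := nv_lip_aux (m := m) (fun e he => (h e he).symm)
  have a' : (nv r H m : ℝ) ≤ nv r H' m + 1 := by exact_mod_cast a
  have b' : (nv r H' m : ℝ) ≤ nv r H m + 1 := by exact_mod_cast b
  rw [abs_le]; constructor <;> linarith

lemma uu_tail {r Q : ℕ} (hr : 1 ≤ r) (hQ : 0 < Q) (m : ℕ) {p : ℝ} (h0 : 0 ≤ p) (h1 : p ≤ 1) {t S : ℝ}
    (ht : 0 ≤ t) (htQ : t ≤ 2 * Q) (hS : EQ r Q p (fun H => uu r H m) + r * t ≤ S) :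
    EQ r Q p (fun H => if S < uu r H m then 1 else 0) ≤ Real.exp (-(t ^ 2 / (4 * Q))) := by
  have hQ' : (0:ℝ) < Q := by exact_mod_cast hQ
  have hr' : (0:ℝ) < r := by exact_mod_cast hr
  set σ : ℝ := t / (2 * Q) with hσ
  have hσ0 : 0 ≤ σ := by positivity
  have hσ1 : σ ≤ 1 := by rw [hσ, div_le_one (by positivity)]; exact htQ
  set μ := EQ r Q p (fun H => (nv r H m : ℝ)) with hμ
  have hE : EQ r Q p (fun H => uu r H m) = r * ((m / r : ℕ) - μ) := by
    simp only [uu_eq]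
    rw [E_smul, E_sub, E_const]
  have step : EQ r Q p (fun H => if S < uu r H m then 1 else 0) ≤
      EQ r Q p (fun H => Real.exp (σ * (μ - t)) * Real.exp (-σ * (nv r H m : ℝ))) := by
    apply E_mono h0 h1
    intro H
    rw [← Real.exp_add]
    split_ifs with h
    · rw [← Real.exp_zero]
      apply Real.exp_le_exp.2
      rw [uu_eq] at h
      rw [hE] at hS
      have : (r:ℝ) * (nv r H m : ℝ) < r * (μ - t) := by nlinarith
      have := lt_of_mul_lt_mul_left this hr'.le
      nlinarith
    · exact (Real.exp_pos _).le
  refine step.trans ?_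
  rw [E_smul]
  have := azuma hr h0 h1 (s := -σ) (by rw [abs_neg, abs_of_nonneg hσ0]; exact hσ1) Q _ (nv_lip r m)
  refine (mul_le_mul_of_nonneg_left this (Real.exp_pos _).le).trans (le_of_eq ?_)
  rw [← Real.exp_add]
  congr 1
  rw [← hμ, hσ]
  field_simp
  ring

lemma reg_of_tail {r Q a : ℕ} (hr : 1 ≤ r) {p q s P : ℝ} (hp : 0 ≤ p) (hq : q ≤ 1) (hs : 0 ≤ s)
    (h : ∀ x, p ≤ x → x ≤ q → ∀ m, a ≤ m → m < Q →
      EQ r Q x (fun H => if s < uu r H m then 1 else 0) ≤ P) :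
    Reg r Q a (2 * s) (2 * r ^ 2 + 2 * Q ^ 2 * P) p q := by
  intro x hpx hxq m ham hmQ
  have h0 : 0 ≤ x := hp.trans hpx
  have h1 : x ≤ 1 := hxq.trans hq
  have step : EQ r Q x (fun H => xx r H m ^ 2) ≤ EQ r Q x (fun H => (2 * s * uu r H m + 2 * (r:ℝ) ^ 2) +
      2 * Q ^ 2 * (if s < uu r H m then 1 else 0)) := by
    apply E_mono h0 h1
    intro H
    have a1 := xx_nonneg (r := r) (H := H) m
    have a2 := xx_le_uu (H := H) hr m
    have a3 := uu_nonneg (H := H) hr m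
    have a4 := uu_le_xx (r := r) (H := H) m
    have a5 := xx_le (r := r) (H := H) m
    have a6 : (m:ℝ) ≤ Q := by exact_mod_cast hmQ.le
    have hr1 : (1:ℝ) ≤ r := by exact_mod_cast hr
    have b1 : xx r H m ^ 2 ≤ 2 * uu r H m ^ 2 + 2 * (r:ℝ) ^ 2 := by
      have : xx r H m ^ 2 ≤ (uu r H m + r) ^ 2 := pow_le_pow_left₀ a1 (by linarith) 2
      nlinarith [sq_nonneg (uu r H m - r)]
    split_ifs with hsu
    · have : uu r H m ^ 2 ≤ (Q:ℝ) ^ 2 := pow_le_pow_left₀ a3 (by linarith) 2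
      have := mul_nonneg hs a3
      linarith
    · push Not at hsu
      have : uu r H m ^ 2 ≤ s * uu r H m := by nlinarith
      linarith
  refine step.trans ?_
  rw [E_add, E_add, E_smul, E_const, E_smul]
  have := mul_le_mul_of_nonneg_left (h x hpx hxq m ham hmQ) (by positivity : (0:ℝ) ≤ 2 * Q ^ 2)
  linarith

end tails

section weights

/-- Exponential window weights. -/
noncomputable def wt (g : ℝ) (c h m : ℕ) : ℝ :=
  max (Real.exp (-(g * |(m:ℝ) - c|)) - Real.exp (-(g * h))) 0

variable {g : ℝ} {c h r Q : ℕ}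

lemma wt_nonneg (m : ℕ) : 0 ≤ wt g c h m := le_max_right _ _

lemma wt_le_one (hg : 0 ≤ g) (m : ℕ) : wt g c h m ≤ 1 := by
  apply max_le _ zero_le_one
  have : Real.exp (-(g * |(m:ℝ) - c|)) ≤ 1 := by
    apply Real.exp_le_one_iff.2
    have := mul_nonneg hg (abs_nonneg ((m:ℝ) - c)); linarith
  linarith [Real.exp_pos (-(g * h))]

lemma wt_zero (hg : 0 ≤ g) {m : ℕ} (hm : (h:ℝ) ≤ |(m:ℝ) - c|) : wt g c h m = 0 := by
  apply max_eq_right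
  have : Real.exp (-(g * |(m:ℝ) - c|)) ≤ Real.exp (-(g * h)) := by
    apply Real.exp_le_exp.2
    have := mul_le_mul_of_nonneg_left hm hg; linarith
  linarith

lemma wW_wt (hg : 0 ≤ g) : wW Q (wt g c h) ≤ Q := by
  unfold wW
  calc ∑ m ∈ range Q, wt g c h m ≤ ∑ m ∈ range Q, (1:ℝ) := sum_le_sum fun m _ => wt_le_one hg m
    _ = Q := by simp

lemma Wt_wt (hg : 0 ≤ g) (hg1 : 4 * r * g ≤ 1) (hc : 2 * r + 1 + h ≤ c) (hQ : c + h + 2 * r ≤ Q) :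
    Wt r Q (c - h) (4 * r * g) (Real.exp (-(g * h))) (wt g c h) where
  nonneg := wt_nonneg
  lo := fun m hm => wt_zero hg (by
    have : m + h ≤ c := by omega
    have : (m:ℝ) + h ≤ c := by exact_mod_cast this
    rw [abs_sub_comm]; exact le_trans (by linarith) (le_abs_self _))
  hi := fun m hm => wt_zero hg (by
    have : c + h ≤ m := by omega
    have : (c:ℝ) + h ≤ m := by exact_mod_cast this
    exact le_trans (by linarith) (le_abs_self _))
  slow := by
    intro m m' h1 h2
    have h1' : (m:ℝ) ≤ m' + 2 * r := by exact_mod_cast h1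
    have h2' : (m':ℝ) ≤ m + 2 * r := by exact_mod_cast h2
    set v := Real.exp (-(g * |(m:ℝ) - c|)) with hv
    set v' := Real.exp (-(g * |(m':ℝ) - c|)) with hv'
    have hv0 : 0 < v := Real.exp_pos _
    have hd : |(|(m:ℝ) - c| - |(m':ℝ) - c|)| ≤ 2 * r := by
      refine (abs_abs_sub_abs_le_abs_sub _ _).trans ?_
      rw [abs_le]; constructor <;> linarith
    obtain ⟨hd1, hd2⟩ := abs_le.1 hd
    set x : ℝ := g * (2 * r) with hx
    have hx0 : 0 ≤ x := by positivity
    have hx1 : x ≤ 1 := by rw [hx]; nlinarith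
    have hex : Real.exp x ≤ 1 + 2 * x := by
      have := (abs_le.1 (Real.abs_exp_sub_one_sub_id_le (x := x) (by rw [abs_of_nonneg hx0]; exact hx1))).2
      nlinarith
    have up : v' ≤ v * Real.exp x := by
      rw [hv, hv', ← Real.exp_add]
      apply Real.exp_le_exp.2
      rw [hx]; nlinarith
    have dn : v * (1 - 2 * x) ≤ v' := by
      have : v * Real.exp (-x) ≤ v' := by
        rw [hv, hv', ← Real.exp_add]
        apply Real.exp_le_exp.2
        rw [hx]; nlinarith
      have e : 1 - 2 * x ≤ Real.exp (-x) := by linarith [Real.add_one_le_exp (-x)]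
      nlinarith
    have hvd : |v - v'| ≤ 4 * r * g * v := by
      rw [abs_le]
      have : v * Real.exp x ≤ v * (1 + 2 * x) := mul_le_mul_of_nonneg_left hex hv0.le
      have e2 : 4 * r * g * v = v * (2 * x) := by rw [hx]; ring
      rw [e2]
      constructor <;> linarith
    have a1 : |wt g c h m - wt g c h m'| ≤ |v - v'| := by
      unfold wt
      refine (abs_max_sub_max_le_abs _ _ _).trans (le_of_eq ?_)
      congr 1; rw [hv, hv']; ring
    have a2 : v ≤ wt g c h m + Real.exp (-(g * h)) := by
      unfold wt
      have := le_max_left (Real.exp (-(g * |(m:ℝ) - c|)) - Real.exp (-(g * h))) 0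
      rw [← hv] at this ⊢
      linarith
    exact a1.trans (hvd.trans (mul_le_mul_of_nonneg_left a2 (by positivity)))
  ha := by omega
  haQ := by omega
  g0 := by positivity
  g1 := hg1
  t0 := (Real.exp_pos _).le

lemma near_iter {p : ℝ} {j b : ℕ} (hr : 2 ≤ r) (h0 : 0 ≤ p) (h1 : p ≤ 1) (hb : b ≤ j) (i : ℕ)
    (hm : j + r * i ≤ Q) :
    EQ r Q p (fun H => uu r H (j + r * i)) ≤ EQ r Q p (fun H => uu r H j) +
      (r * i : ℕ) * Real.exp (-(p * b.choose (r - 1))) := by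
  induction i with
  | zero => simp
  | succ i ih =>
    have e : j + r * (i + 1) = (j + r * i) + r := by ring
    have := near_mono (r := r) (Q := Q) (p := p) (j := j + r * i) hr (by rw [← e]; exact hm) h0 h1
    rw [e]
    refine this.trans ?_
    have ih' := ih (by rw [e] at hm; omega)
    have hch : (b.choose (r - 1) : ℝ) ≤ ((j + r * i + r - 1).choose (r - 1) : ℝ) := by
      exact_mod_cast Nat.choose_le_choose _ (by omega)
    have hexp : Real.exp (-(p * (j + r * i + r - 1).choose (r - 1))) ≤ Real.exp (-(p * b.choose (r - 1))) := by
      apply Real.exp_le_exp.2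
      have := mul_le_mul_of_nonneg_left hch h0; linarith
    have hr0 : (0:ℝ) ≤ r := by positivity
    have := mul_le_mul_of_nonneg_left hexp hr0
    push_cast at ih' ⊢
    linarith

lemma avg {p : ℝ} (hr : 2 ≤ r) (h0 : 0 ≤ p) (h1 : p ≤ 1) (hg : 0 < g) (hg1 : r * g ≤ 1)
    (hτ : Real.exp (-(g * h)) ≤ 1 / 10) (hc : 2 * r + h ≤ c) {m : ℕ} (hcm : c ≤ m) (hmQ : m ≤ Q)
    (hcQ : c < Q) :
    EQ r Q p (fun H => uu r H m) ≤ Q * Real.exp (-(p * (c - h).choose (r - 1))) +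
      8 * r * g * wU r Q (wt g c h) p := by
  have hr0 : (0:ℝ) < r := by have : (2:ℝ) ≤ r := by exact_mod_cast hr
                             linarith
  set δ := Real.exp (-(p * (c - h).choose (r - 1))) with hδ
  have hδ0 : 0 < δ := Real.exp_pos _
  set J := ⌊1 / (r * g)⌋₊ with hJ
  have hrg : 0 < r * g := by positivity
  have hJ1 : (J:ℝ) * (r * g) ≤ 1 := by
    have := Nat.floor_le (a := 1 / (r * g)) (by positivity)
    rwa [← hJ, le_div_iff₀ hrg] at this
  have hJ2 : 1 ≤ 2 * (J:ℝ) * (r * g) := by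
    have a1 := Nat.lt_floor_add_one (1 / (r * g))
    rw [← hJ, div_lt_iff₀ hrg] at a1
    have a2 : (1:ℝ) ≤ J := by
      have : 1 ≤ J := by
        rw [hJ, Nat.one_le_floor_iff, le_div_iff₀ hrg]; linarith
      exact_mod_cast this
    nlinarith
  have hgh : 1 ≤ g * h := by
    by_contra hlt
    push Not at hlt
    have : Real.exp (-1) < Real.exp (-(g * h)) := Real.exp_lt_exp.2 (by linarith)
    have := Real.exp_neg_one_gt_d9
    linarith
  have hrJ : r * J ≤ h := by
    have : (r:ℝ) * J ≤ h := by
      have : g * (r * J) ≤ g * h := by nlinarith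
      exact le_of_mul_le_mul_left this hg
    exact_mod_cast this
  -- first index
  obtain ⟨i0, hi1, hi2⟩ : ∃ i0, m ≤ c + r * i0 ∧ c + r * i0 < m + r := by
    refine ⟨(m - c + (r - 1)) / r, ?_, ?_⟩
    · have := Nat.div_add_mod (m - c + (r - 1)) r
      have := Nat.mod_lt (m - c + (r - 1)) (show 0 < r by omega)
      omega
    · have := Nat.div_mul_le_self (m - c + (r - 1)) r
      have e : r * ((m - c + (r - 1)) / r) = (m - c + (r - 1)) / r * r := Nat.mul_comm _ _
      omega
  let jj : ℕ → ℕ := fun i => m - r * (i0 + i)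
  have hjj : ∀ i, i < J → r * (i0 + i) + h ≤ m + h ∧ c - r * J ≤ jj i ∧ jj i ≤ c ∧ r * (i0 + i) ≤ m := by
    intro i hi
    have e : r * (i0 + i) = r * i0 + r * i := by ring
    have e2 : r * i + r ≤ r * J := by
      calc r * i + r = r * (i + 1) := by ring
        _ ≤ r * J := Nat.mul_le_mul_left _ hi
    simp only [jj]
    refine ⟨?_, ?_, ?_, ?_⟩ <;> omega
  have hw : ∀ i, i < J → 1 / 4 ≤ wt g c h (jj i) := by
    intro i hi
    obtain ⟨_, a1, a2, _⟩ := hjj i hi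
    have b1 : |((jj i : ℕ):ℝ) - c| ≤ r * J := by
      have : (c:ℝ) ≤ (jj i : ℕ) + r * J := by
        have : c ≤ jj i + r * J := by omega
        exact_mod_cast this
      have : ((jj i : ℕ):ℝ) ≤ c := by exact_mod_cast a2
      have : (0:ℝ) ≤ r * J := by positivity
      rw [abs_le]; constructor <;> linarith
    have b2 : Real.exp (-1) ≤ Real.exp (-(g * |((jj i : ℕ):ℝ) - c|)) := by
      apply Real.exp_le_exp.2
      have := mul_le_mul_of_nonneg_left b1 hg.le
      nlinarith
    have := Real.exp_neg_one_gt_d9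
    unfold wt
    refine le_trans ?_ (le_max_left _ _)
    linarith
  have hE : ∀ i, i < J → EQ r Q p (fun H => uu r H m) - Q * δ ≤ EQ r Q p (fun H => uu r H (jj i)) := by
    intro i hi
    obtain ⟨_, a1, a2, a3⟩ := hjj i hi
    have e : jj i + r * (i0 + i) = m := by simp only [jj]; omega
    have := near_iter (r := r) (Q := Q) (p := p) (j := jj i) (b := c - h) hr h0 h1 (by omega) (i0 + i)
      (by rw [e]; exact hmQ)
    rw [e, ← hδ] at this
    have a4 : ((r * (i0 + i) : ℕ) : ℝ) ≤ Q := by exact_mod_cast a3.trans hmQ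
    have := mul_le_mul_of_nonneg_right a4 hδ0.le
    linarith
  have hU0 : ∀ j, 0 ≤ EQ r Q p (fun H => uu r H j) := fun j =>
    E_nonneg h0 h1 fun H => uu_nonneg (by omega) j
  by_cases hpos : EQ r Q p (fun H => uu r H m) ≤ Q * δ
  · have : 0 ≤ wU r Q (wt g c h) p := sum_nonneg fun j _ => mul_nonneg (wt_nonneg j) (hU0 j)
    have : 0 ≤ 8 * r * g * wU r Q (wt g c h) p := by positivity
    linarith
  push Not at hpos
  have hinj : Set.InjOn jj (range J) := by
    intro x hx y hy hxy
    simp only [coe_range, Set.mem_Iio] at hx hy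
    have a := (hjj x hx).2.2.2
    have b := (hjj y hy).2.2.2
    simp only [jj] at hxy
    have : r * (i0 + x) = r * (i0 + y) := by omega
    have := Nat.eq_of_mul_eq_mul_left (by omega) this
    omega
  have hsum : (J:ℝ) * (1 / 4 * (EQ r Q p (fun H => uu r H m) - Q * δ)) ≤ wU r Q (wt g c h) p := by
    calc (J:ℝ) * (1 / 4 * (EQ r Q p (fun H => uu r H m) - Q * δ))
        = ∑ i ∈ range J, (1 / 4 * (EQ r Q p (fun H => uu r H m) - Q * δ)) := by simp
      _ ≤ ∑ i ∈ range J, wt g c h (jj i) * EQ r Q p (fun H => uu r H (jj i)) := by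
          refine sum_le_sum fun i hi => ?_
          rw [mem_range] at hi
          exact mul_le_mul (hw i hi) (hE i hi) (by linarith) (wt_nonneg _)
      _ = ∑ j ∈ (range J).image jj, wt g c h j * EQ r Q p (fun H => uu r H j) :=
          (sum_image (f := fun j => wt g c h j * EQ r Q p (fun H => uu r H j)) hinj).symm
      _ ≤ wU r Q (wt g c h) p := by
          unfold wU
          refine sum_le_sum_of_subset_of_nonneg ?_ fun j _ _ => mul_nonneg (wt_nonneg j) (hU0 j)
          intro j hj
          obtain ⟨i, hi, rfl⟩ := mem_image.1 hj
          rw [mem_range] at hi ⊢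
          have := (hjj i hi).2.2.1
          omega
  set X := EQ r Q p (fun H => uu r H m) - Q * δ with hX
  have hX0 : 0 ≤ X := by linarith
  have f1 : X ≤ 2 * (J:ℝ) * (r * g) * X := le_mul_of_one_le_left hX0 hJ2
  have f2 := mul_le_mul_of_nonneg_left hsum (by positivity : (0:ℝ) ≤ 8 * (r * g))
  have f3 : X ≤ 8 * r * g * wU r Q (wt g c h) p := by nlinarith
  linarith

lemma wU_wt_le {p : ℝ} (hr : 1 ≤ r) (h0 : 0 ≤ p) (h1 : p ≤ 1) (hg : 0 ≤ g) :
    wU r Q (wt g c h) p ≤ (Q:ℝ) ^ 2 := by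
  unfold wU
  calc ∑ m ∈ range Q, wt g c h m * EQ r Q p (fun H => uu r H m) ≤ ∑ m ∈ range Q, (Q:ℝ) := by
        refine sum_le_sum fun m hm => ?_
        rw [mem_range] at hm
        have a : EQ r Q p (fun H => uu r H m) ≤ Q := by
          rw [← E_const r Q p (Q:ℝ)]
          refine E_mono h0 h1 fun H => ?_
          have : (m:ℝ) ≤ Q := by exact_mod_cast hm.le
          exact ((uu_le_xx m).trans (xx_le m)).trans this
        have b : 0 ≤ EQ r Q p (fun H => uu r H m) := E_nonneg h0 h1 fun H => uu_nonneg hr m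
        calc wt g c h m * EQ r Q p (fun H => uu r H m) ≤ 1 * Q :=
              mul_le_mul (wt_le_one hg m) a b zero_le_one
          _ = Q := one_mul _
    _ = (Q:ℝ) ^ 2 := by simp [sq]

lemma wY_wt_le {η τ : ℝ} (hη : 0 ≤ η) (hg : 0 ≤ g) :
    wY Q η τ (wt g c h) ≤ (η + 1) * Q + τ * (Q * (Q ^ 2 + 1)) := by
  unfold wY
  have := mul_le_mul_of_nonneg_left (wW_wt (Q := Q) (c := c) (h := h) hg) (by linarith : 0 ≤ η + 1)
  linarith

end weights

section binom

lemma choose_lo {b n k : ℕ} {x : ℝ} (hx1 : x ≤ 1) (hb : (1 - x) * n ≤ ((b + 1 - k : ℕ) : ℝ)) :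
    (1 - k * x) * ((n - 1).choose k : ℝ) ≤ b.choose k := by
  have hD : ((n - 1).choose k : ℝ) ≤ (n:ℝ) ^ k / (k.factorial : ℝ) := by
    refine (Nat.choose_le_pow_div k (n - 1)).trans ?_
    gcongr
    omega
  have h1 : 1 - k * x ≤ (1 - x) ^ k := by
    have := one_add_mul_le_pow (a := -x) (by linarith) k
    calc 1 - k * x = 1 + k * (-x) := by ring
      _ ≤ (1 + -x) ^ k := this
      _ = (1 - x) ^ k := by ring
  have h2 : ((b + 1 - k : ℕ) : ℝ) ^ k ≤ (k.factorial : ℝ) * b.choose k := by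
    have := Nat.pow_le_choose (α := ℝ) k b
    rw [div_le_iff₀ (by positivity)] at this
    linarith
  have hk : (0:ℝ) < k.factorial := by positivity
  calc (1 - k * x) * ((n - 1).choose k : ℝ) ≤ (1 - x) ^ k * ((n - 1).choose k : ℝ) :=
        mul_le_mul_of_nonneg_right h1 (by positivity)
    _ ≤ (1 - x) ^ k * ((n:ℝ) ^ k / (k.factorial : ℝ)) :=
        mul_le_mul_of_nonneg_left hD (pow_nonneg (by linarith) _)
    _ = ((1 - x) * n) ^ k / (k.factorial : ℝ) := by rw [mul_pow]; ring
    _ ≤ ((b + 1 - k : ℕ) : ℝ) ^ k / (k.factorial : ℝ) := by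
        have : 0 ≤ (1 - x) * n := mul_nonneg (by linarith) (by positivity)
        gcongr
    _ ≤ b.choose k := by rw [div_le_iff₀ hk]; linarith

lemma choose_hi {Q n k : ℕ} (hQ : Q ≤ 3 * (n - k)) (hn : 1 ≤ n) :
    (Q.choose k : ℝ) ≤ 3 ^ k * ((n - 1).choose k : ℝ) := by
  have h1 := Nat.choose_le_pow_div (α := ℝ) k Q
  have h2 := Nat.pow_le_choose (α := ℝ) k (n - 1)
  have e : n - 1 + 1 - k = n - k := by omega
  rw [e] at h2
  have h3 : (Q:ℝ) ≤ 3 * ((n - k : ℕ) : ℝ) := by exact_mod_cast hQ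
  calc (Q.choose k : ℝ) ≤ (Q:ℝ) ^ k / (k.factorial : ℝ) := h1
    _ ≤ (3 * ((n - k : ℕ) : ℝ)) ^ k / (k.factorial : ℝ) := by gcongr
    _ = 3 ^ k * (((n - k : ℕ) : ℝ) ^ k / (k.factorial : ℝ)) := by rw [mul_pow]; ring
    _ ≤ 3 ^ k * ((n - 1).choose k : ℝ) := by
        apply mul_le_mul_of_nonneg_left _ (by positivity)
        exact_mod_cast h2

lemma choose_D {n k : ℕ} (hk : 1 ≤ k) (hn : k + 1 ≤ n) :
    ((n:ℝ) - k) ≤ (k.factorial : ℝ) * ((n - 1).choose k : ℝ) := by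
  have h2 := Nat.pow_le_choose (α := ℝ) k (n - 1)
  have e : n - 1 + 1 - k = n - k := by omega
  rw [e, div_le_iff₀ (by positivity)] at h2
  have h3 : (1:ℝ) ≤ ((n - k : ℕ) : ℝ) := by exact_mod_cast (by omega : 1 ≤ n - k)
  have h4 : ((n - k : ℕ) : ℝ) ≤ ((n - k : ℕ) : ℝ) ^ k := by
    calc ((n - k : ℕ) : ℝ) = ((n - k : ℕ) : ℝ) ^ 1 := (pow_one _).symm
      _ ≤ _ := pow_le_pow_right₀ h3 hk
  have h5 : ((n - k : ℕ) : ℝ) = n - k := by push_cast [Nat.cast_sub (by omega : k ≤ n)]; ring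
  linarith

lemma choose_ratio {S n r : ℕ} {z : ℝ} (hr : 1 ≤ r) (hz : 0 ≤ z) (hn : 1 ≤ n)
    (hS : z * n ≤ ((S + 1 - r : ℕ) : ℝ)) :
    z ^ r * n / r * ((n - 1).choose (r - 1) : ℝ) ≤ S.choose r := by
  obtain ⟨k, rfl⟩ : ∃ k, r = k + 1 := ⟨r - 1, by omega⟩
  have hD : ((n - 1).choose k : ℝ) ≤ (n:ℝ) ^ k / (k.factorial : ℝ) := by
    refine (Nat.choose_le_pow_div k (n - 1)).trans ?_
    gcongr
    omega
  have h2 := Nat.pow_le_choose (α := ℝ) (k + 1) S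
  have hk : (0:ℝ) < k.factorial := by positivity
  rw [Nat.add_sub_cancel]
  calc z ^ (k + 1) * n / (k + 1 : ℕ) * ((n - 1).choose k : ℝ)
      ≤ z ^ (k + 1) * n / (k + 1 : ℕ) * ((n:ℝ) ^ k / (k.factorial : ℝ)) := by gcongr
    _ = (z * n) ^ (k + 1) / ((k + 1).factorial : ℝ) := by
        rw [Nat.factorial_succ, mul_pow]; push_cast; field_simp; ring
    _ ≤ ((S + 1 - (k + 1) : ℕ) : ℝ) ^ (k + 1) / ((k + 1).factorial : ℝ) := by gcongr
    _ ≤ S.choose (k + 1) := by exact_mod_cast h2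

end binom

section phases
variable {g : ℝ} {c h r Q : ℕ}

lemma phaseA {p q R η X Z : ℝ} (hr : 2 ≤ r) (h0 : 0 ≤ p) (hpq : p ≤ q) (h1 : q ≤ 1) (hη : 0 ≤ η)
    (hreg : Reg r Q (c - h) R η p q) (hg : 0 < g) (hg1 : 4 * r * g ≤ 1)
    (hγ : 32 * r ^ 4 * (g * R) ≤ 1) (hτ : Real.exp (-(g * h)) ≤ 1 / 10) (hc : 2 * r + 1 + h ≤ c)
    (hQ : c + h + 2 * r ≤ Q)
    (hX : X ≤ 1 / (2 * r) * (c - h - 1).choose (r - 1) * (q - p)) (hZ : Z ≤ q * (c - h).choose (r - 1))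
    {m : ℕ} (hcm : c ≤ m) (hmQ : m ≤ Q) :
    EQ r Q q (fun H => uu r H m) ≤ Q * Real.exp (-Z) + 8 * r * g * (Real.exp (-X) * Q ^ 2 +
      32 * r ^ 4 * g * ((η + 1) * Q + Real.exp (-(g * h)) * (Q * (Q ^ 2 + 1)))) := by
  have hr0 : (2:ℝ) ≤ r := by exact_mod_cast hr
  have hw := Wt_wt hg.le hg1 hc hQ
  have a1 := phase1 hw hr h0 hpq h1 hη hreg (by
    calc _ = 32 * r ^ 4 * (g * R) := by ring
      _ ≤ 1 := hγ)
  have a2 := avg (Q := Q) hr (h0.trans hpq) h1 hg (by nlinarith) hτ (by omega) hcm hmQ (by omega)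
  have a3 := wU_wt_le (Q := Q) (c := c) (h := h) (r := r) (by omega) h0 (hpq.trans h1) hg.le
  have a4 := wY_wt_le (Q := Q) (c := c) (h := h) (τ := Real.exp (-(g * h))) hη hg.le
  have b1 : Real.exp (-(1 / (2 * r) * (c - h - 1).choose (r - 1) * (q - p))) ≤ Real.exp (-X) :=
    Real.exp_le_exp.2 (by linarith)
  have b2 : Real.exp (-(q * (c - h).choose (r - 1))) ≤ Real.exp (-Z) := Real.exp_le_exp.2 (by linarith)
  have b3 := wU_nonneg hw (by omega) h0 (hpq.trans h1)
  have c1 : Real.exp (-(1 / (2 * r) * (c - h - 1).choose (r - 1) * (q - p))) * wU r Q (wt g c h) p ≤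
      Real.exp (-X) * Q ^ 2 := mul_le_mul b1 a3 b3 (Real.exp_pos _).le
  have c2 := mul_le_mul_of_nonneg_left a4 (by positivity : (0:ℝ) ≤ 32 * r ^ 4 * g)
  have c3 : wU r Q (wt g c h) q ≤ Real.exp (-X) * Q ^ 2 +
      32 * r ^ 4 * g * ((η + 1) * Q + Real.exp (-(g * h)) * (Q * (Q ^ 2 + 1))) := by
    have e : 8 * (r:ℝ) ^ 3 * (4 * r * g) * wY Q η (Real.exp (-(g * h))) (wt g c h) =
      32 * r ^ 4 * g * wY Q η (Real.exp (-(g * h))) (wt g c h) := by ring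
    rw [e] at a1
    linarith
  have c4 := mul_le_mul_of_nonneg_left c3 (by positivity : (0:ℝ) ≤ 8 * r * g)
  have c5 := mul_le_mul_of_nonneg_left b2 (by positivity : (0:ℝ) ≤ (Q:ℝ))
  linarith

lemma phaseB {p q R η X Z Λ Λp K T d : ℝ} (hr : 2 ≤ r) (h0 : 0 ≤ p) (hpq : p ≤ q) (h1 : q ≤ 1)
    (hη : 0 ≤ η)
    (hreg : Reg r Q (c - h) R η p q) (hg : 0 < g) (hg1 : 4 * r * g ≤ 1)
    (hτ : Real.exp (-(g * h)) ≤ 1 / 10) (hc : 2 * r + 1 + h ≤ c)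
    (hQ : c + h + 2 * r ≤ Q)
    (hΛ : 12 ≤ Λ) (hl : Λ ≤ p * (c - h).choose (r - 1))
    (hu : q * Q.choose (r - 1) ≤ Λp) (hK : 0 < K) (hT : 0 < T) (hKΛ : 2 * K ≤ Λ) (hd : 1 / 2 ≤ d)
    (hcoef : (1 + 2 * r / K) * d ≤ 1 - (16 * r ^ 4 * (g * R) + 4 * K ^ 2 * r ^ 2 / (c - h : ℕ) * R +
      r / K * (T * (8 * r ^ 3 * (g * R) + 8 * Real.exp (-(Λ / 2))) + (Λp ^ 2 + Λp) / T)))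
    (hX : X ≤ d * (c - h - 1).choose (r - 1) * (q - p)) (hZ : Z ≤ q * (c - h).choose (r - 1))
    {Y : ℝ} (hY : (η + 1) * Q + Real.exp (-(g * h)) * (Q * (Q ^ 2 + 1)) ≤ Y)
    {m : ℕ} (hcm : c ≤ m) (hmQ : m ≤ Q) :
    EQ r Q q (fun H => uu r H m) ≤ Q * Real.exp (-Z) + 8 * r * g * (Real.exp (-X) * Q ^ 2 +
      2 * (16 * r ^ 4 * g * Y + 4 * K ^ 2 * r ^ 2 / (c - h : ℕ) * (η * Q) + r / K *
        (Real.exp (-(g * h)) * Q ^ 2 + T * (8 * r ^ 3 * g * Y +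
          16 * r ^ 2 * Real.exp (-(Λ / 2)) * Q)))) := by
  have hr0 : (2:ℝ) ≤ r := by exact_mod_cast hr
  have hw := Wt_wt hg.le hg1 hc hQ
  have a1 := phase2 hw hr h0 hpq h1 hη hreg hΛ hl hu hK hT hKΛ (c := d) (by linarith) (by
    refine hcoef.trans (le_of_eq ?_)
    ring)
  have a2 := avg (Q := Q) hr (h0.trans hpq) h1 hg (by nlinarith) hτ (by omega) hcm hmQ (by omega)
  have a3 := wU_wt_le (Q := Q) (c := c) (h := h) (r := r) (by omega) h0 (hpq.trans h1) hg.le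
  have a4 := (wY_wt_le (Q := Q) (c := c) (h := h) (τ := Real.exp (-(g * h))) hη hg.le).trans hY
  have a5 := wW_wt (Q := Q) (c := c) (h := h) hg.le
  have b1 : Real.exp (-(d * (c - h - 1).choose (r - 1) * (q - p))) ≤ Real.exp (-X) :=
    Real.exp_le_exp.2 (by linarith)
  have b2 : Real.exp (-(q * (c - h).choose (r - 1))) ≤ Real.exp (-Z) := Real.exp_le_exp.2 (by linarith)
  have b3 := wU_nonneg hw (by omega) h0 (hpq.trans h1)
  have b4 := wY_nonneg hw hη
  have b5 := wW_nonneg hw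
  have c1 : Real.exp (-(d * (c - h - 1).choose (r - 1) * (q - p))) * wU r Q (wt g c h) p ≤
      Real.exp (-X) * Q ^ 2 := mul_le_mul b1 a3 b3 (Real.exp_pos _).le
  set B := 16 * r ^ 4 * g * Y + 4 * K ^ 2 * r ^ 2 / (c - h : ℕ) * (η * Q) + r / K *
        (Real.exp (-(g * h)) * Q ^ 2 + T * (8 * r ^ 3 * g * Y +
          16 * r ^ 2 * Real.exp (-(Λ / 2)) * Q)) with hB
  have hY0 : 0 ≤ Y := b4.trans a4
  have hB0 : 0 ≤ B := by rw [hB]; positivity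
  have c2 : (4 * r ^ 3 * (4 * r * g) * wY Q η (Real.exp (-(g * h))) (wt g c h) +
      4 * K ^ 2 * r ^ 2 / (c - h : ℕ) * (η * wW Q (wt g c h)) + r / K *
        (Real.exp (-(g * h)) * Q ^ 2 + T * (2 * r ^ 2 * (4 * r * g) * wY Q η (Real.exp (-(g * h))) (wt g c h)
        + 16 * r ^ 2 * Real.exp (-(Λ / 2)) * wW Q (wt g c h)))) ≤ B := by
    have e1 : 4 * (r:ℝ) ^ 3 * (4 * r * g) = 16 * r ^ 4 * g := by ring
    have e2 : 2 * (r:ℝ) ^ 2 * (4 * r * g) = 8 * r ^ 3 * g := by ring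
    rw [hB, e1, e2]
    gcongr
  have c3 : wU r Q (wt g c h) q ≤ Real.exp (-X) * Q ^ 2 + 2 * B := by
    refine a1.trans (add_le_add c1 ?_)
    rw [div_le_iff₀ (by linarith)]
    refine c2.trans ?_
    have := mul_le_mul_of_nonneg_left hd hB0
    clear_value B
    linarith
  have c4 := mul_le_mul_of_nonneg_left c3 (by positivity : (0:ℝ) ≤ 8 * r * g)
  have c5 := mul_le_mul_of_nonneg_left b2 (by positivity : (0:ℝ) ≤ (Q:ℝ))
  linarith

end phases

section stepASec

lemma algA {r n g y L EX EZ t : ℝ} (hr : 2 ≤ r) (hn : 1 ≤ n) (hg : g = y / (128 * r ^ 4 * n))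
    (hy : 1 ≤ y) (hyL : y ≤ L)
    (hZ : EZ * (16 * L ^ 6) ≤ 1) (hX : EX * (8 * L ^ 7) ≤ 1) (h8 : 8 * L ^ 8 ≤ n)
    (ht : t * (8 * L ^ 6 * y ^ 2) ≤ 1) (ht0 : 0 ≤ t) (hEX : 0 ≤ EX) :
    (2 * n) * EZ + 8 * r * g * (EX * (2 * n) ^ 2 +
      32 * r ^ 4 * g * ((2 * r ^ 2 + 2 + 1) * (2 * n) + t * ((2 * n) * ((2 * n) ^ 2 + 1)))) ≤
      n / (2 * L ^ 6) := by
  have hL : 1 ≤ L := hy.trans hyL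
  have hL6 : 0 < L ^ 6 := by positivity
  have hr0 : 0 < r := by linarith
  have hn0 : 0 < n := by linarith
  have e1 : 32 * r ^ 4 * g = y / (4 * n) := by rw [hg]; field_simp; norm_num
  have e2 : 8 * r * g = y / (16 * r ^ 3 * n) := by rw [hg]; field_simp; norm_num
  have hr3 : 8 ≤ r ^ 3 := by nlinarith [sq_nonneg r, sq_nonneg (r-2)]
  have hr32 : 2 * r ^ 2 ≤ r ^ 3 := by nlinarith [sq_nonneg r]
  have T1 : (2 * n) * EZ ≤ n / (8 * L ^ 6) := by
    rw [le_div_iff₀ (by positivity)]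
    nlinarith
  have T2 : y / (16 * r ^ 3 * n) * (EX * (2 * n) ^ 2) ≤ n / (8 * L ^ 6) := by
    have a : y / (16 * r ^ 3 * n) * (EX * (2 * n) ^ 2) = (y * EX * n) / (4 * r ^ 3) := by
      field_simp; ring
    have b : (y * EX * n) / (4 * r ^ 3) ≤ y * EX * n := by
      apply div_le_self (by positivity); linarith
    have c : y * EX * n ≤ L * EX * n := by gcongr
    have d : L * EX * n ≤ n / (8 * L ^ 6) := by
      rw [le_div_iff₀ (by positivity)]
      have : L * EX * n * (8 * L ^ 6) = n * (EX * (8 * L ^ 7)) := by ring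
      rw [this]; nlinarith
    linarith
  have T3 : y / (16 * r ^ 3 * n) * (y / (4 * n) * ((2 * r ^ 2 + 2 + 1) * (2 * n))) ≤ n / (8 * L ^ 6) := by
    have a : y / (16 * r ^ 3 * n) * (y / (4 * n) * ((2 * r ^ 2 + 2 + 1) * (2 * n))) =
      y ^ 2 / n * ((2 * r ^ 2 + 3) / (32 * r ^ 3)) := by
      field_simp; ring
    have b : (2 * r ^ 2 + 3) / (32 * r ^ 3) ≤ 1 := by
      rw [div_le_one (by positivity)]; linarith
    have b' : y ^ 2 / n * ((2 * r ^ 2 + 3) / (32 * r ^ 3)) ≤ y ^ 2 / n :=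
      mul_le_of_le_one_right (by positivity) b
    have c : y ^ 2 / n ≤ L ^ 2 / n := by gcongr
    have d : L ^ 2 / n ≤ n / (8 * L ^ 6) := by
      rw [div_le_div_iff₀ hn0 (by positivity)]
      have : L ^ 2 * (8 * L ^ 6) = 8 * L ^ 8 := by ring
      rw [this]; nlinarith
    linarith
  have T4 : y / (16 * r ^ 3 * n) * (y / (4 * n) * (t * ((2 * n) * ((2 * n) ^ 2 + 1)))) ≤ n / (8 * L ^ 6) := by
    have a : y / (16 * r ^ 3 * n) * (y / (4 * n) * (t * ((2 * n) * ((2 * n) ^ 2 + 1)))) =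
      y ^ 2 * t * (((2 * n) ^ 2 + 1) / (32 * r ^ 3 * n)) := by
      field_simp; ring
    have b : ((2 * n) ^ 2 + 1) / (32 * r ^ 3 * n) ≤ n := by
      rw [div_le_iff₀ (by positivity)]
      have : 8 * n ^ 2 ≤ r ^ 3 * n ^ 2 := by nlinarith
      nlinarith
    have b' : y ^ 2 * t * (((2 * n) ^ 2 + 1) / (32 * r ^ 3 * n)) ≤ y ^ 2 * t * n :=
      mul_le_mul_of_nonneg_left b (by positivity)
    have d : y ^ 2 * t * n ≤ n / (8 * L ^ 6) := by
      rw [le_div_iff₀ (by positivity)]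
      have : y ^ 2 * t * n * (8 * L ^ 6) = n * (t * (8 * L ^ 6 * y ^ 2)) := by ring
      rw [this]; nlinarith
    linarith
  rw [e1, e2]
  have s : n / (2 * L ^ 6) = n / (8 * L ^ 6) + n / (8 * L ^ 6) + n / (8 * L ^ 6) + n / (8 * L ^ 6) := by
    field_simp; ring
  rw [s, mul_add, mul_add (y / (4 * n)), mul_add (y / (16 * r ^ 3 * n)) (y / (4 * n) * _)]
  linarith

lemma tailA {r n : ℕ} (hr : 2 ≤ r) (hn : 1 ≤ n) {e1 L y : ℝ} (he : 0 < e1)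
    (hyL : y ^ (2 * r) = L) (hy : 1 ≤ y) (hyn : 2 * r * y ≤ n)
    (hD : 0 < ((n - 1).choose (r - 1) : ℝ)) (hbig : 12 * r * 2 ^ r ≤ e1 * y ^ r) {x : ℝ} (hx1 : x ≤ 1)
    (hx : e1 * L / (n - 1).choose (r - 1) / 2 ≤ x) {m : ℕ} (hm : m < 2 * n) :
    EQ r (2 * n) x (fun H => if ((⌈n / y⌉₊ : ℕ) : ℝ) < uu r H m then 1 else 0) ≤ 1 / ((2 * n : ℕ) : ℝ) ^ 2 := by
  have hy0 : 0 < y := by linarith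
  have hL0 : 0 < L := by rw [← hyL]; positivity
  have hn0 : (1:ℝ) ≤ n := by exact_mod_cast hn
  have hr0 : (2:ℝ) ≤ r := by exact_mod_cast hr
  have hx0 : 0 ≤ x := le_trans (by positivity) hx
  set S := ⌈n / y⌉₊ with hS
  set D := ((n - 1).choose (r - 1) : ℝ) with hDd
  have s1 : EQ r (2 * n) x (fun H => if (S : ℝ) < uu r H m then 1 else 0) ≤
      EQ r (2 * n) x (fun H => if (S : ℝ) ≤ xx r H m then 1 else 0) := by
    apply E_mono hx0 hx1
    intro H
    have := uu_le_xx (r := r) (H := H) m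
    split_ifs with a b
    · exact le_rfl
    · exfalso; exact b (a.le.trans this)
    · norm_num
    · exact le_rfl
  refine s1.trans ((E_indep (by omega) hm.le hx0 hx1).trans ?_)
  have hSz : 1 / (2 * y) * n ≤ ((S + 1 - r : ℕ) : ℝ) := by
    have a : n / y ≤ S := Nat.le_ceil _
    have b : (S:ℝ) + 1 - r ≤ ((S + 1 - r : ℕ) : ℝ) := by
      have : S + 1 ≤ (S + 1 - r) + r := by omega
      have : ((S + 1 : ℕ) : ℝ) ≤ ((S + 1 - r + r : ℕ) : ℝ) := by exact_mod_cast this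
      push_cast at this ⊢; linarith
    have c : (r:ℝ) ≤ n / y / 2 := by
      rw [div_div, le_div_iff₀ (by positivity)]; linarith
    have d : 1 / (2 * y) * n = n / y / 2 := by field_simp
    rw [d]; linarith
  have hC := choose_ratio (S := S) (n := n) (r := r) (z := 1 / (2 * y)) (by omega) (by positivity) hn hSz
  rw [← hDd] at hC
  have hbig2 : 6 * (n:ℝ) ≤ x * S.choose r := by
    have a : e1 * L / D / 2 * ((1 / (2 * y)) ^ r * n / r * D) ≤ x * S.choose r :=
      mul_le_mul hx hC (by positivity) hx0
    refine le_trans ?_ a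
    have e : e1 * L / D / 2 * ((1 / (2 * y)) ^ r * n / r * D) = (e1 * y ^ r) * n / (2 * r * 2 ^ r) := by
      rw [← hyL, div_pow, mul_pow, one_pow, two_mul r, pow_add]
      field_simp
    rw [e, le_div_iff₀ (by positivity)]
    nlinarith
  have e1' : (1 - x) ^ (S.choose r) ≤ Real.exp (-(x * S.choose r)) := by
    have : 1 - x ≤ Real.exp (-x) := by linarith [Real.add_one_le_exp (-x)]
    calc (1 - x) ^ (S.choose r) ≤ Real.exp (-x) ^ (S.choose r) := pow_le_pow_left₀ (by linarith) this _
      _ = _ := by rw [← Real.exp_nat_mul]; congr 1; ring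
  have e2' : (2:ℝ) ^ m ≤ Real.exp (2 * n) := by
    calc (2:ℝ) ^ m ≤ 2 ^ (2 * n) := pow_le_pow_right₀ (by norm_num) hm.le
      _ ≤ (Real.exp 1) ^ (2 * n) := by
          gcongr; linarith [Real.add_one_le_exp (1:ℝ)]
      _ = Real.exp (2 * n) := by rw [← Real.exp_nat_mul]; push_cast; ring_nf
  have hq : 0 ≤ (1 - x) ^ (S.choose r) := pow_nonneg (by linarith) _
  calc (2:ℝ) ^ m * (1 - x) ^ (S.choose r) ≤ Real.exp (2 * n) * Real.exp (-(x * S.choose r)) :=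
        mul_le_mul e2' e1' hq (Real.exp_pos _).le
    _ ≤ Real.exp (-(2 * n) + -(2 * n)) := by
        rw [← Real.exp_add]; apply Real.exp_le_exp.2; linarith
    _ ≤ 1 / ((2 * n : ℕ) : ℝ) ^ 2 := by
        push_cast
        rw [Real.exp_add, Real.exp_neg, one_div, ← mul_inv, sq]
        have : 2 * (n:ℝ) ≤ Real.exp (2 * n) := by linarith [Real.add_one_le_exp (2 * (n:ℝ))]
        apply inv_anti₀ (by positivity)
        exact mul_le_mul this this (by positivity) (by positivity)

set_option maxHeartbeats 2000000 in
lemma stepA {r n h : ℕ} (hr : 2 ≤ r) (hn : 1 ≤ n) {ε L y : ℝ} (hε : 0 < ε) (hε1 : ε ≤ 1)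
    (hyL : y ^ (2 * r) = L) (hy : 1 ≤ y) (hyL2 : y ≤ L) (hyn : 2 * r * y ≤ n)
    (hD : 0 < ((n - 1).choose (r - 1) : ℝ)) (hbig : 12 * r * 2 ^ r ≤ ε / 8 * y ^ r)
    (hp1 : ε / 8 * L / (n - 1).choose (r - 1) ≤ 1)
    (hh1 : ε / (16 * r) * n / 2 ≤ h) (hh2 : h ≤ ε / (16 * r) * n) (hrn : 4 * r + 1 ≤ ε / (16 * r) * n)
    (hZ : 16 * L ^ 6 ≤ Real.exp (ε / 16 * L)) (hX : 8 * L ^ 7 ≤ Real.exp (ε / (64 * r) * L))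
    (h8 : 8 * L ^ 8 ≤ n) (ht : 10 * L ^ 6 * y ^ 2 ≤ Real.exp (ε / (4096 * r ^ 5) * y))
    {m : ℕ} (hm1 : n - h ≤ m) (hm2 : m ≤ 2 * n) :
    EQ r (2 * n) (ε / 8 * L / (n - 1).choose (r - 1)) (fun H => uu r H m) ≤ n / (2 * L ^ 6) := by
  have hr0 : (2:ℝ) ≤ r := by exact_mod_cast hr
  have hn0 : (1:ℝ) ≤ n := by exact_mod_cast hn
  have hL1 : 1 ≤ L := hy.trans hyL2
  set D := ((n - 1).choose (r - 1) : ℝ) with hDd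
  set p := ε / 8 * L / D with hp
  have hp0 : 0 ≤ p := by positivity
  have hy0 : 0 < y := by linarith
  set g := y / (128 * r ^ 4 * n) with hg
  have hg0 : 0 < g := by positivity
  have hκ : ε / (16 * r) * n ≤ n / 32 := by
    have : ε / (16 * r) ≤ 1 / 32 := by
      rw [div_le_div_iff₀ (by positivity) (by norm_num)]; linarith
    nlinarith
  have hhn : (h:ℝ) ≤ n / 32 := hh2.trans hκ
  have hrn' : 4 * (r:ℝ) + 1 ≤ n / 32 := hrn.trans hκ
  have hN : 4 * h + 8 * r + 1 ≤ n := by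
    have : 4 * (h:ℝ) + 8 * r + 1 ≤ n := by linarith
    exact_mod_cast this
  have hreg : Reg r (2 * n) (n - h - h) (2 * (⌈n / y⌉₊ : ℕ)) (2 * r ^ 2 + 2) (p / 2) p := by
    have := reg_of_tail (r := r) (Q := 2 * n) (a := n - h - h) (p := p / 2) (q := p)
      (s := ((⌈n / y⌉₊ : ℕ) : ℝ)) (P := 1 / ((2 * n : ℕ) : ℝ) ^ 2) (by omega) (by positivity) hp1
      (by positivity) (fun x hx1 hx2 m' _ hm' =>
        tailA hr hn (by positivity) hyL hy hyn hD hbig (hx2.trans hp1) hx1 hm')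
    convert this using 2
    have : ((2 * n : ℕ) : ℝ) ≠ 0 := by
      have : (0:ℝ) < ((2 * n : ℕ) : ℝ) := by push_cast; linarith
      exact this.ne'
    field_simp
  have hS : ((⌈n / y⌉₊ : ℕ) : ℝ) ≤ 2 * (n / y) := by
    have a := Nat.ceil_lt_add_one (a := n / y) (by positivity)
    have : 1 ≤ n / y := by
      rw [le_div_iff₀ hy0]; nlinarith
    linarith
  have hgh : ε / (4096 * r ^ 5) * y ≤ g * h := by
    calc ε / (4096 * r ^ 5) * y = g * (ε / (16 * r) * n / 2) := by rw [hg]; field_simp; norm_num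
      _ ≤ g * h := mul_le_mul_of_nonneg_left hh1 hg0.le
  have hτ : Real.exp (-(g * h)) * (10 * L ^ 6 * y ^ 2) ≤ 1 := by
    have : Real.exp (-(g * h)) ≤ Real.exp (-(ε / (4096 * r ^ 5) * y)) := Real.exp_le_exp.2 (by linarith)
    calc Real.exp (-(g * h)) * (10 * L ^ 6 * y ^ 2) ≤
        Real.exp (-(ε / (4096 * r ^ 5) * y)) * Real.exp (ε / (4096 * r ^ 5) * y) :=
          mul_le_mul this ht (by positivity) (Real.exp_pos _).le
      _ = 1 := by rw [← Real.exp_add]; simp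
  have hLy : 1 ≤ L ^ 6 * y ^ 2 := one_le_mul_of_one_le_of_one_le (one_le_pow₀ hL1) (one_le_pow₀ hy)
  have hτ0 := Real.exp_pos (-(g * h))
  have hτ1 : Real.exp (-(g * h)) ≤ 1 / 10 := by
    have : Real.exp (-(g * h)) * (10 * L ^ 6 * y ^ 2) = 10 * Real.exp (-(g * h)) * (L ^ 6 * y ^ 2) := by ring
    rw [this] at hτ
    nlinarith
  have hτ2 : Real.exp (-(g * h)) * (8 * L ^ 6 * y ^ 2) ≤ 1 := by
    have : 0 ≤ Real.exp (-(g * h)) * (L ^ 6 * y ^ 2) := by positivity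
    nlinarith
  have hCh : D / 2 ≤ ((n - h - h - 1).choose (r - 1) : ℝ) := by
    have hb : (1 - 4 * (ε / (16 * r))) * n ≤ ((n - h - h - 1 + 1 - (r - 1) : ℕ) : ℝ) := by
      have : (n:ℝ) ≤ ((n - h - h - 1 + 1 - (r - 1) : ℕ) : ℝ) + h + h + r := by
        have : n ≤ (n - h - h - 1 + 1 - (r - 1)) + h + h + r := by omega
        exact_mod_cast this
      have e : (1 - 4 * (ε / (16 * r))) * n = n - 4 * (ε / (16 * r) * n) := by ring
      rw [e]; linarith
    have hx1 : 4 * (ε / (16 * r)) ≤ 1 := by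
      rw [← mul_div_assoc, div_le_one (by positivity)]; linarith
    have := choose_lo (n := n) (k := r - 1) hx1 hb
    rw [← hDd] at this
    refine le_trans ?_ this
    have hk : ((r - 1 : ℕ) : ℝ) * (4 * (ε / (16 * r))) ≤ 1 / 2 := by
      have : ((r - 1 : ℕ) : ℝ) ≤ r := by exact_mod_cast Nat.sub_le r 1
      calc ((r - 1 : ℕ) : ℝ) * (4 * (ε / (16 * r))) ≤ r * (4 * (ε / (16 * r))) := by gcongr
        _ = ε / 4 := by field_simp; norm_num
        _ ≤ 1 / 2 := by linarith
    have := mul_le_mul_of_nonneg_right hk hD.le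
    linarith
  have hCh2 : D / 2 ≤ ((n - h - h).choose (r - 1) : ℝ) :=
    hCh.trans (by exact_mod_cast Nat.choose_le_choose _ (by omega))
  have hpD : p * D = ε / 8 * L := by rw [hp]; field_simp
  have key := phaseA (g := g) (c := n - h) (h := h) (r := r) (Q := 2 * n) (p := p / 2) (q := p)
    (R := 2 * (⌈n / y⌉₊ : ℕ)) (η := 2 * r ^ 2 + 2) (X := ε / (64 * r) * L) (Z := ε / 16 * L) hr
    (by positivity) (by linarith) hp1 (by positivity) hreg hg0
    (by rw [hg]
        rw [← mul_div_assoc, div_le_one (by positivity)]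
        have a : y ≤ n := by nlinarith
        have b : (1:ℝ) ≤ r ^ 3 := one_le_pow₀ (by linarith)
        have c : y ≤ r ^ 3 * n := by nlinarith
        have d : (0:ℝ) ≤ r * (r ^ 3 * n) := by positivity
        nlinarith)
    (by calc 32 * r ^ 4 * (g * (2 * (⌈n / y⌉₊ : ℕ))) ≤ 32 * r ^ 4 * (g * (2 * (2 * (n / y)))) := by gcongr
          _ = 1 := by rw [hg]; field_simp; norm_num)
    hτ1 (by omega) (by omega)
    (by have e : p - p / 2 = p / 2 := by ring
        rw [e]
        calc ε / (64 * r) * L = 1 / (2 * r) * (D / 2) * (p / 2) := by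
              have : 1 / (2 * r) * (D / 2) * (p / 2) = 1 / (8 * r) * (p * D) := by field_simp; ring
              rw [this, hpD]; field_simp; norm_num
          _ ≤ _ := by gcongr)
    (by calc ε / 16 * L = p * (D / 2) := by
              have : p * (D / 2) = (p * D) / 2 := by ring
              rw [this, hpD]; ring
          _ ≤ _ := by gcongr)
    hm1 hm2
  refine key.trans ?_
  have := algA (r := r) (n := n) (g := g) (y := y) (L := L) (EX := Real.exp (-(ε / (64 * r) * L)))
    (EZ := Real.exp (-(ε / 16 * L))) (t := Real.exp (-(g * h))) hr0 hn0 hg hy hyL2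
    (by calc _ ≤ Real.exp (-(ε / 16 * L)) * Real.exp (ε / 16 * L) := by gcongr
          _ = 1 := by rw [← Real.exp_add]; simp)
    (by calc _ ≤ Real.exp (-(ε / (64 * r) * L)) * Real.exp (ε / (64 * r) * L) := by gcongr
          _ = 1 := by rw [← Real.exp_add]; simp)
    h8 hτ2 hτ0.le (Real.exp_pos _).le
  push_cast
  exact this

end stepASec

section stepBSec

lemma algB {r n g L EX EZ t w G K η a q Y M N : ℝ} (hr : 2 ≤ r) (hn : 1 ≤ n) (hL : 1 ≤ L)
    (hg0 : 0 ≤ g) (hG0 : 0 ≤ G) (hη : 0 ≤ η)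
    (hg : n * g ≤ G * L) (hEX : n * EX ≤ w) (hEZ : n * EZ ≤ w) (hw : 1 ≤ n * w) (hw0 : 0 ≤ w)
    (ht0 : 0 ≤ t) (ht : t * (2 * n) ^ 2 ≤ 1) (ha : n / 2 ≤ a) (hq0 : 0 ≤ q) (hq1 : q ≤ 1)
    (hY : Y = (2 * r ^ 2 + 4) * (2 * n)) (hM : M = 2 * (2 * r ^ 2 + 4) * G)
    (hN : N = 16 * K ^ 2 * r ^ 2 * η) :
    (2 * n) * EZ + 8 * r * g * (EX * (2 * n) ^ 2 + 2 * (16 * r ^ 4 * g * Y +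
      4 * K ^ 2 * r ^ 2 / a * (η * (2 * n)) + q * (t * (2 * n) ^ 2 + L ^ 3 * (8 * r ^ 3 * g * Y +
        16 * r ^ 2 * w * (2 * n))))) ≤
    (2 + 8 * r * (4 + 2 * (16 * r ^ 4 * M + N + 1 + 8 * r ^ 3 * M + 32 * r ^ 2)) * G) * (L ^ 5 * w) := by
  have hn0 : 0 < n := by linarith
  have hr0 : 0 < r := by linarith
  have hM0 : 0 ≤ M := by rw [hM]; positivity
  have hN0 : 0 ≤ N := by rw [hN]; positivity
  have hL4 : 1 ≤ L ^ 4 := one_le_pow₀ hL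
  have hLL4 : L ≤ L ^ 4 := by
    calc L = L ^ 1 := (pow_one _).symm
      _ ≤ L ^ 4 := pow_le_pow_right₀ hL (by norm_num)
  have hL34 : L ^ 3 ≤ L ^ 4 := pow_le_pow_right₀ hL (by norm_num)
  set U := n * w * L ^ 4 with hU
  have hU1 : L ^ 4 ≤ U := by rw [hU]; exact le_mul_of_one_le_left (by positivity) hw
  have hU2 : n * w ≤ U := by rw [hU]; exact le_mul_of_one_le_right (by linarith) hL4
  have hgY : g * Y ≤ M * L := by
    have : g * Y = 2 * (2 * r ^ 2 + 4) * (n * g) := by rw [hY]; ring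
    rw [this, hM]
    have := mul_le_mul_of_nonneg_left hg (by positivity : 0 ≤ 2 * (2 * r ^ 2 + 4))
    linarith
  have i1 : EX * (2 * n) ^ 2 ≤ 4 * U := by
    have : EX * (2 * n) ^ 2 = 4 * n * (n * EX) := by ring
    rw [this]
    have := mul_le_mul_of_nonneg_left hEX (by positivity : 0 ≤ 4 * n)
    linarith
  have i2 : 16 * r ^ 4 * g * Y ≤ 16 * r ^ 4 * M * U := by
    have e : 16 * r ^ 4 * g * Y = 16 * r ^ 4 * (g * Y) := by ring
    have : g * Y ≤ M * U := hgY.trans (mul_le_mul_of_nonneg_left (hLL4.trans hU1) hM0)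
    rw [e]
    have := mul_le_mul_of_nonneg_left this (by positivity : 0 ≤ 16 * r ^ 4)
    linarith
  have i3 : 4 * K ^ 2 * r ^ 2 / a * (η * (2 * n)) ≤ N * U := by
    have ha0 : 0 < a := by linarith
    have h1 : 4 * K ^ 2 * r ^ 2 / a * (η * (2 * n)) ≤ N := by
      rw [hN, div_mul_eq_mul_div, div_le_iff₀ ha0]
      have := mul_le_mul_of_nonneg_left ha (by positivity : 0 ≤ 16 * K ^ 2 * r ^ 2 * η)
      linarith
    have h2 : N ≤ N * U := le_mul_of_one_le_right hN0 (hL4.trans hU1)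
    linarith
  have i4 : t * (2 * n) ^ 2 ≤ U := ht.trans (hL4.trans hU1)
  have i5 : L ^ 3 * (8 * r ^ 3 * g * Y + 16 * r ^ 2 * w * (2 * n)) ≤ (8 * r ^ 3 * M + 32 * r ^ 2) * U := by
    have h1 : L ^ 3 * (8 * r ^ 3 * g * Y) ≤ 8 * r ^ 3 * M * U := by
      have e : L ^ 3 * (8 * r ^ 3 * g * Y) = 8 * r ^ 3 * (L ^ 3 * (g * Y)) := by ring
      have : L ^ 3 * (g * Y) ≤ L ^ 3 * (M * L) := mul_le_mul_of_nonneg_left hgY (by positivity)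
      have h3 : L ^ 3 * (M * L) ≤ M * U := by
        have : L ^ 3 * (M * L) = M * L ^ 4 := by ring
        rw [this]; exact mul_le_mul_of_nonneg_left hU1 hM0
      rw [e]
      have := mul_le_mul_of_nonneg_left (this.trans h3) (by positivity : 0 ≤ 8 * r ^ 3)
      linarith
    have h2 : L ^ 3 * (16 * r ^ 2 * w * (2 * n)) ≤ 32 * r ^ 2 * U := by
      have e : L ^ 3 * (16 * r ^ 2 * w * (2 * n)) = 32 * r ^ 2 * (n * w * L ^ 3) := by ring
      rw [e, hU]
      gcongr
      all_goals linarith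
    linarith
  have i6 : q * (t * (2 * n) ^ 2 + L ^ 3 * (8 * r ^ 3 * g * Y + 16 * r ^ 2 * w * (2 * n))) ≤
      U + (8 * r ^ 3 * M + 32 * r ^ 2) * U := by
    have hY0 : 0 ≤ Y := by rw [hY]; positivity
    refine (mul_le_of_le_one_left (by positivity) hq1).trans (add_le_add i4 i5)
  set I := EX * (2 * n) ^ 2 + 2 * (16 * r ^ 4 * g * Y +
      4 * K ^ 2 * r ^ 2 / a * (η * (2 * n)) + q * (t * (2 * n) ^ 2 + L ^ 3 * (8 * r ^ 3 * g * Y +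
        16 * r ^ 2 * w * (2 * n)))) with hI
  set I0 := 4 + 2 * (16 * r ^ 4 * M + N + 1 + 8 * r ^ 3 * M + 32 * r ^ 2) with hI0
  have hI00 : 0 ≤ I0 := by rw [hI0]; positivity
  have hII : I ≤ I0 * U := by
    rw [hI, hI0]
    linarith
  clear_value I I0
  have f1 : 8 * r * g * I ≤ 8 * r * g * (I0 * U) := mul_le_mul_of_nonneg_left hII (by positivity)
  have f2 : 8 * r * g * (I0 * U) = 8 * r * I0 * w * L ^ 4 * (n * g) := by rw [hU]; ring
  have f3 : 8 * r * I0 * w * L ^ 4 * (n * g) ≤ 8 * r * I0 * w * L ^ 4 * (G * L) :=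
    mul_le_mul_of_nonneg_left hg (by positivity)
  have f4 : w ≤ L ^ 5 * w := le_mul_of_one_le_left hw0 (one_le_pow₀ hL)
  have f5 : 8 * r * I0 * w * L ^ 4 * (G * L) = 8 * r * I0 * G * (L ^ 5 * w) := by ring
  rw [add_mul]
  linarith

lemma coefB {r n g L R w G K ε a B : ℝ} (hr : 2 ≤ r) (hn : 1 ≤ n) (hL : 1 ≤ L) (hε : 0 < ε) (hε1 : ε ≤ 1)
    (hK : K = 32 * r / ε) (hR : R = 2 * (n / L ^ 6)) (hg : n * g ≤ G * L) (hG : 0 ≤ G)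
    (ha : n / 2 ≤ a) (hB : 1 ≤ B) (hw0 : 0 ≤ w)
    (h1 : 32 * (32 * r ^ 4 * G + 16 * K ^ 2 * r ^ 2 + 16 * r ^ 3 * G + 2 * B ^ 2) ≤ ε * L)
    (h2 : w * (256 * L ^ 3) ≤ ε) :
    (1 + 2 * r / K) * (1 - ε / 8) ≤ 1 - (16 * r ^ 4 * (g * R) + 4 * K ^ 2 * r ^ 2 / a * R +
      r / K * (L ^ 3 * (8 * r ^ 3 * (g * R) + 8 * w) + ((B * L) ^ 2 + B * L) / L ^ 3)) := by
  have hn0 : 0 < n := by linarith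
  have hr0 : 0 < r := by linarith
  have hL0 : 0 < L := by linarith
  have hrK : r / K = ε / 32 := by rw [hK]; field_simp
  have hrK2 : 2 * r / K = ε / 16 := by rw [mul_div_assoc, hrK]; ring
  have lhs : (1 + 2 * r / K) * (1 - ε / 8) ≤ 1 - ε / 16 := by rw [hrK2]; nlinarith
  have hgR : g * R ≤ 2 * G / L ^ 5 := by
    have : g * R = 2 * (n * g) / L ^ 6 := by rw [hR]; ring
    rw [this, div_le_div_iff₀ (by positivity) (by positivity)]
    have := mul_le_mul_of_nonneg_right hg (by positivity : 0 ≤ L ^ 5)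
    nlinarith
  have hL1 : ∀ k, 1 / L ^ (k + 1) ≤ 1 / L := by
    intro k
    apply one_div_le_one_div_of_le hL0
    exact le_self_pow₀ hL (by omega)
  have t1 : 16 * r ^ 4 * (g * R) ≤ 32 * r ^ 4 * G * (1 / L) := by
    calc 16 * r ^ 4 * (g * R) ≤ 16 * r ^ 4 * (2 * G / L ^ 5) := by gcongr
      _ = 32 * r ^ 4 * G * (1 / L ^ (4 + 1)) := by ring
      _ ≤ _ := mul_le_mul_of_nonneg_left (hL1 4) (by positivity)
  have t2 : 4 * K ^ 2 * r ^ 2 / a * R ≤ 16 * K ^ 2 * r ^ 2 * (1 / L) := by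
    have ha0 : 0 < a := by linarith
    have hRa : R / a ≤ 4 * (1 / L ^ (5 + 1)) := by
      rw [div_le_iff₀ ha0, hR]
      have := mul_le_mul_of_nonneg_left ha (by positivity : 0 ≤ 4 * (1 / L ^ (5 + 1)))
      calc 2 * (n / L ^ 6) = 4 * (1 / L ^ (5 + 1)) * (n / 2) := by ring
        _ ≤ _ := this
    calc 4 * K ^ 2 * r ^ 2 / a * R = 4 * K ^ 2 * r ^ 2 * (R / a) := by ring
      _ ≤ 4 * K ^ 2 * r ^ 2 * (4 * (1 / L)) := by
          gcongr
          exact hRa.trans (mul_le_mul_of_nonneg_left (hL1 5) (by norm_num))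
      _ = _ := by ring
  have t3 : L ^ 3 * (8 * r ^ 3 * (g * R)) ≤ 16 * r ^ 3 * G * (1 / L) := by
    calc L ^ 3 * (8 * r ^ 3 * (g * R)) ≤ L ^ 3 * (8 * r ^ 3 * (2 * G / L ^ 5)) := by gcongr
      _ = 16 * r ^ 3 * G * (1 / L ^ (1 + 1)) := by field_simp; ring
      _ ≤ _ := mul_le_mul_of_nonneg_left (hL1 1) (by positivity)
  have t4 : ((B * L) ^ 2 + B * L) / L ^ 3 ≤ 2 * B ^ 2 * (1 / L) := by
    rw [div_le_iff₀ (by positivity)]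
    have e : 2 * B ^ 2 * (1 / L) * L ^ 3 = 2 * (B * L) ^ 2 := by field_simp
    rw [e]
    have : 1 ≤ B * L := one_le_mul_of_one_le_of_one_le hB hL
    nlinarith
  have t5 : L ^ 3 * (8 * w) ≤ ε / 32 := by linarith
  have tot : (32 * r ^ 4 * G + 16 * K ^ 2 * r ^ 2 + 16 * r ^ 3 * G + 2 * B ^ 2) * (1 / L) ≤ ε / 32 := by
    rw [mul_one_div, div_le_iff₀ hL0]; linarith
  have P : r / K * (L ^ 3 * (8 * r ^ 3 * (g * R) + 8 * w) + ((B * L) ^ 2 + B * L) / L ^ 3) ≤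
      16 * r ^ 3 * G * (1 / L) + ε / 32 + 2 * B ^ 2 * (1 / L) := by
    have b0 : 0 ≤ 16 * r ^ 3 * G * (1 / L) + ε / 32 + 2 * B ^ 2 * (1 / L) := by positivity
    have b1 : L ^ 3 * (8 * r ^ 3 * (g * R) + 8 * w) + ((B * L) ^ 2 + B * L) / L ^ 3 ≤
      16 * r ^ 3 * G * (1 / L) + ε / 32 + 2 * B ^ 2 * (1 / L) := by rw [mul_add]; linarith
    rw [hrK]
    refine (mul_le_mul_of_nonneg_left b1 (by positivity)).trans ?_
    exact mul_le_of_le_one_left b0 (by linarith)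
  rw [add_mul, add_mul, add_mul] at tot
  linarith

end stepBSec

lemma tailB {r n : ℕ} (hr : 2 ≤ r) (hn : 1 ≤ n) {L x s0 : ℝ} (hL : 1 ≤ L) (hnL : (n:ℝ) = Real.exp L)
    (h13 : 128 * r ^ 2 * L ^ 13 ≤ n) (hx0 : 0 ≤ x) (hx1 : x ≤ 1) {m : ℕ}
    (hs0 : s0 = n / L ^ 6)
    (hE : EQ r (2 * n) x (fun H => uu r H m) ≤ n / (2 * L ^ 6)) :
    EQ r (2 * n) x (fun H => if s0 < uu r H m then 1 else 0) ≤ 1 / ((2 * n : ℕ) : ℝ) ^ 2 := by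
  have hr0 : (2:ℝ) ≤ r := by exact_mod_cast hr
  have hn0 : (1:ℝ) ≤ n := by exact_mod_cast hn
  have hL6 : 1 ≤ L ^ 6 := one_le_pow₀ hL
  have hL0 : 0 < L := by linarith
  have key := uu_tail (r := r) (Q := 2 * n) (by omega) (by omega) m hx0 hx1
    (t := n / (2 * r * L ^ 6)) (S := s0) (by positivity)
    (by push_cast
        rw [div_le_iff₀ (by positivity)]
        have : 1 ≤ r * L ^ 6 := by nlinarith
        nlinarith)
    (by have e : (r:ℝ) * (n / (2 * r * L ^ 6)) = n / (2 * L ^ 6) := by field_simp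
        have e2 : s0 = n / (2 * L ^ 6) + n / (2 * L ^ 6) := by rw [hs0]; field_simp; norm_num
        rw [e, e2]; linarith)
  refine key.trans ?_
  have e : ((n:ℝ) / (2 * r * L ^ 6)) ^ 2 / (4 * ((2 * n : ℕ) : ℝ)) = n / (32 * r ^ 2 * L ^ 12) := by
    push_cast; field_simp; norm_num
  rw [e]
  have b : 4 * L ≤ n / (32 * r ^ 2 * L ^ 12) := by
    rw [le_div_iff₀ (by positivity)]
    calc 4 * L * (32 * r ^ 2 * L ^ 12) = 128 * r ^ 2 * L ^ 13 := by ring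
      _ ≤ (n:ℝ) := h13
  have c : Real.exp (-(n / (32 * r ^ 2 * L ^ 12))) ≤ Real.exp (-(4 * L)) := Real.exp_le_exp.2 (by linarith)
  refine c.trans ?_
  push_cast
  rw [Real.exp_neg, one_div]
  apply inv_anti₀ (by positivity)
  have e4 : Real.exp (4 * L) = (n:ℝ) ^ 4 := by
    rw [hnL, ← Real.exp_nat_mul]; push_cast; rfl
  rw [e4]
  have : (2:ℝ) ≤ n := by
    rw [hnL]; linarith [Real.add_one_le_exp L]
  have : (4:ℝ) ≤ n ^ 2 := by nlinarith
  nlinarith [sq_nonneg (n:ℝ)]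

lemma auxE1 {ε : ℝ} (h : 0 < ε) (h1 : ε ≤ 1) : 1 + ε / 4 ≤ (1 - ε / 8) ^ 2 * (1 + 7 * ε / 8) := by
  have : 0 ≤ ε ^ 3 := by positivity
  nlinarith

lemma auxE2 {ε : ℝ} (h : 0 < ε) (h1 : ε ≤ 1) : 1 + ε / 4 ≤ (1 - ε / 8) * (1 + ε) := by
  nlinarith

lemma auxE3 {ε D : ℝ} (h : 0 < D) (h1 : ε ≤ 1) : D / 2 ≤ (1 - ε / 8) * D := by
  nlinarith

lemma auxE4 {ε L : ℝ} (h1 : ε ≤ 1) (h : 0 < L) : 0 ≤ L + -(ε * L / 32) := by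
  nlinarith

set_option maxHeartbeats 8000000 in
lemma stepB {r n h : ℕ} (hr : 2 ≤ r) (hn : 1 ≤ n) {ε L G K B : ℝ} (hε : 0 < ε) (hε1 : ε ≤ 1)
    (hnL : (n:ℝ) = Real.exp L)
    (hD : 0 < ((n - 1).choose (r - 1) : ℝ))
    (hq1 : (1 + ε) * L / (n - 1).choose (r - 1) ≤ 1)
    (hh1 : ε / (16 * r) * n / 2 ≤ h) (hh2 : h ≤ ε / (16 * r) * n) (hrn : 4 * r + 1 ≤ ε / (16 * r) * n)
    (hL : 1024 * r ≤ ε ^ 2 * L) (h40 : 40 * r * L ≤ h) (h13 : 128 * r ^ 2 * L ^ 13 ≤ n)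
    (hK : K = 32 * r / ε) (hG : G = 320 * r / ε) (hB : B = 2 * 3 ^ r)
    (hc1 : 32 * (32 * r ^ 4 * G + 16 * K ^ 2 * r ^ 2 + 16 * r ^ 3 * G + 2 * B ^ 2) ≤ ε * L)
    (hc2 : Real.exp (-(ε * L / 32)) * (256 * L ^ 3) ≤ ε)
    (hA : ∀ m, n - h ≤ m → m ≤ 2 * n →
      EQ r (2 * n) (ε / 8 * L / (n - 1).choose (r - 1)) (fun H => uu r H m) ≤ n / (2 * L ^ 6)) :
    EQ r (2 * n) ((1 + ε) * L / (n - 1).choose (r - 1)) (fun H => uu r H n) ≤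
      (2 + 8 * r * (4 + 2 * (16 * r ^ 4 * (2 * (2 * r ^ 2 + 4) * G) + (16 * K ^ 2 * r ^ 2 * (2 * r ^ 2 + 2)) + 1
        + 8 * r ^ 3 * (2 * (2 * r ^ 2 + 4) * G) + 32 * r ^ 2)) * G) *
        (L ^ 5 * Real.exp (-(ε * L / 32))) := by
  have hr0 : (2:ℝ) ≤ r := by exact_mod_cast hr
  have hn0 : (1:ℝ) ≤ n := by exact_mod_cast hn
  have hεε : ε ^ 2 ≤ ε := by nlinarith
  have hL0 : 0 < L := by
    by_contra hneg
    have : ε ^ 2 * L ≤ 0 := mul_nonpos_of_nonneg_of_nonpos (by positivity) (by linarith)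
    linarith
  have hεL : 1024 * r ≤ ε * L := hL.trans (by gcongr)
  have hL1 : 1 ≤ L := by nlinarith
  set D := ((n - 1).choose (r - 1) : ℝ) with hDd
  set p := ε / 8 * L / D with hp
  set q := (1 + ε) * L / D with hq
  have hp0 : 0 ≤ p := by positivity
  have hpq : p ≤ q := by rw [hp, hq]; gcongr; linarith
  have hpD : p * D = ε / 8 * L := by rw [hp]; field_simp
  have hqD : q * D = (1 + ε) * L := by rw [hq]; field_simp
  have hκ : ε / (16 * r) * n ≤ n / 32 := by
    have : ε / (16 * r) ≤ 1 / 32 := by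
      rw [div_le_div_iff₀ (by positivity) (by norm_num)]; linarith
    nlinarith
  have hhn : (h:ℝ) ≤ n / 32 := hh2.trans hκ
  have hrn' : 4 * (r:ℝ) + 1 ≤ n / 32 := hrn.trans hκ
  have hN : 4 * h + 8 * r + 1 ≤ n := by
    have : 4 * (h:ℝ) + 8 * r + 1 ≤ n := by linarith
    exact_mod_cast this
  have hh0 : 0 < (h:ℝ) := lt_of_lt_of_le (by positivity) h40
  set g := 10 * L / h with hg
  have hg0 : 0 < g := by positivity
  have hgh : g * h = 10 * L := by rw [hg]; field_simp
  have hng : n * g ≤ G * L := by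
    rw [hg, hG, ← mul_div_assoc, div_le_iff₀ hh0]
    have e : 320 * r / ε * L * (ε / (16 * r) * n / 2) = n * (10 * L) := by field_simp; norm_num
    rw [← e]
    gcongr
  have hG0 : 0 ≤ G := by rw [hG]; positivity
  have hK0 : 0 < K := by rw [hK]; positivity
  set w := Real.exp (-(ε * L / 32)) with hw
  have hw0 : 0 < w := Real.exp_pos _
  have hreg : Reg r (2 * n) (n - h) (2 * (n / L ^ 6)) (2 * r ^ 2 + 2) p q := by
    have := reg_of_tail (r := r) (Q := 2 * n) (a := n - h) (p := p) (q := q)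
      (s := n / L ^ 6) (P := 1 / ((2 * n : ℕ) : ℝ) ^ 2) (by omega) hp0 hq1
      (by positivity) (fun x hx1 hx2 m' ha hm' =>
        tailB hr hn hL1 hnL h13 (hp0.trans hx1) (hx2.trans hq1) rfl
          ((E_uu_anti (by omega) hm'.le hp0 hx1 (hx2.trans hq1)).trans (hA m' ha hm'.le)))
    convert this using 2
    have : ((2 * n : ℕ) : ℝ) ≠ 0 := by
      have : (0:ℝ) < ((2 * n : ℕ) : ℝ) := by push_cast; linarith
      exact this.ne'
    field_simp
  have hCh : (1 - ε / 8) * D ≤ ((n - h - 1).choose (r - 1) : ℝ) := by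
    have hb : (1 - 2 * (ε / (16 * r))) * n ≤ ((n - h - 1 + 1 - (r - 1) : ℕ) : ℝ) := by
      have : (n:ℝ) ≤ ((n - h - 1 + 1 - (r - 1) : ℕ) : ℝ) + h + r := by
        have : n ≤ (n - h - 1 + 1 - (r - 1)) + h + r := by omega
        exact_mod_cast this
      have e : (1 - 2 * (ε / (16 * r))) * n = n - 2 * (ε / (16 * r) * n) := by ring
      rw [e]; linarith
    have hx1 : 2 * (ε / (16 * r)) ≤ 1 := by
      rw [← mul_div_assoc, div_le_one (by positivity)]; linarith
    have := choose_lo (n := n) (k := r - 1) hx1 hb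
    rw [← hDd] at this
    refine le_trans ?_ this
    have hk : ((r - 1 : ℕ) : ℝ) * (2 * (ε / (16 * r))) ≤ ε / 8 := by
      have : ((r - 1 : ℕ) : ℝ) ≤ r := by exact_mod_cast Nat.sub_le r 1
      calc ((r - 1 : ℕ) : ℝ) * (2 * (ε / (16 * r))) ≤ r * (2 * (ε / (16 * r))) := by gcongr
        _ = ε / 8 := by field_simp; norm_num
    have := mul_le_mul_of_nonneg_right hk hD.le
    linarith
  have hCh2 : (1 - ε / 8) * D ≤ ((n - h).choose (r - 1) : ℝ) :=
    hCh.trans (by exact_mod_cast Nat.choose_le_choose _ (by omega))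
  have hCD : q * (2 * n).choose (r - 1) ≤ B * L := by
    have a := choose_hi (Q := 2 * n) (n := n) (k := r - 1) (by omega) hn
    rw [← hDd] at a
    have b : (3:ℝ) ^ (r - 1) ≤ 3 ^ r := pow_le_pow_right₀ (by norm_num) (by omega)
    calc q * (2 * n).choose (r - 1) ≤ q * (3 ^ r * D) := by
          have h1 : (3:ℝ) ^ (r - 1) * D ≤ 3 ^ r * D := mul_le_mul_of_nonneg_right b hD.le
          exact mul_le_mul_of_nonneg_left (a.trans h1) (hp0.trans hpq)
      _ = 3 ^ r * (q * D) := by ring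
      _ ≤ 3 ^ r * (2 * L) := by rw [hqD]; gcongr; linarith
      _ = B * L := by rw [hB]; ring
  have ha2 : (n:ℝ) / 2 ≤ ((n - h : ℕ) : ℝ) := by
    rw [Nat.cast_sub (by omega)]; linarith
  have hB1 : 1 ≤ B := by
    rw [hB]; have : (1:ℝ) ≤ 3 ^ r := one_le_pow₀ (by norm_num)
    linarith
  have hcoef := coefB (r := r) (n := n) (g := g) (L := L) (R := 2 * (n / L ^ 6)) (w := w) (G := G)
    (K := K) (ε := ε) (a := ((n - h : ℕ) : ℝ)) (B := B) hr0 hn0 hL1 hε hε1 hK rfl hng hG0 ha2 hB1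
    hw0.le hc1 hc2
  have hwΛ : Real.exp (-(ε * L / 16 / 2)) = w := by rw [hw]; congr 1; ring
  have ht : Real.exp (-(g * h)) = Real.exp (-(10 * L)) := by rw [hgh]
  have ht8 : Real.exp (-(10 * L)) * (n:ℝ) ^ 2 = Real.exp (-(8 * L)) := by
    rw [hnL, ← Real.exp_nat_mul, ← Real.exp_add]; congr 1; push_cast; ring
  have ht9 : Real.exp (-(8 * L)) ≤ 1 / 9 := by
    rw [Real.exp_neg, one_div]
    apply inv_anti₀ (by norm_num)
    linarith [Real.add_one_le_exp (8 * L)]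
  have ht0 := Real.exp_pos (-(10 * L))
  have ht4 : Real.exp (-(10 * L)) * (2 * n) ^ 2 ≤ 1 := by rw [mul_pow]; linarith
  have ht5 : Real.exp (-(10 * L)) * ((2 * n) ^ 2 + 1) ≤ 1 := by
    have : (1:ℝ) ≤ n ^ 2 := one_le_pow₀ hn0
    have := mul_le_mul_of_nonneg_left this ht0.le
    rw [mul_pow]; linarith
  have key := phaseB (g := g) (c := n) (h := h) (r := r) (Q := 2 * n) (p := p) (q := q)
    (R := 2 * (n / L ^ 6)) (η := 2 * r ^ 2 + 2) (X := (1 + ε / 4) * L) (Z := (1 + ε / 4) * L)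
    (Λ := ε * L / 16) (Λp := B * L) (K := K) (T := L ^ 3) (d := 1 - ε / 8) hr
    hp0 hpq hq1 (by positivity) hreg hg0
    (by rw [hg, ← mul_div_assoc, div_le_one hh0]; linarith)
    (by rw [ht]
        have : (0:ℝ) ≤ Real.exp (-(10 * L)) := ht0.le
        have h1 : Real.exp (-(10 * L)) ≤ 1 / 11 := by
          rw [Real.exp_neg, one_div]
          apply inv_anti₀ (by norm_num)
          linarith [Real.add_one_le_exp (10 * L)]
        linarith)
    (by omega) (by omega)
    (by linarith)
    (by have : D / 2 ≤ ((n - h).choose (r - 1) : ℝ) := le_trans (auxE3 hD hε1) hCh2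
        calc ε * L / 16 = p * (D / 2) := by
              have : p * (D / 2) = (p * D) / 2 := by ring
              rw [this, hpD]; ring
          _ ≤ _ := by gcongr)
    hCD hK0 (by positivity)
    (by rw [hK, ← mul_div_assoc, div_le_iff₀ hε]; linarith)
    (by linarith)
    (by rw [hwΛ]; exact hcoef)
    (by have e : (1 - ε / 8) * ((1 - ε / 8) * D) * (q - p) = (1 - ε / 8) ^ 2 * (1 + 7 * ε / 8) * L := by
          have : (1 - ε / 8) * ((1 - ε / 8) * D) * (q - p) = (1 - ε / 8) ^ 2 * (q * D - p * D) := by ring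
          rw [this, hqD, hpD]; ring
        have h1 : (1 + ε / 4) * L ≤ (1 - ε / 8) ^ 2 * (1 + 7 * ε / 8) * L := by
          apply mul_le_mul_of_nonneg_right _ hL0.le
          exact auxE1 hε hε1
        refine h1.trans (e.symm.le.trans ?_)
        have : 0 ≤ 1 - ε / 8 := by linarith
        have : 0 ≤ q - p := by linarith
        gcongr)
    (by have e : q * ((1 - ε / 8) * D) = (1 - ε / 8) * ((1 + ε) * L) := by rw [← hqD]; ring
        have h1 : (1 + ε / 4) * L ≤ q * ((1 - ε / 8) * D) := by
          rw [e, ← mul_assoc]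
          apply mul_le_mul_of_nonneg_right _ hL0.le
          exact auxE2 hε hε1
        refine h1.trans ?_
        have := hp0.trans hpq
        gcongr)
    (Y := (2 * r ^ 2 + 4) * (2 * n))
    (by rw [ht]; push_cast
        have : Real.exp (-(10 * L)) * (2 * n * ((2 * n) ^ 2 + 1)) ≤ 2 * (n:ℝ) := by
          calc Real.exp (-(10 * L)) * (2 * n * ((2 * n) ^ 2 + 1)) =
            Real.exp (-(10 * L)) * ((2 * n) ^ 2 + 1) * (2 * n) := by ring
            _ ≤ 1 * (2 * (n:ℝ)) := mul_le_mul_of_nonneg_right ht5 (by linarith)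
            _ = 2 * (n:ℝ) := by ring
        linarith)
    (m := n) le_rfl (by omega)
  refine key.trans ?_
  rw [hwΛ, ht]
  push_cast
  have hEX : n * Real.exp (-((1 + ε / 4) * L)) ≤ w := by
    rw [hnL, ← Real.exp_add, hw]
    apply Real.exp_le_exp.2
    have : 0 ≤ ε * L := by positivity
    linarith
  exact algB (r := r) (n := n) (g := g) (L := L) (EX := Real.exp (-((1 + ε / 4) * L)))
    (EZ := Real.exp (-((1 + ε / 4) * L))) (t := Real.exp (-(10 * L))) (w := w) (G := G) (K := K)
    (η := 2 * r ^ 2 + 2) (a := ((n - h : ℕ) : ℝ)) (q := r / K) (Y := (2 * r ^ 2 + 4) * (2 * n))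
    hr0 hn0 hL1 hg0.le hG0 (by positivity) hng hEX hEX
    (by rw [hnL, hw, ← Real.exp_add]; apply Real.one_le_exp; exact auxE4 hε1 hL0)
    hw0.le ht0.le ht4 ha2 (by positivity)
    (by rw [hK]
        have : (r:ℝ) / (32 * r / ε) = ε / 32 := by field_simp
        rw [this]; linarith)
    rfl rfl rfl

lemma polyexp (C : ℝ) {c : ℝ} (hc : 0 < c) (k : ℕ) :
    ∀ᶠ x : ℝ in Filter.atTop, C * x ^ k ≤ Real.exp (c * x) := by
  have h := (isLittleO_pow_exp_pos_mul_atTop (k := k) hc).def (c := 1 / (|C| + 1)) (by positivity)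
  filter_upwards [h, Filter.eventually_ge_atTop 0] with x hx hx0
  rw [Real.norm_of_nonneg (by positivity), Real.norm_of_nonneg (Real.exp_pos _).le] at hx
  have h1 : C ≤ |C| + 1 := by linarith [le_abs_self C]
  calc C * x ^ k ≤ (|C| + 1) * x ^ k := by gcongr
    _ ≤ (|C| + 1) * (1 / (|C| + 1) * Real.exp (c * x)) := by gcongr
    _ = Real.exp (c * x) := by field_simp

set_option maxHeartbeats 2000000 in
lemma claimA {r : ℕ} (hr : 2 ≤ r) {ε ρ : ℝ} (hε : 0 < ε) (hε1 : ε ≤ 1) (hρ : 0 < ρ) :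
    ∀ᶠ n : ℕ in Filter.atTop,
      0 < ((n - 1).choose (r - 1) : ℝ) ∧ 1 ≤ Real.log n ∧
      (1 + ε) * Real.log n / (n - 1).choose (r - 1) ≤ 1 ∧
      EQ r (2 * n) ((1 + ε) * Real.log n / (n - 1).choose (r - 1)) (fun H => uu r H n) ≤ ρ := by
  have hr0 : (2:ℝ) ≤ r := by exact_mod_cast hr
  set K := 32 * r / ε with hK
  set G := 320 * r / ε with hG
  set B : ℝ := 2 * 3 ^ r with hB
  set A := (2 + 8 * r * (4 + 2 * (16 * r ^ 4 * (2 * (2 * r ^ 2 + 4) * G) + (16 * K ^ 2 * r ^ 2 * (2 * r ^ 2 + 2)) + 1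
        + 8 * r ^ 3 * (2 * (2 * r ^ 2 + 4) * G) + 32 * r ^ 2)) * G) with hA
  have hLt : Filter.Tendsto (fun n : ℕ => Real.log n) Filter.atTop Filter.atTop :=
    Real.tendsto_log_atTop.comp tendsto_natCast_atTop_atTop
  have hyt : Filter.Tendsto (fun n : ℕ => Real.log n ^ (1 / (2 * r : ℝ))) Filter.atTop Filter.atTop :=
    (tendsto_rpow_atTop (by positivity)).comp hLt
  have hnt : Filter.Tendsto (fun n : ℕ => (n:ℝ)) Filter.atTop Filter.atTop := tendsto_natCast_atTop_atTop
  have e0 := hLt.eventually (Filter.eventually_ge_atTop (max 1 (max (1024 * r / ε ^ 2)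
    ((32 * (32 * r ^ 4 * G + 16 * K ^ 2 * r ^ 2 + 16 * r ^ 3 * G + 2 * B ^ 2)) / ε))))
  have e1 := hyt.eventually (Filter.eventually_ge_atTop (max 1 (12 * r * 2 ^ r / (ε / 8))))
  have e2 := hnt.eventually (Filter.eventually_ge_atTop (max (2 * (r:ℝ)) (max ((4 * r + 1) / (ε / (16 * r)))
    (2 / (ε / (16 * r))))))
  have e3 := hLt.eventually (polyexp 16 (c := ε / 16) (by positivity) 6)
  have e4 := hLt.eventually (polyexp 8 (c := ε / (64 * r)) (by positivity) 7)
  have e5 := hLt.eventually (polyexp 8 (c := 1) (by positivity) 8)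
  have e6 := hyt.eventually (polyexp 10 (c := ε / (4096 * r ^ 5)) (by positivity) (2 * r * 6 + 2))
  have e7 := hLt.eventually (polyexp (128 * r ^ 2) (c := 1) (by positivity) 13)
  have e8 := hLt.eventually (polyexp (256 / ε) (c := ε / 32) (by positivity) 3)
  have e9 := hLt.eventually (polyexp (A / ρ) (c := ε / 32) (by positivity) 5)
  have e10 := hLt.eventually (polyexp (2 * r) (c := 1) (by positivity) 1)
  have e11 := hLt.eventually (polyexp (2 * (1 + ε) * (r - 1).factorial) (c := 1) (by positivity) 1)
  have e12 := hLt.eventually (polyexp (40 * r / (ε / (16 * r) / 2)) (c := 1) (by positivity) 1)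
  filter_upwards [e0, e1, e2, e3, e4, e5, e6, e7, e8, e9, e10, e11, e12] with n f0 f1 f2 f3 f4 f5 f6 f7
    f8 f9 f10 f11 f12
  clear e0 e1 e2 e3 e4 e5 e6 e7 e8 e9 e10 e11 e12 hLt hyt hnt
  simp only [max_le_iff] at f0 f1 f2
  obtain ⟨hL1, hL2, hL3⟩ := f0
  obtain ⟨hy1, hy2⟩ := f1
  obtain ⟨hn1, hn2, hn3⟩ := f2
  have hnpos : (0:ℝ) < n := by linarith
  have hnL : (n:ℝ) = Real.exp (Real.log n) := (Real.exp_log hnpos).symm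
  set L := Real.log n with hLdef
  have hL0 : 0 < L := by linarith
  set y := L ^ (1 / (2 * r : ℝ)) with hy
  rw [one_mul, ← hnL] at f5 f7 f10 f11 f12
  rw [pow_one] at f10 f11 f12
  have hyL : y ^ (2 * r) = L := by
    rw [hy, ← Real.rpow_natCast, ← Real.rpow_mul hL0.le]
    push_cast
    rw [one_div, inv_mul_cancel₀ (by positivity), Real.rpow_one]
  have hyL2 : y ≤ L := by
    rw [← hyL]; exact le_self_pow₀ hy1 (by omega)
  have hn1' : 2 * r ≤ n := by exact_mod_cast hn1
  have hn : 1 ≤ n := by omega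
  have hDn := choose_D (k := r - 1) (n := n) (by omega) (by omega)
  have hfac : (0:ℝ) < (r - 1).factorial := by exact_mod_cast Nat.factorial_pos _
  have hk : ((r - 1 : ℕ) : ℝ) ≤ r := by exact_mod_cast Nat.sub_le r 1
  have hD1 : (1 + ε) * L ≤ (n - 1).choose (r - 1) := by
    have : (r - 1).factorial * ((1 + ε) * L) ≤ (r - 1).factorial * ((n - 1).choose (r - 1) : ℝ) := by
      refine le_trans ?_ hDn
      linarith
    exact le_of_mul_le_mul_left this hfac
  have hD : 0 < ((n - 1).choose (r - 1) : ℝ) := lt_of_lt_of_le (by positivity) hD1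
  have hq1 : (1 + ε) * L / (n - 1).choose (r - 1) ≤ 1 := by
    rw [div_le_one hD]; exact hD1
  have hp1 : ε / 8 * L / (n - 1).choose (r - 1) ≤ 1 := by
    refine le_trans ?_ hq1
    gcongr; linarith
  have hκ : 0 < ε / (16 * r) := by positivity
  set κ := ε / (16 * r) with hκd
  set h := ⌊κ * n⌋₊ with hh
  have hh2 : (h:ℝ) ≤ κ * n := Nat.floor_le (by positivity)
  have hκ2 : 2 ≤ κ * n := by
    rw [div_le_iff₀ hκ] at hn3; linarith
  have hh1 : κ * n / 2 ≤ h := by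
    have := Nat.lt_floor_add_one (κ * n)
    rw [← hh] at this
    linarith
  have hrn : 4 * r + 1 ≤ κ * n := by
    rw [div_le_iff₀ hκ] at hn2; linarith
  refine ⟨hD, hL1, hq1, ?_⟩
  have key := stepB (r := r) (n := n) (h := h) hr hn hε hε1 hnL hD hq1 hh1 hh2 hrn
    (by rw [div_le_iff₀ (by positivity)] at hL2; linarith)
    (by refine le_trans ?_ hh1
        rw [div_mul_eq_mul_div, div_le_iff₀ (by positivity)] at f12
        linarith)
    f7 hK hG hB
    (by rw [div_le_iff₀ hε] at hL3; linarith)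
    (by have : Real.exp (-(ε * L / 32)) * (256 / ε * L ^ 3) ≤ 1 := by
          calc Real.exp (-(ε * L / 32)) * (256 / ε * L ^ 3) ≤ Real.exp (-(ε * L / 32)) * Real.exp (ε / 32 * L) :=
                mul_le_mul_of_nonneg_left f8 (Real.exp_pos _).le
            _ = 1 := by
                rw [← Real.exp_add]
                have : -(ε * L / 32) + ε / 32 * L = 0 := by ring
                rw [this, Real.exp_zero]
        have e : Real.exp (-(ε * L / 32)) * (256 * L ^ 3) = (Real.exp (-(ε * L / 32)) * (256 / ε * L ^ 3)) * ε := by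
          field_simp
        rw [e]
        calc _ ≤ 1 * ε := mul_le_mul_of_nonneg_right this hε.le
          _ = ε := one_mul _)
    (fun m hm1 hm2 => stepA hr hn hε hε1 hyL hy1 hyL2
      (by have : 2 * r * y ≤ 2 * r * L := by gcongr
          linarith)
      hD
      (by rw [div_le_iff₀ (by positivity)] at hy2
          have : y ≤ y ^ r := le_self_pow₀ hy1 (by omega)
          have := mul_le_mul_of_nonneg_left this (by positivity : 0 ≤ ε / 8)
          linarith)
      hp1 hh1 hh2 hrn f3 f4 f5
      (by have e : 10 * L ^ 6 * y ^ 2 = 10 * y ^ (2 * r * 6 + 2) := by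
            rw [pow_add, pow_mul, hyL]; ring
          rw [e]; exact f6) hm1 hm2)
  refine key.trans ?_
  rw [← hA]
  have : Real.exp (-(ε * L / 32)) * (A / ρ * L ^ 5) ≤ 1 := by
    calc Real.exp (-(ε * L / 32)) * (A / ρ * L ^ 5) ≤ Real.exp (-(ε * L / 32)) * Real.exp (ε / 32 * L) :=
          mul_le_mul_of_nonneg_left f9 (Real.exp_pos _).le
      _ = 1 := by
          rw [← Real.exp_add]
          have : -(ε * L / 32) + ε / 32 * L = 0 := by ring
          rw [this, Real.exp_zero]
  have e : A * (L ^ 5 * Real.exp (-(ε * L / 32))) = (Real.exp (-(ε * L / 32)) * (A / ρ * L ^ 5)) * ρ := by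
    field_simp
  rw [e]
  calc _ ≤ 1 * ρ := mul_le_mul_of_nonneg_right this hρ.le
    _ = ρ := one_mul _

section transferSec
variable {E : Type*} [DecidableEq E]

lemma bad_step (S : Finset E) (bad : Finset E → Prop) [DecidablePred bad]
    (hdown : ∀ H H', H' ⊆ H → bad H → bad H') (j : ℕ) :
    #((powersetCard (j + 1) S).filter bad) * (j + 1) ≤ #((powersetCard j S).filter bad) * (#S - j) := by
  apply Finset.card_mul_le_card_mul (fun a b => b ⊆ a)
  · intro a ha
    rw [mem_filter, mem_powersetCard] at ha
    have : powersetCard j a ⊆ bipartiteAbove (fun a b => b ⊆ a) ((powersetCard j S).filter bad) a := by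
      intro b hb
      rw [mem_powersetCard] at hb
      rw [mem_bipartiteAbove, mem_filter, mem_powersetCard]
      exact ⟨⟨⟨hb.1.trans ha.1.1, hb.2⟩, hdown a b hb.1 ha.2⟩, hb.1⟩
    have h2 := card_le_card this
    rw [card_powersetCard, ha.1.2, Nat.choose_succ_self_right] at h2
    exact h2
  · intro b hb
    rw [mem_filter, mem_powersetCard] at hb
    have : bipartiteBelow (fun a b => b ⊆ a) ((powersetCard (j + 1) S).filter bad) b ⊆
        (S \ b).image (fun e => insert e b) := by
      intro a ha
      rw [mem_bipartiteBelow, mem_filter, mem_powersetCard] at ha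
      obtain ⟨⟨⟨haS, hac⟩, _⟩, hba⟩ := ha
      have hc : #(a \ b) = 1 := by
        rw [card_sdiff_of_subset hba, hac, hb.1.2]; omega
      obtain ⟨e, he⟩ := card_eq_one.1 hc
      have hea : e ∈ a \ b := by rw [he]; exact mem_singleton_self e
      rw [mem_sdiff] at hea
      rw [mem_image]
      refine ⟨e, mem_sdiff.2 ⟨haS hea.1, hea.2⟩, ?_⟩
      rw [← sdiff_union_of_subset hba, he]; rfl
    refine (card_le_card this).trans (card_image_le.trans ?_)
    rw [card_sdiff_of_subset hb.1.1, hb.1.2]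

lemma bad_frac_anti (S : Finset E) (bad : Finset E → Prop) [DecidablePred bad]
    (hdown : ∀ H H', H' ⊆ H → bad H → bad H') :
    Antitone (fun j => (#((powersetCard j S).filter bad) : ℝ) / (#S).choose j) := by
  apply antitone_nat_of_succ_le
  intro j
  by_cases hj : j + 1 ≤ #S
  · have h1 : (0:ℝ) < (#S).choose j := by exact_mod_cast Nat.choose_pos (by omega)
    have h2 : (0:ℝ) < (#S).choose (j + 1) := by exact_mod_cast Nat.choose_pos hj
    rw [div_le_div_iff₀ h2 h1]
    have h3 := bad_step S bad hdown j
    have h4 := Nat.choose_succ_right_eq (#S) j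
    have h5 : #((powersetCard (j + 1) S).filter bad) * (#S).choose j * (j + 1) ≤
        #((powersetCard j S).filter bad) * (#S).choose (j + 1) * (j + 1) := by
      calc _ = #((powersetCard (j + 1) S).filter bad) * (j + 1) * (#S).choose j := by ring
        _ ≤ #((powersetCard j S).filter bad) * (#S - j) * (#S).choose j := Nat.mul_le_mul_right _ h3
        _ = #((powersetCard j S).filter bad) * ((#S).choose j * (#S - j)) := by ring
        _ = _ := by rw [← h4]; ring
    exact_mod_cast Nat.le_of_mul_le_mul_right h5 (by omega)
  · have : (#S).choose (j + 1) = 0 := Nat.choose_eq_zero_of_lt (by omega)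
    simp only [this, Nat.cast_zero, div_zero]
    positivity

lemma Ex_layer (p : ℝ) (S : Finset E) (P : Finset E → Prop) [DecidablePred P] :
    Ex p S (fun H => if P H then 1 else 0) =
      ∑ j ∈ range (#S + 1), p ^ j * (1 - p) ^ (#S - j) * (#((powersetCard j S).filter P) : ℝ) := by
  unfold Ex
  rw [Finset.sum_powerset]
  refine Finset.sum_congr rfl fun j _ => ?_
  rw [Finset.card_filter]
  push_cast
  rw [Finset.mul_sum]
  refine Finset.sum_congr rfl fun H hH => ?_
  rw [(mem_powersetCard.1 hH).2]

lemma transfer {p : ℝ} (h0 : 0 ≤ p) (h1 : p ≤ 1) (S : Finset E) (bad : Finset E → Prop) [DecidablePred bad]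
    (hdown : ∀ H H', H' ⊆ H → bad H → bad H') {M : ℕ} (hM : 0 < M) :
    (#((powersetCard M S).filter bad) : ℝ) / (#S).choose M * (1 - p * #S / M) ≤
      Ex p S (fun H => if bad H then 1 else 0) := by
  have hM' : (0:ℝ) < M := by exact_mod_cast hM
  set φ := (#((powersetCard M S).filter bad) : ℝ) / (#S).choose M with hφ
  have hφ0 : 0 ≤ φ := by positivity
  have mk : 1 - p * #S / M ≤ Ex p S (fun H => if #H ≤ M then 1 else 0) := by
    have e : 1 - p * #S / M = Ex p S (fun H => 1 - (1 / M) * (#H : ℝ)) := by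
      rw [Ex_sub, Ex_const, Ex_mul, Ex_card]; ring
    rw [e]
    apply Ex_mono h0 h1
    intro H _
    split_ifs with h
    · have : (0:ℝ) ≤ 1 / M * #H := by positivity
      linarith
    · have : (M:ℝ) ≤ #H := by exact_mod_cast (by omega : M ≤ #H)
      have : 1 ≤ 1 / M * (#H : ℝ) := by
        rw [div_mul_eq_mul_div, le_div_iff₀ hM']; linarith
      linarith
  refine (mul_le_mul_of_nonneg_left mk hφ0).trans ?_
  rw [Ex_layer, Ex_layer, Finset.mul_sum]
  refine Finset.sum_le_sum fun j hj => ?_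
  have hq : 0 ≤ 1 - p := by linarith
  have hw : 0 ≤ p ^ j * (1 - p) ^ (#S - j) := by positivity
  rw [mul_left_comm]
  apply mul_le_mul_of_nonneg_left _ hw
  have hjS : j ≤ #S := by rw [mem_range] at hj; omega
  have hc : (0:ℝ) < (#S).choose j := by exact_mod_cast Nat.choose_pos hjS
  by_cases hjM : j ≤ M
  · have h2 := bad_frac_anti S bad hdown hjM
    simp only at h2
    rw [← hφ] at h2
    have h3 : (#((powersetCard j S).filter (fun H => #H ≤ M)) : ℝ) ≤ (#S).choose j := by
      rw [← card_powersetCard]; exact_mod_cast card_filter_le _ _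
    calc φ * _ ≤ φ * (#S).choose j := mul_le_mul_of_nonneg_left h3 hφ0
      _ ≤ _ := by rwa [← le_div_iff₀ hc]
  · have : (powersetCard j S).filter (fun H => #H ≤ M) = ∅ := by
      apply filter_eq_empty_iff.2
      intro H hH
      rw [(mem_powersetCard.1 hH).2]; exact hjM
    rw [this, card_empty, Nat.cast_zero, mul_zero]
    positivity

end transferSec

lemma E_uu_restrict (r n : ℕ) (p : ℝ) :
    EQ r (2 * n) p (fun H => uu r H n) = Ex p (powersetCard r (range n)) (fun H => uu r H n) := by
  unfold EQ
  apply Ex_restrict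
  · exact powersetCard_mono (range_subset_range.2 (by omega))
  · intro H₁ H₂ h1 h2
    have : nv r (H₁ ∪ H₂) n = nv r H₂ n := by
      apply past_nv r n
      intro e he
      rw [mem_union]
      refine ⟨fun h => h.resolve_left fun h' => ?_, Or.inr⟩
      have := h1 h'
      rw [mem_sdiff, mem_powersetCard, mem_powersetCard] at this
      exact this.2 ⟨he, this.1.2⟩
    rw [uu_eq, uu_eq, this]

lemma uu_of_bad {r n : ℕ} (hr : 1 ≤ r) (hrn : r ∣ n) {H : Finset (Finset ℕ)}
    (hbad : ¬ 0 < pmCount (range n) H) : 1 ≤ uu r H n := by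
  have h1 := nv_le_div (H := H) hr n
  have h2 : nv r H n ≠ n / r := by
    intro h
    apply hbad
    apply pm_of_nu (r := r) _ (pmCount (range n)) (fun H => rfl)
    change r * nv r H n = n
    rw [h, Nat.mul_div_cancel' hrn]
  have h3 : (nv r H n : ℝ) + 1 ≤ (n / r : ℕ) := by exact_mod_cast (by omega : nv r H n + 1 ≤ n / r)
  have hr' : (1:ℝ) ≤ r := by exact_mod_cast hr
  rw [uu_eq]
  nlinarith

lemma pmCount_mono (V : Finset ℕ) {H H' : Finset (Finset ℕ)} (h : H' ⊆ H) : pmCount V H' ≤ pmCount V H :=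
  card_le_card (filter_subset_filter _ (powerset_mono.2 h))

/-- **Shamir's problem, asymptotic version (Theorem 1).** For fixed `r ≥ 3` and `ε > 0`,
if `M > (1+ε)(n/r)·log n`, then `H^r_{n,M}` has a perfect matching w.h.p. -/
theorem shamir_asymptotic (r : ℕ) (hr : 3 ≤ r) (ε : ℝ) (hε : 0 < ε)
    (ρ : ℝ) (hρ : 0 < ρ) :
    ∃ n₀ : ℕ, ∀ n : ℕ, n₀ ≤ n → r ∣ n → ∀ M : ℕ,
      (1 + ε) * ((n : ℝ) / r) * Real.log n < M → M ≤ n.choose r →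
      1 - ρ ≤
        (((Finset.powersetCard M (Kn n r)).filter
            (fun H => 0 < pmCount (Finset.range n) H)).card : ℝ) /
          ((Finset.powersetCard M (Kn n r)).card : ℝ) := by
  have hr0 : (3:ℝ) ≤ r := by exact_mod_cast hr
  set ε' := min ε 1 / 2 with hε'
  have hm0 : 0 < min ε 1 := lt_min hε one_pos
  have hm1 := min_le_left ε 1
  have hm2 := min_le_right ε 1
  have a1 : 0 < ε' := by rw [hε']; linarith
  have a2 : ε' ≤ 1 := by rw [hε']; linarith
  have a3 : ε' < ε := by rw [hε']; linarith
  set c := 1 - (1 + ε') / (1 + ε) with hc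
  have hc0 : 0 < c := by
    rw [hc, sub_pos, div_lt_one (by linarith)]; linarith
  have ev := claimA (r := r) (by omega) a1 a2 (mul_pos hρ hc0)
  obtain ⟨n₀, hn₀⟩ := Filter.eventually_atTop.1 (ev.and (Filter.eventually_ge_atTop r))
  refine ⟨n₀, fun n hn hrn M hM1 hM2 => ?_⟩
  obtain ⟨⟨hD, hL, hq1, hE⟩, hnr⟩ := hn₀ n hn
  set L := Real.log n with hLd
  set D := ((n - 1).choose (r - 1) : ℝ) with hDd
  set p := (1 + ε') * L / D with hp
  have hp0 : 0 ≤ p := by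
    have : 0 ≤ L := by linarith
    positivity
  have hn0 : (0:ℝ) < n := by
    have : (r:ℝ) ≤ n := by exact_mod_cast hnr
    linarith
  have hb : 0 < ((n:ℝ) / r) * L := by
    have : 0 < L := by linarith
    positivity
  have hM0' : (0:ℝ) < M := by
    refine lt_trans ?_ hM1
    rw [mul_assoc]; positivity
  have hM0 : 0 < M := by exact_mod_cast hM0'
  have hS : #(powersetCard r (range n)) = n.choose r := by rw [card_powersetCard, card_range]
  rw [E_uu_restrict] at hE
  have t1 : Ex p (powersetCard r (range n)) (fun H => if ¬ 0 < pmCount (range n) H then 1 else 0) ≤ ρ * c := by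
    refine le_trans (Ex_mono hp0 hq1 ?_) hE
    intro H _
    split_ifs with h
    · exact uu_nonneg (by omega) n
    · exact uu_of_bad (by omega) hrn h
  have t2 := transfer hp0 hq1 (powersetCard r (range n)) (fun H => ¬ 0 < pmCount (range n) H)
    (fun H H' hs hb hpos => hb (lt_of_lt_of_le hpos (pmCount_mono _ hs))) hM0
  have t3 := t2.trans t1
  rw [hS] at t3
  set φ := (#((powersetCard M (powersetCard r (range n))).filter
    (fun H => ¬ 0 < pmCount (range n) H)) : ℝ) / (n.choose r).choose M with hφ
  have hφ0 : 0 ≤ φ := by positivity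
  have hpN : p * n.choose r = (1 + ε') * (n / r * L) := by
    have e := choose_rel3 (r := r) (m := n) (by omega) hnr
    rw [← hDd] at e
    have e2 : ((n.choose r : ℕ) : ℝ) = n * D / r := by
      rw [eq_div_iff (by linarith)]; linarith
    rw [e2, hp]
    have : (0:ℝ) < r := by linarith
    field_simp
  have hcle : c ≤ 1 - p * n.choose r / M := by
    rw [hc, hpN]
    have : (1 + ε') * (n / r * L) / M ≤ (1 + ε') / (1 + ε) := by
      rw [div_le_div_iff₀ hM0' (by linarith)]
      have h1 : (1 + ε) * (n / r * L) ≤ M := by rw [← mul_assoc]; exact hM1.le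
      have := mul_le_mul_of_nonneg_left h1 (by linarith : 0 ≤ 1 + ε')
      linarith
    linarith
  have hφρ : φ ≤ ρ :=
    le_of_mul_le_mul_right ((mul_le_mul_of_nonneg_left hcle hφ0).trans t3) hc0
  have hcard : #(powersetCard M (Kn n r)) = (n.choose r).choose M := by
    rw [card_powersetCard]; unfold Kn; rw [hS]
  have hCpos : (0:ℝ) < (n.choose r).choose M := by exact_mod_cast Nat.choose_pos hM2
  have hsum := Finset.card_filter_add_card_filter_not (s := powersetCard M (Kn n r))
    (fun H => 0 < pmCount (range n) H)
  rw [hcard] at hsum ⊢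
  have hsum' : (#((powersetCard M (Kn n r)).filter (fun H => 0 < pmCount (range n) H)) : ℝ) +
      #((powersetCard M (Kn n r)).filter (fun H => ¬ 0 < pmCount (range n) H)) = (n.choose r).choose M := by
    exact_mod_cast hsum
  have hfin : (#((powersetCard M (Kn n r)).filter (fun H => 0 < pmCount (range n) H)) : ℝ) /
      (n.choose r).choose M = 1 - φ := by
    rw [hφ, eq_sub_iff_add_eq, ← add_div, div_eq_one_iff_eq hCpos.ne']
    exact hsum'
  rw [hfin]
  linarith
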